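/- Let A be a real symmetric positive definite 3×3 matrix, Q(x) = xᵀAx, κ > 0 and 4 ≤ p < ∞. There exists C = C(A, p, κ) such that for all λ > 1, all δ with λ^{κ−1} < δ < 1, and every ν ∈ ℝ³ with Q(ν) = 1, the following holds: for every finitely supported a : ℤ³ → ℂ vanishing outside the angular sector of the shell {k ∈ ℤ³ : |√(Q(k)) − λ| < δ and |k/√(Q(k)) − ν| < δ}, one has ‖f‖_{L^p} ≤ C (λ^{1 − 3/p} δ^{1/2} + (λδ)^{1/2 − 1/p}) ‖a‖_{ℓ²}. -/

import Mathlib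

open MeasureTheory

noncomputable def trigSum (a : (Fin 3 → ℤ) →₀ ℂ) (x : Fin 3 → ℝ) : ℂ :=
  ∑ k ∈ a.support, a k * Complex.exp (2 * Real.pi * Complex.I * ((∑ i, (k i : ℝ) * x i : ℝ) : ℂ))

noncomputable def lpNorm (p : ℝ) (a : (Fin 3 → ℤ) →₀ ℂ) : ℝ :=
  (∫ x in (Set.univ.pi fun _ : Fin 3 => Set.Icc (0:ℝ) 1), ‖trigSum a x‖ ^ p) ^ (1 / p)

noncomputable def l2Norm (a : (Fin 3 → ℤ) →₀ ℂ) : ℝ :=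
  (∑ k ∈ a.support, ‖a k‖ ^ 2) ^ ((1:ℝ) / 2)

noncomputable def Qform (A : Matrix (Fin 3) (Fin 3) ℝ) (x : Fin 3 → ℝ) : ℝ :=
  ∑ i, ∑ j, A i j * x i * x j

noncomputable def enorm3 (x : Fin 3 → ℝ) : ℝ := Real.sqrt (∑ i, x i ^ 2)

namespace ShellCap

open Complex Metric
open scoped ENNReal InnerProductSpace ComplexConjugate

/-- Three dimensional Euclidean space. -/
abbrev E3 := EuclideanSpace ℝ (Fin 3)

/-- The normalised rotation invariant measure on the unit sphere. -/
noncomputable def sphereMeasure : Measure E3 :=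
  (volume (ball (0 : E3) 1))⁻¹ • (volume.restrict (ball (0 : E3) 1)).map (fun x => ‖x‖⁻¹ • x)

lemma measurable_normalize : Measurable (fun x : E3 => ‖x‖⁻¹ • x) := by
  fun_prop

instance isProbabilityMeasure_sphereMeasure : IsProbabilityMeasure sphereMeasure := by
  constructor
  rw [sphereMeasure, Measure.smul_apply, Measure.map_apply measurable_normalize MeasurableSet.univ]
  simp only [Set.preimage_univ, Measure.restrict_apply_univ, smul_eq_mul]
  exact ENNReal.inv_mul_cancel (measure_ball_pos _ _ one_pos).ne' measure_ball_lt_top.ne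

lemma ae_norm_eq_one : ∀ᵐ ω ∂sphereMeasure, ‖ω‖ = 1 := by
  have hne : volume (ball (0 : E3) 1) ≠ ∞ := measure_ball_lt_top.ne
  refine Measure.ae_smul_measure (μ := (volume.restrict (ball (0 : E3) 1)).map _) ?_ _
  rw [ae_map_iff measurable_normalize.aemeasurable (measurableSet_eq_fun (by fun_prop) (by fun_prop))]
  have : ∀ᵐ x : E3 ∂volume.restrict (ball (0 : E3) 1), x ≠ 0 :=
    ae_restrict_of_ae (by simp [ae_iff])
  filter_upwards [this] with x hx
  rw [norm_smul, norm_inv, norm_norm, inv_mul_cancel₀ (norm_ne_zero_iff.2 hx)]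

lemma measurePreserving_sphereMeasure (g : E3 ≃ₗᵢ[ℝ] E3) :
    MeasurePreserving g sphereMeasure sphereMeasure := by
  refine ⟨g.continuous.measurable, ?_⟩
  rw [sphereMeasure, Measure.map_smul, Measure.map_map g.continuous.measurable measurable_normalize]
  have h1 : (g ∘ fun x : E3 => ‖x‖⁻¹ • x) = (fun x : E3 => ‖x‖⁻¹ • x) ∘ g := by
    ext1 x; simp
  rw [h1, ← Measure.map_map measurable_normalize g.continuous.measurable]
  have h2 := (g.measurePreserving.restrict_preimage (s := ball (0 : E3) 1) measurableSet_ball).map_eq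
  rw [LinearIsometryEquiv.preimage_ball, map_zero] at h2
  rw [h2]

/-- Rotation by the angle `θ` in the coordinate plane spanned by the axes `i` and `j`. -/
noncomputable def planeRotationMap (i j : Fin 3) (θ : ℝ) : E3 →ₗ[ℝ] E3 where
  toFun ω := ω + ((Real.cos θ - 1) * ω i - Real.sin θ * ω j) • EuclideanSpace.single i (1 : ℝ) +
    (Real.sin θ * ω i + (Real.cos θ - 1) * ω j) • EuclideanSpace.single j (1 : ℝ)
  map_add' x y := by ext k; simp; split_ifs <;> ring
  map_smul' c x := by ext k; simp; split_ifs <;> ring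

lemma norm_planeRotationMap {i j : Fin 3} (hij : i ≠ j) (θ : ℝ) (ω : E3) :
    ‖planeRotationMap i j θ ω‖ = ‖ω‖ := by
  rw [EuclideanSpace.norm_eq, EuclideanSpace.norm_eq]
  congr 1
  have := Real.sin_sq_add_cos_sq θ
  simp only [Fin.sum_univ_three, Real.norm_eq_abs, sq_abs, planeRotationMap]
  fin_cases i <;> fin_cases j <;> simp at hij ⊢ <;> grind

/-- The rotation `planeRotationMap` as a linear isometry. -/
noncomputable def planeRotation {i j : Fin 3} (hij : i ≠ j) (θ : ℝ) : E3 ≃ₗᵢ[ℝ] E3 :=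
  LinearIsometry.toLinearIsometryEquiv
    ⟨planeRotationMap i j θ, norm_planeRotationMap hij θ⟩ rfl

/-- The complex bilinear pairing of `w` with a real vector. -/
noncomputable def cdot (w : Fin 3 → ℂ) (x : E3) : ℂ := ∑ i, w i * (x i : ℂ)

lemma continuous_cdot (w : Fin 3 → ℂ) : Continuous (cdot w) := by
  unfold cdot; fun_prop

lemma norm_cdot_le (w : Fin 3 → ℂ) {x : E3} (hx : ‖x‖ = 1) : ‖cdot w x‖ ≤ ∑ i, ‖w i‖ := by
  refine (norm_sum_le _ _).trans (Finset.sum_le_sum fun i _ => ?_)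
  rw [norm_mul, Complex.norm_real]
  have := PiLp.norm_apply_le x i
  rw [hx] at this
  exact mul_le_of_le_one_right (norm_nonneg _) this

lemma sphere_integrable {F : E3 → ℂ} (hF : Continuous F) : Integrable F sphereMeasure := by
  obtain ⟨C, hC⟩ := (isCompact_sphere (0 : E3) 1).exists_bound_of_continuousOn hF.continuousOn
  refine Integrable.of_bound hF.aestronglyMeasurable C ?_
  filter_upwards [ae_norm_eq_one] with ω hω
  exact hC ω (by simpa using hω)

lemma planeRotation_apply {i j : Fin 3} (hij : i ≠ j) (θ : ℝ) (ω : E3) :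
    planeRotation hij θ ω = planeRotationMap i j θ ω := rfl

lemma sphere_rotation_identity (w : Fin 3 → ℂ) {i j : Fin 3} (hij : i ≠ j) :
    ∫ ω, ((w j * (ω i : ℂ) - w i * (ω j : ℂ)) ^ 2 - (w i * (ω i : ℂ) + w j * (ω j : ℂ))) *
      exp (cdot w ω) ∂sphereMeasure = 0 := by
  set F : E3 → ℂ := fun x => (w j * (x i : ℂ) - w i * (x j : ℂ)) * exp (cdot w x) with hF
  set G : E3 → ℂ := fun ω => ((w j * (ω i : ℂ) - w i * (ω j : ℂ)) ^ 2 -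
    (w i * (ω i : ℂ) + w j * (ω j : ℂ))) * exp (cdot w ω) with hG
  have hcd := continuous_cdot w
  have hFc : Continuous F := by fun_prop
  have hGc : Continuous G := by fun_prop
  obtain ⟨C, hC⟩ := (isCompact_sphere (0 : E3) 1).exists_bound_of_continuousOn hGc.continuousOn
  have hrot_i : ∀ θ (ω : E3), planeRotationMap i j θ ω i = Real.cos θ * ω i - Real.sin θ * ω j := by
    intro θ ω; simp [planeRotationMap, hij]; ring
  have hrot_j : ∀ θ (ω : E3), planeRotationMap i j θ ω j = Real.sin θ * ω i + Real.cos θ * ω j := by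
    intro θ ω; simp [planeRotationMap, hij.symm]; ring
  have hcdot : ∀ θ (ω : E3), cdot w (planeRotationMap i j θ ω) = cdot w ω +
      (((Real.cos θ - 1) * ω i - Real.sin θ * ω j : ℝ) * w i +
        (Real.sin θ * ω i + (Real.cos θ - 1) * ω j : ℝ) * w j) := by
    intro θ ω
    simp only [cdot, planeRotationMap, Fin.sum_univ_three]
    fin_cases i <;> fin_cases j <;> simp at hij ⊢ <;> ring
  have hderiv : ∀ θ (ω : E3), HasDerivAt (fun θ : ℝ => F (planeRotation hij θ ω))
      (G (planeRotation hij θ ω)) θ := by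
    intro θ ω
    have hc : HasDerivAt (fun θ : ℝ => ((Real.cos θ : ℝ) : ℂ)) ((-Real.sin θ : ℝ) : ℂ) θ :=
      (Real.hasDerivAt_cos θ).ofReal_comp
    have hs : HasDerivAt (fun θ : ℝ => ((Real.sin θ : ℝ) : ℂ)) ((Real.cos θ : ℝ) : ℂ) θ :=
      (Real.hasDerivAt_sin θ).ofReal_comp
    simp only [planeRotation_apply, hF, hG, hcdot, hrot_i, hrot_j]
    push_cast
    have h1 : HasDerivAt (fun θ : ℝ => w j * ((Real.cos θ : ℝ) * (ω i : ℂ) - (Real.sin θ : ℝ) * (ω j : ℂ)) -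
        w i * ((Real.sin θ : ℝ) * (ω i : ℂ) + (Real.cos θ : ℝ) * (ω j : ℂ))) _ θ :=
      (((hc.mul_const (ω i : ℂ)).sub (hs.mul_const (ω j : ℂ))).const_mul (w j)).sub
        (((hs.mul_const (ω i : ℂ)).add (hc.mul_const (ω j : ℂ))).const_mul (w i))
    have h2 : HasDerivAt (fun θ : ℝ => exp (cdot w ω +
        ((((Real.cos θ : ℝ) - 1) * (ω i : ℂ) - (Real.sin θ : ℝ) * (ω j : ℂ)) * w i +
        ((Real.sin θ : ℝ) * (ω i : ℂ) + ((Real.cos θ : ℝ) - 1) * (ω j : ℂ)) * w j))) _ θ :=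
      ((((((hc.sub_const 1).mul_const (ω i : ℂ)).sub (hs.mul_const (ω j : ℂ))).mul_const (w i)).add
        (((hs.mul_const (ω i : ℂ)).add ((hc.sub_const 1).mul_const (ω j : ℂ))).mul_const (w j))).const_add
        (cdot w ω)).cexp
    have h3 := h1.mul h2
    push_cast at h3
    simp only [Pi.add_apply, Pi.sub_apply] at h3
    refine h3.congr_deriv ?_
    ring
  have key := hasDerivAt_integral_of_dominated_loc_of_deriv_le (μ := sphereMeasure)
    (F := fun θ ω => F (planeRotation hij θ ω)) (F' := fun θ ω => G (planeRotation hij θ ω))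
    (x₀ := (0 : ℝ)) (s := Set.univ) (bound := fun _ => C) Filter.univ_mem
    (Filter.Eventually.of_forall fun θ =>
      (hFc.comp (planeRotation hij θ).continuous).aestronglyMeasurable)
    (sphere_integrable (hFc.comp (planeRotation hij 0).continuous))
    (hGc.comp (planeRotation hij 0).continuous).aestronglyMeasurable
    (by
      filter_upwards [ae_norm_eq_one] with ω hω θ _
      exact hC _ (by simpa using hω))
    (integrable_const _)
    (Filter.Eventually.of_forall fun ω θ _ => hderiv θ ω)
  have hconst : (fun θ : ℝ => ∫ ω, F (planeRotation hij θ ω) ∂sphereMeasure) =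
      fun _ => ∫ ω, F ω ∂sphereMeasure := by
    ext1 θ
    exact (measurePreserving_sphereMeasure (planeRotation hij θ)).integral_comp
      (planeRotation hij θ).toHomeomorph.measurableEmbedding F
  have h0 := key.2
  rw [hconst] at h0
  have h1 := h0.unique (hasDerivAt_const (0 : ℝ) _)
  rwa [(measurePreserving_sphereMeasure (planeRotation hij 0)).integral_comp
      (planeRotation hij 0).toHomeomorph.measurableEmbedding G] at h1

/-- The Laplace transform of the sphere measure satisfies the radial differential equation. -/
lemma sphere_moment_identity (w : Fin 3 → ℂ) (z : ℂ) (hz : z ^ 2 = ∑ i, w i ^ 2) (c : ℝ) :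
    c * (z ^ 2 * ∫ ω, exp (c * cdot w ω) ∂sphereMeasure -
      ∫ ω, cdot w ω ^ 2 * exp (c * cdot w ω) ∂sphereMeasure) =
      2 * ∫ ω, cdot w ω * exp (c * cdot w ω) ∂sphereMeasure := by
  have hcont := continuous_cdot w
  rcases eq_or_ne c 0 with rfl | hc
  · have h := (measurePreserving_sphereMeasure (LinearIsometryEquiv.neg ℝ)).integral_comp
      (LinearIsometryEquiv.neg ℝ).toHomeomorph.measurableEmbedding (cdot w)
    have h2 : ∀ x : E3, cdot w (LinearIsometryEquiv.neg ℝ x) = -cdot w x := by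
      intro x; simp [cdot]
    simp only [h2, integral_neg] at h
    have h3 : ∫ ω, cdot w ω ∂sphereMeasure = 0 := by
      linear_combination (-1 / 2 : ℂ) * h
    simp [h3]
  have hcd : ∀ ω, cdot (fun i => c * w i) ω = c * cdot w ω := by
    intro ω; simp only [cdot, Finset.mul_sum]; congr 1; ext i; ring
  have h01 := sphere_rotation_identity (fun i => c * w i) (i := 0) (j := 1) (by decide)
  have h02 := sphere_rotation_identity (fun i => c * w i) (i := 0) (j := 2) (by decide)
  have h12 := sphere_rotation_identity (fun i => c * w i) (i := 1) (j := 2) (by decide)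
  simp only [hcd] at h01 h02 h12
  have i0 : Integrable (fun ω => exp (c * cdot w ω)) sphereMeasure :=
    sphere_integrable (by fun_prop)
  have i1 : Integrable (fun ω => cdot w ω * exp (c * cdot w ω)) sphereMeasure :=
    sphere_integrable (by fun_prop)
  have i2 : Integrable (fun ω => cdot w ω ^ 2 * exp (c * cdot w ω)) sphereMeasure :=
    sphere_integrable (by fun_prop)
  have hsum : (c : ℂ) * (c * (z ^ 2 * ∫ ω, exp (c * cdot w ω) ∂sphereMeasure -
      ∫ ω, cdot w ω ^ 2 * exp (c * cdot w ω) ∂sphereMeasure) -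
      2 * ∫ ω, cdot w ω * exp (c * cdot w ω) ∂sphereMeasure) = 0 + 0 + 0 := by
    rw [← integral_const_mul, ← integral_const_mul, ← integral_sub (i0.const_mul _) i2,
      ← integral_const_mul, ← integral_sub (sphere_integrable (by fun_prop)) (i1.const_mul _),
      ← integral_const_mul]
    conv_rhs => enter [2]; rw [← h12]
    conv_rhs => enter [1, 1]; rw [← h01]
    conv_rhs => enter [1, 2]; rw [← h02]
    rw [← integral_add (sphere_integrable (by fun_prop)) (sphere_integrable (by fun_prop)),
      ← integral_add (sphere_integrable (by fun_prop)) (sphere_integrable (by fun_prop))]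
    refine integral_congr_ae ?_
    filter_upwards [ae_norm_eq_one] with ω hω
    have h1 : (ω 0 : ℂ) ^ 2 + (ω 1 : ℂ) ^ 2 + (ω 2 : ℂ) ^ 2 = 1 := by
      have := EuclideanSpace.norm_sq_eq ω
      rw [hω, Fin.sum_univ_three] at this
      simp only [Real.norm_eq_abs, sq_abs] at this
      exact_mod_cast this.symm.trans (one_pow 2)
    simp only [hz, cdot, Fin.sum_univ_three]
    linear_combination (-(c : ℂ) ^ 2 * (w 0 ^ 2 + w 1 ^ 2 + w 2 ^ 2) *
      exp (c * (w 0 * ω 0 + w 1 * ω 1 + w 2 * ω 2))) * h1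
  rw [add_zero, add_zero] at hsum
  have h4 := (mul_eq_zero.1 hsum).resolve_left (by exact_mod_cast hc)
  linear_combination h4

lemma hasDerivAt_sphere_moment (w : Fin 3 → ℂ) (n : ℕ) (c : ℝ) :
    HasDerivAt (fun c : ℝ => ∫ ω, cdot w ω ^ n * exp (c * cdot w ω) ∂sphereMeasure)
      (∫ ω, cdot w ω ^ (n + 1) * exp (c * cdot w ω) ∂sphereMeasure) c := by
  have hcont := continuous_cdot w
  set W := ∑ i, ‖w i‖
  have hW : 0 ≤ W := Finset.sum_nonneg fun i _ => norm_nonneg _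
  refine (hasDerivAt_integral_of_dominated_loc_of_deriv_le (μ := sphereMeasure)
    (F := fun (c : ℝ) ω => cdot w ω ^ n * exp (c * cdot w ω))
    (F' := fun c ω => cdot w ω ^ (n + 1) * exp (c * cdot w ω))
    (s := Metric.ball c 1) (bound := fun _ => W ^ (n + 1) * Real.exp ((|c| + 1) * W))
    (Metric.ball_mem_nhds _ one_pos)
    (Filter.Eventually.of_forall fun θ => Continuous.aestronglyMeasurable (by fun_prop))
    (sphere_integrable (by fun_prop))
    (Continuous.aestronglyMeasurable (by fun_prop)) ?_ (integrable_const _) ?_).2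
  · filter_upwards [ae_norm_eq_one] with ω hω x hx
    have h1 := norm_cdot_le w hω
    rw [norm_mul, norm_pow, norm_exp]
    have hx' : |x| ≤ |c| + 1 := by
      have : |x - c| < 1 := by simpa [Real.dist_eq] using hx
      have := abs_sub_abs_le_abs_sub x c
      linarith
    gcongr
    calc ((x : ℂ) * cdot w ω).re ≤ ‖(x : ℂ) * cdot w ω‖ := re_le_norm _
      _ = |x| * ‖cdot w ω‖ := by rw [norm_mul, norm_real, Real.norm_eq_abs]
      _ ≤ _ := by gcongr
  · refine Filter.Eventually.of_forall fun ω x _ => ?_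
    have h1 : HasDerivAt (fun x : ℝ => (x : ℂ) * cdot w ω) (1 * cdot w ω) x :=
      (Complex.ofRealCLM.hasDerivAt (x := x)).mul_const _
    refine (h1.cexp.const_mul (cdot w ω ^ n)).congr_deriv ?_
    ring

lemma sphere_laplace (w : Fin 3 → ℂ) (z : ℂ) (hz : z ^ 2 = ∑ i, w i ^ 2) :
    ∫ ω, exp (cdot w ω) ∂sphereMeasure = exp (-z) * ∫ t in (0 : ℝ)..1, exp (2 * z * t) := by
  set I : ℕ → ℝ → ℂ := fun n c => ∫ ω, cdot w ω ^ n * exp (c * cdot w ω) ∂sphereMeasure with hI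
  have hd : ∀ n c, HasDerivAt (I n) (I (n + 1) c) c := hasDerivAt_sphere_moment w
  have hcoe : ∀ c : ℝ, HasDerivAt (fun c : ℝ => (c : ℂ)) 1 c := fun c =>
    Complex.ofRealCLM.hasDerivAt (x := c)
  have hode : ∀ c, c * (z ^ 2 * I 0 c - I 2 c) = 2 * I 1 c := by
    intro c
    simpa [hI] using sphere_moment_identity w z hz c
  have hez : ∀ (a : ℂ) (c : ℝ), HasDerivAt (fun c : ℝ => exp (a * c)) (exp (a * c) * a) c := by
    intro a c
    simpa using ((hcoe c).const_mul a).cexp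
  have h1 : ∀ c : ℝ, (I 0 c + c * I 1 c + z * (c * I 0 c)) * exp (-z * c) = 1 := by
    have hder : ∀ c : ℝ, HasDerivAt
        (fun c : ℝ => (I 0 c + c * I 1 c + z * (c * I 0 c)) * exp (-z * c)) 0 c := by
      intro c
      have := ((((hd 0 c).add ((hcoe c).mul (hd 1 c))).add
        (((hcoe c).mul (hd 0 c)).const_mul z)).mul (hez (-z) c))
      refine this.congr_deriv ?_
      simp only [Pi.add_apply, Pi.mul_apply]
      linear_combination (-exp (-z * c)) * hode c
    intro c
    have := is_const_of_deriv_eq_zero (fun c => (hder c).differentiableAt)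
      (fun c => (hder c).deriv) c 0
    rw [this]
    simp [hI]
  have h2 : ∀ c : ℝ, HasDerivAt (fun c : ℝ => c * I 0 c * exp (z * c)) (exp (2 * z * c)) c := by
    intro c
    refine (((hcoe c).mul (hd 0 c)).mul (hez z c)).congr_deriv ?_
    have e1 : exp (2 * z * c) = exp (z * c) * exp (z * c) := by rw [← Complex.exp_add]; ring_nf
    have e2 : exp (-z * c) * exp (z * c) = 1 := by rw [← Complex.exp_add]; simp
    simp only [Pi.mul_apply]
    rw [e1]
    linear_combination (exp (z * c) * exp (z * c)) * h1 c -
      exp (z * c) * (I 0 c + c * I 1 c + z * (c * I 0 c)) * e2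
  have h3 := intervalIntegral.integral_eq_sub_of_hasDerivAt (a := 0) (b := 1)
    (fun c _ => h2 c) (Continuous.intervalIntegrable (by fun_prop) _ _)
  rw [h3]
  simp only [hI, ofReal_one, ofReal_zero, pow_zero, one_mul, mul_one, zero_mul, sub_zero]
  rw [mul_comm, mul_assoc, ← Complex.exp_add]
  simp

lemma norm_sphere_laplace_le {w : Fin 3 → ℂ} {z : ℂ} (hz : z ^ 2 = ∑ i, w i ^ 2) (hre : 0 ≤ z.re) :
    ‖∫ ω, exp (cdot w ω) ∂sphereMeasure‖ ≤ Real.exp z.re := by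
  rw [sphere_laplace w z hz, norm_mul, norm_exp, neg_re]
  have h : ‖∫ t in (0 : ℝ)..1, exp (2 * z * t)‖ ≤ Real.exp (2 * z.re) * |1 - 0| := by
    refine intervalIntegral.norm_integral_le_of_norm_le_const fun t ht => ?_
    rw [Set.uIoc_of_le zero_le_one] at ht
    rw [norm_exp]
    have : (2 * z * (t : ℂ)).re = 2 * z.re * t := by simp
    rw [this]
    exact Real.exp_le_exp.2 (by nlinarith [ht.1, ht.2])
  calc _ ≤ Real.exp (-z.re) * (Real.exp (2 * z.re) * |1 - 0|) := by gcongr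
    _ = Real.exp z.re := by
      rw [sub_zero, abs_one, mul_one, ← Real.exp_add]; ring_nf

lemma sphere_laplace_eq {w : Fin 3 → ℂ} {z : ℂ} (hz : z ^ 2 = ∑ i, w i ^ 2) (hz0 : z ≠ 0) :
    ∫ ω, exp (cdot w ω) ∂sphereMeasure = (exp z - exp (-z)) / (2 * z) := by
  rw [sphere_laplace w z hz, integral_exp_mul_complex (by simpa using hz0)]
  simp only [ofReal_one, mul_one, ofReal_zero, mul_zero, Complex.exp_zero]
  rw [← mul_div_assoc, mul_sub, ← Complex.exp_add]
  ring_nf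

lemma norm_sphere_laplace_le_div {w : Fin 3 → ℂ} {z : ℂ} (hz : z ^ 2 = ∑ i, w i ^ 2)
    (hre : 0 ≤ z.re) (hz0 : z ≠ 0) :
    ‖∫ ω, exp (cdot w ω) ∂sphereMeasure‖ ≤ Real.exp z.re / ‖z‖ := by
  rw [sphere_laplace_eq hz hz0, norm_div, norm_mul, Complex.norm_ofNat]
  have h1 : ‖exp z - exp (-z)‖ ≤ 2 * Real.exp z.re := by
    refine (norm_sub_le _ _).trans ?_
    rw [norm_exp, norm_exp, neg_re]
    have : Real.exp (-z.re) ≤ Real.exp z.re := by gcongr; linarith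
    linarith
  have : 0 < ‖z‖ := norm_pos_iff.2 hz0
  rw [div_le_div_iff₀ (by positivity) this]
  nlinarith

lemma sphere_integrable_real {F : E3 → ℝ} (hF : Continuous F) : Integrable F sphereMeasure := by
  have h := (sphere_integrable (F := fun x => (F x : ℂ)) (by fun_prop)).re
  simpa using h

lemma cdot_ofReal (v ω : E3) : cdot (fun i => (v i : ℂ)) ω = ((⟪v, ω⟫_ℝ : ℝ) : ℂ) := by
  simp [cdot, PiLp.inner_apply, mul_comm]

lemma sphere_laplace_real (v : E3) :
    ∫ ω, Real.exp ⟪v, ω⟫_ℝ ∂sphereMeasure =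
      Real.exp (-‖v‖) * ∫ t in (0 : ℝ)..1, Real.exp (2 * ‖v‖ * t) := by
  have hz : ((‖v‖ : ℝ) : ℂ) ^ 2 = ∑ i, ((v i : ℝ) : ℂ) ^ 2 := by
    have := EuclideanSpace.norm_sq_eq v
    simp only [Real.norm_eq_abs, sq_abs] at this
    exact_mod_cast this
  have h := sphere_laplace (fun i => (v i : ℂ)) ‖v‖ hz
  simp only [cdot_ofReal] at h
  have e1 : ∀ ω : E3, exp ((⟪v, ω⟫_ℝ : ℝ) : ℂ) = ((Real.exp ⟪v, ω⟫_ℝ : ℝ) : ℂ) := by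
    intro ω; push_cast; rfl
  have e2 : ∀ t : ℝ, exp (2 * (‖v‖ : ℂ) * t) = ((Real.exp (2 * ‖v‖ * t) : ℝ) : ℂ) := by
    intro t; push_cast; rfl
  simp only [e1, e2] at h
  rw [integral_complex_ofReal, intervalIntegral.integral_ofReal] at h
  have e3 : exp (-(‖v‖ : ℂ)) = ((Real.exp (-‖v‖) : ℝ) : ℂ) := by push_cast; rfl
  rw [e3] at h
  exact_mod_cast h

lemma sphere_laplace_real_eq {v : E3} (hv : v ≠ 0) :
    ∫ ω, Real.exp ⟪v, ω⟫_ℝ ∂sphereMeasure =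
      Real.exp ‖v‖ * (1 - Real.exp (-(2 * ‖v‖))) / (2 * ‖v‖) := by
  have hv' : 0 < ‖v‖ := norm_pos_iff.2 hv
  rw [sphere_laplace_real]
  have h : ∫ t in (0 : ℝ)..1, Real.exp (2 * ‖v‖ * t) = (Real.exp (2 * ‖v‖) - 1) / (2 * ‖v‖) := by
    rw [intervalIntegral.integral_comp_mul_left (fun x => Real.exp x) (by positivity)]
    simp; field_simp
  rw [h, ← mul_div_assoc]
  congr 1
  rw [mul_sub, mul_sub, ← Real.exp_add, ← Real.exp_add]
  ring_nf

lemma sphere_laplace_real_le (v : E3) :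
    ∫ ω, Real.exp ⟪v, ω⟫_ℝ ∂sphereMeasure ≤ Real.exp ‖v‖ := by
  calc ∫ ω, Real.exp ⟪v, ω⟫_ℝ ∂sphereMeasure ≤ ∫ ω, Real.exp ‖v‖ ∂sphereMeasure := by
        refine integral_mono_ae (sphere_integrable_real (by fun_prop)) (integrable_const _) ?_
        filter_upwards [ae_norm_eq_one] with ω hω
        have := real_inner_le_norm v ω
        rw [hω, mul_one] at this
        exact Real.exp_le_exp.2 this
    _ = _ := by simp

lemma sphere_laplace_real_le_div {v : E3} (hv : v ≠ 0) :
    ∫ ω, Real.exp ⟪v, ω⟫_ℝ ∂sphereMeasure ≤ Real.exp ‖v‖ / (2 * ‖v‖) := by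
  have hv' : 0 < ‖v‖ := norm_pos_iff.2 hv
  rw [sphere_laplace_real_eq hv]
  gcongr
  have := Real.exp_pos ‖v‖
  have := Real.exp_pos (-(2 * ‖v‖))
  nlinarith

lemma le_sphere_laplace_real (v : E3) :
    Real.exp ‖v‖ / (1 + 2 * ‖v‖) ≤ ∫ ω, Real.exp ⟪v, ω⟫_ℝ ∂sphereMeasure := by
  rcases eq_or_ne v 0 with rfl | hv
  · simp
  have hv' : 0 < ‖v‖ := norm_pos_iff.2 hv
  rw [sphere_laplace_real_eq hv, mul_div_assoc, div_eq_mul_inv]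
  gcongr
  rw [inv_eq_one_div, div_le_div_iff₀ (by positivity) (by positivity)]
  have h1 : 2 * ‖v‖ + 1 ≤ Real.exp (2 * ‖v‖) := Real.add_one_le_exp _
  have h2 : Real.exp (-(2 * ‖v‖)) * Real.exp (2 * ‖v‖) = 1 := by rw [← Real.exp_add]; simp
  nlinarith [Real.exp_pos (-(2 * ‖v‖))]

/-- The Gaussian neighbourhood of the spherical cap of radius `lam` around `ν`. -/
noncomputable def capMultiplier (ν : E3) (lam β s : ℝ) (ξ : E3) : ℝ :=
  (lam / s) ^ 2 * ∫ ω, Real.exp (β * (⟪ν, ω⟫_ℝ - 1)) *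
    Real.exp (-(‖ξ - lam • ω‖ ^ 2 / (2 * s ^ 2))) ∂sphereMeasure

lemma capMultiplier_nonneg (ν : E3) (lam β s : ℝ) (ξ : E3) : 0 ≤ capMultiplier ν lam β s ξ :=
  mul_nonneg (sq_nonneg _) (integral_nonneg fun _ => by positivity)

lemma norm_sub_smul_sq (ξ : E3) (lam : ℝ) {ω : E3} (hω : ‖ω‖ = 1) :
    ‖ξ - lam • ω‖ ^ 2 = ‖ξ‖ ^ 2 + lam ^ 2 - 2 * lam * ⟪ξ, ω⟫_ℝ := by
  rw [norm_sub_sq_real, norm_smul, hω, inner_smul_right, mul_one, Real.norm_eq_abs, sq_abs]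
  ring

lemma capMultiplier_le {ν : E3} (hν : ‖ν‖ = 1) {lam β s : ℝ} (hlam : 0 < lam) (hβ : 0 ≤ β)
    (hs : 0 < s) (ξ : E3) : capMultiplier ν lam β s ξ ≤ 8 := by
  have h1 : ∫ ω, Real.exp (β * (⟪ν, ω⟫_ℝ - 1)) *
      Real.exp (-(‖ξ - lam • ω‖ ^ 2 / (2 * s ^ 2))) ∂sphereMeasure ≤
      Real.exp (-((‖ξ‖ ^ 2 + lam ^ 2) / (2 * s ^ 2))) *
        ∫ ω, Real.exp ⟪(lam / s ^ 2) • ξ, ω⟫_ℝ ∂sphereMeasure := by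
    rw [← integral_const_mul]
    refine integral_mono_ae (sphere_integrable_real (by fun_prop))
      (sphere_integrable_real (by fun_prop)) ?_
    filter_upwards [ae_norm_eq_one] with ω hω
    have h2 : Real.exp (β * (⟪ν, ω⟫_ℝ - 1)) ≤ 1 := by
      have := real_inner_le_norm ν ω
      rw [hω, hν, mul_one] at this
      exact Real.exp_le_one_iff.2 (mul_nonpos_of_nonneg_of_nonpos hβ (by linarith))
    refine (mul_le_of_le_one_left (by positivity) h2).trans_eq ?_
    rw [← Real.exp_add, norm_sub_smul_sq ξ lam hω, inner_smul_left]
    congr 1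
    simp only [conj_trivial]
    field_simp
    ring
  have hnorm : ‖(lam / s ^ 2) • ξ‖ = lam * ‖ξ‖ / s ^ 2 := by
    rw [norm_smul, Real.norm_of_nonneg (by positivity)]; ring
  have hexp : Real.exp (-((‖ξ‖ ^ 2 + lam ^ 2) / (2 * s ^ 2))) * Real.exp (lam * ‖ξ‖ / s ^ 2) =
      Real.exp (-((‖ξ‖ - lam) ^ 2 / (2 * s ^ 2))) := by
    rw [← Real.exp_add]; congr 1; field_simp; ring
  refine (mul_le_mul_of_nonneg_left h1 (sq_nonneg _)).trans ?_
  rcases le_or_gt (lam / 2) ‖ξ‖ with hξ | hξ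
  · have hξ0 : 0 < ‖ξ‖ := by linarith
    have hne : (lam / s ^ 2) • ξ ≠ 0 := by
      rw [← norm_pos_iff, hnorm]; positivity
    have h2 := sphere_laplace_real_le_div hne
    rw [hnorm] at h2
    calc (lam / s) ^ 2 * (Real.exp (-((‖ξ‖ ^ 2 + lam ^ 2) / (2 * s ^ 2))) *
        ∫ ω, Real.exp ⟪(lam / s ^ 2) • ξ, ω⟫_ℝ ∂sphereMeasure)
        ≤ (lam / s) ^ 2 * (Real.exp (-((‖ξ‖ ^ 2 + lam ^ 2) / (2 * s ^ 2))) *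
        (Real.exp (lam * ‖ξ‖ / s ^ 2) / (2 * (lam * ‖ξ‖ / s ^ 2)))) := by gcongr
      _ = Real.exp (-((‖ξ‖ - lam) ^ 2 / (2 * s ^ 2))) * (lam / (2 * ‖ξ‖)) := by
        rw [← hexp]; field_simp
      _ ≤ 1 * 1 := by
        gcongr
        · exact Real.exp_le_one_iff.2 (by rw [neg_nonpos]; positivity)
        · rw [div_le_one (by positivity)]; linarith
      _ ≤ 8 := by norm_num
  · have h2 := sphere_laplace_real_le ((lam / s ^ 2) • ξ)
    rw [hnorm] at h2
    have hx : lam ^ 2 / (8 * s ^ 2) ≤ Real.exp (lam ^ 2 / (8 * s ^ 2)) := by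
      linarith [Real.add_one_le_exp (lam ^ 2 / (8 * s ^ 2))]
    calc (lam / s) ^ 2 * (Real.exp (-((‖ξ‖ ^ 2 + lam ^ 2) / (2 * s ^ 2))) *
        ∫ ω, Real.exp ⟪(lam / s ^ 2) • ξ, ω⟫_ℝ ∂sphereMeasure)
        ≤ (lam / s) ^ 2 * (Real.exp (-((‖ξ‖ ^ 2 + lam ^ 2) / (2 * s ^ 2))) *
        Real.exp (lam * ‖ξ‖ / s ^ 2)) := by gcongr
      _ = 8 * (lam ^ 2 / (8 * s ^ 2)) * Real.exp (-((‖ξ‖ - lam) ^ 2 / (2 * s ^ 2))) := by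
        rw [← hexp]; field_simp
      _ ≤ 8 * Real.exp (lam ^ 2 / (8 * s ^ 2)) * Real.exp (-(lam ^ 2 / (8 * s ^ 2))) := by
        gcongr ?_ * Real.exp (-?_)
        · gcongr
        · rw [div_le_div_iff₀ (by positivity) (by positivity)]
          have : lam ^ 2 ≤ 4 * (‖ξ‖ - lam) ^ 2 := by nlinarith
          nlinarith [sq_pos_of_pos hs]
      _ = 8 := by rw [mul_assoc, ← Real.exp_add]; simp

/-- On the cap itself the multiplier is bounded below. -/
lemma le_capMultiplier {ν : E3} (hν : ‖ν‖ = 1) {lam δ s K : ℝ} (hlam : 1 < lam) (hδ : 0 < δ)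
    (hδ1 : δ < 1) (hs : δ ≤ s) (hs1 : s ≤ 1) (hsM : s ≤ lam * δ) {ξ : E3} (hξ : |‖ξ‖ - lam| < δ)
    (hξν : ‖‖ξ‖⁻¹ • ξ - ν‖ ≤ K * δ) :
    Real.exp (-(K ^ 2 + 1)) / 7 ≤ capMultiplier ν lam (1 / δ ^ 2) s ξ := by
  have hs0 : 0 < s := hδ.trans_le hs
  set β := 1 / δ ^ 2 with hβ
  have hβ0 : 0 < β := by positivity
  have hξ0 : 0 < ‖ξ‖ := by have := abs_lt.1 hξ; linarith
  set r := ‖ξ‖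
  set v := lam * r / s ^ 2 with hv
  have hv0 : 0 < v := by positivity
  have hinner : ⟪ν, ξ⟫_ℝ = r * (1 - ‖r⁻¹ • ξ - ν‖ ^ 2 / 2) := by
    have hu : ‖r⁻¹ • ξ‖ = 1 := by
      rw [norm_smul, norm_inv, norm_norm, inv_mul_cancel₀ hξ0.ne']
    rw [norm_sub_sq_real, hu, hν, inner_smul_left, real_inner_comm]
    simp only [conj_trivial]
    field_simp
    ring
  have hw2 : ‖β • ν + (lam / s ^ 2) • ξ‖ ^ 2 = (β + v) ^ 2 - β * v * ‖r⁻¹ • ξ - ν‖ ^ 2 := by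
    rw [norm_add_sq_real, norm_smul, norm_smul, inner_smul_left, inner_smul_right, hinner, hν,
      Real.norm_of_nonneg hβ0.le, Real.norm_of_nonneg (show 0 ≤ lam / s ^ 2 by positivity)]
    simp only [conj_trivial]
    rw [hv]
    ring
  set W := ‖β • ν + (lam / s ^ 2) • ξ‖
  have hW0 : 0 ≤ W := norm_nonneg _
  have hWle : W ≤ β + v := by
    have : 0 ≤ β * v * ‖r⁻¹ • ξ - ν‖ ^ 2 := by positivity
    exact abs_le_of_sq_le_sq' (by linarith) (by positivity) |>.2
  have hKβ : β * ‖r⁻¹ • ξ - ν‖ ^ 2 ≤ K ^ 2 := by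
    calc β * ‖r⁻¹ • ξ - ν‖ ^ 2 ≤ β * (K * δ) ^ 2 := by gcongr
      _ = K ^ 2 := by rw [hβ]; field_simp
  have hWge : β + v - K ^ 2 ≤ W := by
    by_contra! hlt
    have h1 : W ^ 2 < (β + v) * (β + v - K ^ 2) := by
      rcases hW0.eq_or_lt with h | h
      · rw [← h] at hlt ⊢
        have : 0 < (β + v) * (β + v - K ^ 2) := mul_pos (by positivity) hlt
        simpa using this
      · nlinarith
    nlinarith [sq_nonneg K]
  have hint : ∫ ω, Real.exp (β * (⟪ν, ω⟫_ℝ - 1)) *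
      Real.exp (-(‖ξ - lam • ω‖ ^ 2 / (2 * s ^ 2))) ∂sphereMeasure =
      Real.exp (-β - (r ^ 2 + lam ^ 2) / (2 * s ^ 2)) *
        ∫ ω, Real.exp ⟪β • ν + (lam / s ^ 2) • ξ, ω⟫_ℝ ∂sphereMeasure := by
    rw [← integral_const_mul]
    refine integral_congr_ae ?_
    filter_upwards [ae_norm_eq_one] with ω hω
    rw [← Real.exp_add, ← Real.exp_add, norm_sub_smul_sq ξ lam hω, inner_add_left, inner_smul_left,
      inner_smul_left]
    congr 1
    simp only [conj_trivial]
    field_simp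
    ring
  rw [capMultiplier, hint]
  have hlow := le_sphere_laplace_real (β • ν + (lam / s ^ 2) • ξ)
  have hE : Real.exp (-(K ^ 2 + 1)) ≤
      Real.exp (-β - (r ^ 2 + lam ^ 2) / (2 * s ^ 2)) * Real.exp W := by
    rw [← Real.exp_add]
    refine Real.exp_le_exp.2 ?_
    have h1 : (r ^ 2 + lam ^ 2) / (2 * s ^ 2) = v + (r - lam) ^ 2 / (2 * s ^ 2) := by
      rw [hv]; field_simp; ring
    have h2 : (r - lam) ^ 2 / (2 * s ^ 2) ≤ 1 := by
      rw [div_le_one (by positivity)]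
      have := sq_lt_sq' (abs_lt.1 hξ).1 (abs_lt.1 hξ).2
      nlinarith
    linarith
  have hden : 1 + 2 * W ≤ 7 * (lam / s) ^ 2 := by
    have hls : 1 ≤ (lam / s) ^ 2 := by
      rw [one_le_sq_iff₀ (by positivity), one_le_div hs0]; linarith
    have h1 : β ≤ (lam / s) ^ 2 := by
      rw [hβ, div_pow, div_le_div_iff₀ (by positivity) (by positivity), one_mul, ← mul_pow]
      gcongr
    have h2 : v ≤ 2 * (lam / s) ^ 2 := by
      have : r ≤ 2 * lam := by have := abs_lt.1 hξ; linarith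
      rw [hv, div_pow, ← mul_div_assoc]
      refine div_le_div_of_nonneg_right ?_ (by positivity)
      nlinarith
    linarith
  calc Real.exp (-(K ^ 2 + 1)) / 7 = (lam / s) ^ 2 * (Real.exp (-(K ^ 2 + 1)) / (7 * (lam / s) ^ 2)) := by
        field_simp
    _ ≤ (lam / s) ^ 2 * (Real.exp (-β - (r ^ 2 + lam ^ 2) / (2 * s ^ 2)) * Real.exp W / (1 + 2 * W)) := by
        gcongr
    _ ≤ _ := by
        rw [mul_div_assoc]
        gcongr

/-- The Laplace transform of the sphere at a complex frequency, normalised at `y = 0`. -/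
noncomputable def capLaplace (ν : E3) (lam β : ℝ) (y : E3) : ℂ :=
  exp (-β) * ∫ ω, exp (cdot (fun i => (β * ν i : ℝ) - I * (lam * y i : ℝ)) ω) ∂sphereMeasure

/-- The convolution kernel whose Fourier transform is `capMultiplier`. -/
noncomputable def capKernel (ν : E3) (lam β s : ℝ) (y : E3) : ℂ :=
  ((lam / s) ^ 2 * (2 * Real.pi / s ^ 2) ^ (-(3 / 2) : ℝ) : ℝ) *
    (Real.exp (-(s ^ 2 / 2 * ‖y‖ ^ 2)) * capLaplace ν lam β y)

lemma exists_sqrt_nonneg_re (ζ : ℂ) : ∃ z : ℂ, z ^ 2 = ζ ∧ 0 ≤ z.re := by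
  obtain ⟨z, hz⟩ := IsAlgClosed.exists_pow_nat_eq ζ two_pos
  rcases le_total 0 z.re with h | h
  · exact ⟨z, hz, h⟩
  · exact ⟨-z, by rw [neg_sq, hz], by simpa using h⟩

lemma cdot_kernel (ν y ω : E3) (lam β : ℝ) :
    cdot (fun i => (β * ν i : ℝ) - I * (lam * y i : ℝ)) ω =
      (β * ⟪ν, ω⟫_ℝ : ℝ) - I * (lam * ⟪ω, y⟫_ℝ : ℝ) := by
  have h1 : ((β * ⟪ν, ω⟫_ℝ : ℝ) : ℂ) = cdot (fun i => (β * ν i : ℝ)) ω := by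
    have := cdot_ofReal (β • ν) ω
    rw [inner_smul_left] at this
    simpa using this.symm
  have h2 : ((lam * ⟪ω, y⟫_ℝ : ℝ) : ℂ) = cdot (fun i => (lam * y i : ℝ)) ω := by
    have := cdot_ofReal (lam • y) ω
    rw [inner_smul_left, real_inner_comm] at this
    simpa using this.symm
  rw [h1, h2]
  simp only [cdot, Finset.mul_sum, ← Finset.sum_sub_distrib]
  exact Finset.sum_congr rfl fun i _ => by ring

lemma sum_sq_kernel {ν : E3} (hν : ‖ν‖ = 1) (y : E3) (lam β : ℝ) :
    ∑ i, ((β * ν i : ℝ) - I * (lam * y i : ℝ) : ℂ) ^ 2 =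
      ((β ^ 2 - (lam * ‖y‖) ^ 2 : ℝ) : ℂ) - ((2 * β * (lam * ⟪ν, y⟫_ℝ) : ℝ) : ℂ) * I := by
  have h1 : ∑ i, ν i ^ 2 = 1 := by
    have := EuclideanSpace.norm_sq_eq ν
    simp only [Real.norm_eq_abs, sq_abs, hν] at this
    linarith
  have h2 : ‖y‖ ^ 2 = ∑ i, y i ^ 2 := by
    have := EuclideanSpace.norm_sq_eq y
    simpa only [Real.norm_eq_abs, sq_abs] using this
  have h3 : ⟪ν, y⟫_ℝ = ∑ i, ν i * y i := by
    simp [PiLp.inner_apply, mul_comm]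
  have h4 : β ^ 2 - (lam * ‖y‖) ^ 2 = ∑ i, ((β * ν i) ^ 2 - (lam * y i) ^ 2) := by
    rw [Finset.sum_sub_distrib, mul_pow, h2, ← mul_one (β ^ 2), ← h1]
    simp only [Finset.mul_sum, mul_pow]
  have h5 : 2 * β * (lam * ⟪ν, y⟫_ℝ) = ∑ i, 2 * (β * ν i) * (lam * y i) := by
    rw [h3]; simp only [Finset.mul_sum]; exact Finset.sum_congr rfl fun i _ => by ring
  rw [h4, h5]
  push_cast
  rw [Finset.sum_mul, ← Finset.sum_sub_distrib]
  refine Finset.sum_congr rfl fun i _ => ?_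
  linear_combination ((lam : ℂ) * y i) ^ 2 * I_sq

lemma perp_norm_sq {ν : E3} (hν : ‖ν‖ = 1) (y : E3) :
    ‖y - ⟪ν, y⟫_ℝ • ν‖ ^ 2 = ‖y‖ ^ 2 - ⟪ν, y⟫_ℝ ^ 2 := by
  rw [norm_sub_sq_real, norm_smul, hν, inner_smul_right, real_inner_comm, mul_one,
    Real.norm_eq_abs, sq_abs]
  ring

/-- Size of the complex square root `p + iq` governing the kernel. -/
lemma kernel_root_bound {β p q Y a : ℝ} (hβ : 0 < β) (hp : 0 ≤ p)
    (h1 : p ^ 2 - q ^ 2 = β ^ 2 - Y ^ 2) (h2 : p * q = -(β * a)) (ha : a ^ 2 ≤ Y ^ 2) :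
    p ≤ β ∧ (β / 2 ≤ p → β * (Y ^ 2 - a ^ 2) / (8 * (β ^ 2 + a ^ 2)) ≤ β - p) ∧
      ((β + Y) ^ 2 ≤ 64 * (p ^ 2 + q ^ 2) ∨ p ≤ β / 2) := by
  have hid : (β ^ 2 - p ^ 2) * (p ^ 2 + a ^ 2) = (Y ^ 2 - a ^ 2) * p ^ 2 := by
    have : p ^ 2 * q ^ 2 = β ^ 2 * a ^ 2 := by rw [← mul_pow, h2]; ring
    nlinarith
  have hpβ : p ≤ β := by
    by_contra! h
    have h3 : 0 < (p ^ 2 - β ^ 2) * (p ^ 2 + a ^ 2) := by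
      apply mul_pos <;> nlinarith [sq_nonneg a]
    nlinarith [mul_nonneg (sub_nonneg.2 ha) (sq_nonneg p)]
  refine ⟨hpβ, fun hp2 => ?_, ?_⟩
  · have hpos : 0 < p := by linarith
    have e1 : β - p = (Y ^ 2 - a ^ 2) * (p ^ 2 / ((p ^ 2 + a ^ 2) * (β + p))) := by
      field_simp
      linarith
    have e2 : β / (8 * (β ^ 2 + a ^ 2)) ≤ p ^ 2 / ((p ^ 2 + a ^ 2) * (β + p)) := by
      rw [div_le_div_iff₀ (by positivity) (by positivity)]
      have f1 : β ^ 2 ≤ 4 * p ^ 2 := by nlinarith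
      have f2 : β * (β + p) ≤ 2 * β ^ 2 := by nlinarith
      have f3 : β * (β + p) * (p ^ 2 + a ^ 2) ≤ 2 * β ^ 2 * (p ^ 2 + a ^ 2) := by gcongr
      have f4 : 2 * β ^ 2 * a ^ 2 ≤ 8 * p ^ 2 * a ^ 2 := by
        have := mul_le_mul_of_nonneg_right f1 (sq_nonneg a); linarith
      have : 0 ≤ p ^ 2 * β ^ 2 := by positivity
      nlinarith
    rw [e1, mul_comm β, mul_div_assoc]
    exact mul_le_mul_of_nonneg_left e2 (by linarith)
  · by_contra! h
    obtain ⟨h3, h4⟩ := h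
    have h5 : Y ^ 2 ≤ β ^ 2 + q ^ 2 := by nlinarith
    nlinarith [sq_nonneg (β - Y), sq_nonneg q]

set_option maxHeartbeats 1000000 in
lemma kernel_decay {ν : E3} (hν : ‖ν‖ = 1) {lam δ : ℝ} (hδ : 0 < δ) (hM : 1 ≤ lam * δ) (y : E3) :
    ‖capLaplace ν lam (1 / δ ^ 2) y‖ * Real.exp (-(δ ^ 2 / 2 * ‖y‖ ^ 2)) ≤
      24 / (1 / δ ^ 2 + lam * ‖y‖) * (Real.exp (-(‖y - ⟪ν, y⟫_ℝ • ν‖ / 8)) *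
        Real.exp (-(δ ^ 2 / 4 * ‖y‖ ^ 2))) := by
  have hlam : 0 < lam := pos_of_mul_pos_left (by linarith) hδ.le
  set β := 1 / δ ^ 2 with hβ
  have hβ0 : 0 < β := by positivity
  obtain ⟨z, hz, hre⟩ := exists_sqrt_nonneg_re
    (((β ^ 2 - (lam * ‖y‖) ^ 2 : ℝ) : ℂ) - ((2 * β * (lam * ⟪ν, y⟫_ℝ) : ℝ) : ℂ) * I)
  have hz' := hz.trans (sum_sq_kernel hν y lam β).symm
  set Y := lam * ‖y‖ with hY
  set a := lam * ⟪ν, y⟫_ℝ with ha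
  set m := ‖y - ⟪ν, y⟫_ℝ • ν‖ with hm
  have hm0 : 0 ≤ m := norm_nonneg _
  have hm2 : m ^ 2 = ‖y‖ ^ 2 - ⟪ν, y⟫_ℝ ^ 2 := perp_norm_sq hν y
  have hmy : m ≤ ‖y‖ := abs_le_of_sq_le_sq' (by nlinarith [sq_nonneg ⟪ν, y⟫_ℝ]) (norm_nonneg _) |>.2
  have hY0 : 0 ≤ Y := by positivity
  have hYa : Y ^ 2 - a ^ 2 = lam ^ 2 * m ^ 2 := by rw [hm2, hY, ha]; ring
  have hr := congrArg Complex.re hz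
  have hi := congrArg Complex.im hz
  simp only [sq, mul_re, mul_im, sub_re, sub_im, ofReal_re, ofReal_im, I_re, I_im] at hr hi
  obtain ⟨hp1, hp2, hp3⟩ := kernel_root_bound (p := z.re) (q := z.im) (a := a) (Y := Y) hβ0 hre
    (by nlinarith) (by nlinarith) (by nlinarith [sq_nonneg (lam * m)])
  have hJ : ‖capLaplace ν lam β y‖ ≤ Real.exp (z.re - β) := by
    rw [capLaplace, norm_mul, norm_exp, sub_eq_neg_add, Real.exp_add]
    simp only [neg_re, ofReal_re]
    gcongr
    exact norm_sphere_laplace_le hz' hre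
  have hJ1 : ‖capLaplace ν lam β y‖ ≤ 12 / (β + Y) * Real.exp ((z.re - β) / 2) := by
    have hhalf : Real.exp (z.re - β) ≤ Real.exp ((z.re - β) / 2) :=
      Real.exp_le_exp.2 (by linarith)
    have hcase : (β + Y) ^ 2 ≤ 64 * (z.re ^ 2 + z.im ^ 2) ∨
      (¬ (β + Y) ^ 2 ≤ 64 * (z.re ^ 2 + z.im ^ 2) ∧ z.re ≤ β / 2) := by tauto
    have hnz : ‖z‖ ^ 2 = z.re ^ 2 + z.im ^ 2 := by rw [← normSq_eq_norm_sq, normSq_apply]; ring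
    rcases hcase with h | ⟨h, h'⟩
    · rw [← hnz] at h
      have h8 : β + Y ≤ 8 * ‖z‖ :=
        abs_le_of_sq_le_sq' (by nlinarith) (by positivity) |>.2
      have hz0 : 0 < ‖z‖ := by linarith
      have : ‖capLaplace ν lam β y‖ ≤ Real.exp (z.re - β) / ‖z‖ := by
        rw [capLaplace, norm_mul, norm_exp, sub_eq_neg_add, Real.exp_add, mul_div_assoc]
        simp only [neg_re, ofReal_re]
        gcongr
        exact norm_sphere_laplace_le_div hz' hre (norm_pos_iff.1 hz0)
      refine this.trans ?_
      rw [div_mul_eq_mul_div, div_le_div_iff₀ hz0 (by positivity)]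
      have := Real.exp_pos ((z.re - β) / 2)
      nlinarith
    · have hYβ : Y ≤ 2 * β := by
        push Not at h
        nlinarith [sq_nonneg z.re, sq_nonneg z.im]
      have h10 : (β + Y) / 12 ≤ Real.exp ((β + Y) / 12) := by
        linarith [Real.add_one_le_exp ((β + Y) / 12)]
      calc ‖capLaplace ν lam β y‖ ≤ Real.exp (z.re - β) := hJ
        _ = Real.exp ((z.re - β) / 2) * Real.exp ((z.re - β) / 2) := by
          rw [← Real.exp_add]; ring_nf
        _ ≤ Real.exp (-((β + Y) / 12)) * Real.exp ((z.re - β) / 2) := by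
          gcongr; linarith
        _ ≤ 12 / (β + Y) * Real.exp ((z.re - β) / 2) := by
          gcongr
          rw [Real.exp_neg, ← inv_div (β + Y)]
          exact inv_anti₀ (by positivity) h10
  have hE : Real.exp ((z.re - β) / 2) * Real.exp (-(δ ^ 2 / 2 * ‖y‖ ^ 2)) ≤
      2 * (Real.exp (-(m / 8)) * Real.exp (-(δ ^ 2 / 4 * ‖y‖ ^ 2))) := by
    have h2 : Real.exp (1 / 16) ≤ 2 := by
      have h := Real.exp_one_lt_d9
      have : Real.exp (1 / 16) ^ 16 ≤ 2 ^ 16 := by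
        rw [← Real.exp_nat_mul]; norm_num; linarith
      exact le_of_pow_le_pow_left₀ (by norm_num) (by norm_num) this
    refine le_trans ?_ (mul_le_mul_of_nonneg_right h2 (by positivity))
    rw [← Real.exp_add, ← Real.exp_add, ← Real.exp_add]
    refine Real.exp_le_exp.2 ?_
    rcases le_total (β / 2) z.re with h | h
    · have h3 := hp2 h
      set A := 1 + δ ^ 2 * ⟪ν, y⟫_ℝ ^ 2 with hA
      have hA0 : 0 < A := by positivity
      have h4 : m ^ 2 / (8 * A) ≤ β * (Y ^ 2 - a ^ 2) / (8 * (β ^ 2 + a ^ 2)) := by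
        rw [hYa, div_le_div_iff₀ (by positivity) (by positivity), ha, hA]
        have h5 : β ^ 2 + (lam * ⟪ν, y⟫_ℝ) ^ 2 ≤ β * lam ^ 2 * (1 + δ ^ 2 * ⟪ν, y⟫_ℝ ^ 2) := by
          have e1 : β * δ ^ 2 = 1 := by rw [hβ]; field_simp
          have e2 : β ≤ lam ^ 2 := by
            rw [hβ, div_le_iff₀ (by positivity), ← mul_pow]
            exact one_le_pow₀ hM
          calc β ^ 2 + (lam * ⟪ν, y⟫_ℝ) ^ 2 ≤ β * lam ^ 2 + (β * δ ^ 2) * (lam * ⟪ν, y⟫_ℝ) ^ 2 := by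
                rw [e1, one_mul, sq β]; gcongr
            _ = _ := by ring
        have := mul_le_mul_of_nonneg_left h5 (by positivity : 0 ≤ 8 * m ^ 2)
        nlinarith
      have h6 : m / 4 ≤ m ^ 2 / (8 * A) + A / 8 := by
        rw [div_add_div _ _ (by positivity) (by positivity), div_le_div_iff₀ (by positivity) (by positivity)]
        nlinarith [sq_nonneg (m - A)]
      have h7 : A ≤ 1 + δ ^ 2 * ‖y‖ ^ 2 := by
        have h9 : ⟪ν, y⟫_ℝ ^ 2 ≤ ‖y‖ ^ 2 := by nlinarith
        have := mul_le_mul_of_nonneg_left h9 (sq_nonneg δ)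
        linarith
      have h8 := mul_nonneg (sq_nonneg δ) (sq_nonneg ‖y‖)
      linarith
    · have h3 : ‖y‖ ≤ β / 2 + δ ^ 2 * ‖y‖ ^ 2 / 2 := by
        have e : β = (1 / δ) ^ 2 := by rw [hβ, div_pow, one_pow]
        have := sq_nonneg (1 / δ - δ * ‖y‖)
        have e2 : 1 / δ * δ = 1 := by field_simp
        nlinarith
      have h8 := mul_nonneg (sq_nonneg δ) (sq_nonneg ‖y‖)
      linarith
  calc ‖capLaplace ν lam β y‖ * Real.exp (-(δ ^ 2 / 2 * ‖y‖ ^ 2))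
      ≤ 12 / (β + Y) * Real.exp ((z.re - β) / 2) * Real.exp (-(δ ^ 2 / 2 * ‖y‖ ^ 2)) := by gcongr
    _ ≤ 12 / (β + Y) * (2 * (Real.exp (-(m / 8)) * Real.exp (-(δ ^ 2 / 4 * ‖y‖ ^ 2)))) := by
      rw [mul_assoc]; gcongr
    _ = _ := by ring

/-- The integrand of the Fourier representation of `capMultiplier`. -/
noncomputable def capIntegrand (ν : E3) (lam β s : ℝ) (ξ ω y : E3) : ℂ :=
  Real.exp (β * ⟪ν, ω⟫_ℝ) *
    exp (-((s ^ 2 / 2 : ℝ) : ℂ) * ‖y‖ ^ 2 + I * ((⟪ξ - lam • ω, y⟫_ℝ : ℝ) : ℂ))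

lemma continuous_capIntegrand (ν : E3) (lam β s : ℝ) (ξ : E3) :
    Continuous fun q : E3 × E3 => capIntegrand ν lam β s ξ q.1 q.2 := by
  unfold capIntegrand; fun_prop

lemma norm_capIntegrand (ν : E3) (lam β s : ℝ) (ξ ω y : E3) :
    ‖capIntegrand ν lam β s ξ ω y‖ =
      Real.exp (β * ⟪ν, ω⟫_ℝ) * Real.exp (-(s ^ 2 / 2) * ‖y‖ ^ 2) := by
  rw [capIntegrand, norm_mul, norm_exp, Complex.norm_real, Real.norm_eq_abs, Real.abs_exp]
  congr 2
  simp [← ofReal_pow]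

lemma integrable_gaussian {b : ℝ} (hb : 0 < b) :
    Integrable (fun y : E3 => Real.exp (-b * ‖y‖ ^ 2)) := by
  have := (GaussianFourier.integrable_cexp_neg_mul_sq_norm_add (V := E3) (b := (b : ℂ))
    (by simpa using hb) 0 0).norm
  refine this.congr (ae_of_all _ fun y => ?_)
  simp [norm_exp, ← ofReal_pow]

lemma integrable_capIntegrand (ν : E3) (lam β : ℝ) {s : ℝ} (hs : 0 < s) (ξ : E3) :
    Integrable (fun q : E3 × E3 => capIntegrand ν lam β s ξ q.1 q.2)
      (sphereMeasure.prod volume) := by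
  have h1 : Integrable (fun ω : E3 => Real.exp (β * ⟪ν, ω⟫_ℝ)) sphereMeasure :=
    sphere_integrable_real (by fun_prop)
  refine (h1.mul_prod (integrable_gaussian (b := s ^ 2 / 2) (by positivity))).mono'
    (continuous_capIntegrand ν lam β s ξ).aestronglyMeasurable (ae_of_all _ fun q => ?_)
  rw [norm_capIntegrand]

lemma capKernel_mul_exp (ν : E3) (lam β s : ℝ) (ξ y : E3) :
    capKernel ν lam β s y * exp (I * (⟪ξ, y⟫_ℝ : ℝ)) =
      ((lam / s) ^ 2 * (2 * Real.pi / s ^ 2) ^ (-(3 / 2) : ℝ) * Real.exp (-β) : ℝ) *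
        ∫ ω, capIntegrand ν lam β s ξ ω y ∂sphereMeasure := by
  have h : ∀ ω, capIntegrand ν lam β s ξ ω y =
      (Real.exp (-(s ^ 2 / 2 * ‖y‖ ^ 2)) * exp (I * (⟪ξ, y⟫_ℝ : ℝ))) *
        exp (cdot (fun i => (β * ν i : ℝ) - I * (lam * y i : ℝ)) ω) := fun ω => by
    rw [capIntegrand, cdot_kernel, inner_sub_left, inner_smul_left, ofReal_exp, ofReal_exp,
      ← exp_add, ← exp_add, ← exp_add]
    congr 1
    push_cast
    simp only [conj_trivial]
    ring
  simp_rw [h, integral_const_mul, capKernel, capLaplace]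
  push_cast
  ring

lemma capKernel_eq (ν : E3) (lam β s : ℝ) :
    capKernel ν lam β s = fun y =>
      ((lam / s) ^ 2 * (2 * Real.pi / s ^ 2) ^ (-(3 / 2) : ℝ) * Real.exp (-β) : ℝ) *
        ∫ ω, capIntegrand ν lam β s 0 ω y ∂sphereMeasure := by
  ext y
  have := capKernel_mul_exp ν lam β s 0 y
  rwa [inner_zero_left, ofReal_zero, mul_zero, exp_zero, mul_one] at this

lemma measurable_capKernel (ν : E3) (lam β s : ℝ) : Measurable (capKernel ν lam β s) := by
  rw [capKernel_eq]
  exact (StronglyMeasurable.integral_prod_left (μ := sphereMeasure)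
    (f := fun ω y => capIntegrand ν lam β s 0 ω y)
    (continuous_capIntegrand ν lam β s 0).stronglyMeasurable).measurable.const_mul _

lemma integrable_capKernel (ν : E3) (lam β : ℝ) {s : ℝ} (hs : 0 < s) :
    Integrable (capKernel ν lam β s) := by
  rw [capKernel_eq]
  exact (integrable_capIntegrand ν lam β hs 0).integral_prod_right.const_mul _

lemma fourier_capKernel (ν : E3) (lam β : ℝ) {s : ℝ} (hs : 0 < s) (ξ : E3) :
    ∫ y, capKernel ν lam β s y * exp (I * (⟪ξ, y⟫_ℝ : ℝ)) = capMultiplier ν lam β s ξ := by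
  simp_rw [capKernel_mul_exp, integral_const_mul]
  rw [integral_integral_swap (f := fun y ω => capIntegrand ν lam β s ξ ω y)
    (integrable_capIntegrand ν lam β hs ξ).swap]
  have hb : 0 < (((s ^ 2 / 2 : ℝ) : ℂ)).re := by rw [ofReal_re]; positivity
  have h : ∀ ω, ∫ y, capIntegrand ν lam β s ξ ω y =
      (((2 * Real.pi / s ^ 2) ^ (3 / 2 : ℝ) * (Real.exp (β * ⟪ν, ω⟫_ℝ) *
        Real.exp (-(‖ξ - lam • ω‖ ^ 2 / (2 * s ^ 2)))) : ℝ) : ℂ) := fun ω => by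
    simp only [capIntegrand]
    rw [integral_const_mul]
    have := GaussianFourier.integral_cexp_neg_mul_sq_norm_add (V := E3) hb I (ξ - lam • ω)
    rw [this]
    have h1 : ((Real.pi : ℂ) / ((s ^ 2 / 2 : ℝ) : ℂ)) = ((2 * Real.pi / s ^ 2 : ℝ) : ℂ) := by
      push_cast; field_simp
    have h2 : ((Module.finrank ℝ E3 : ℂ) / 2) = ((3 / 2 : ℝ) : ℂ) := by simp
    have h3 : I ^ 2 * (‖ξ - lam • ω‖ : ℂ) ^ 2 / (4 * ((s ^ 2 / 2 : ℝ) : ℂ)) =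
        ((-(‖ξ - lam • ω‖ ^ 2 / (2 * s ^ 2)) : ℝ) : ℂ) := by
      rw [I_sq]; push_cast; field_simp; norm_num
    rw [h1, h2, h3, ← ofReal_cpow (by positivity), ← ofReal_exp]
    push_cast
    ring
  simp_rw [h]
  rw [integral_complex_ofReal, ← ofReal_mul, capMultiplier, integral_const_mul]
  congr 1
  have h5 : (2 * Real.pi / s ^ 2) ^ (-(3 / 2) : ℝ) * (2 * Real.pi / s ^ 2) ^ (3 / 2 : ℝ) = 1 := by
    rw [← Real.rpow_add (by positivity)]; norm_num
  have h6 : ∀ ω, Real.exp (β * (⟪ν, ω⟫_ℝ - 1)) * Real.exp (-(‖ξ - lam • ω‖ ^ 2 / (2 * s ^ 2))) =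
      Real.exp (-β) * (Real.exp (β * ⟪ν, ω⟫_ℝ) *
        Real.exp (-(‖ξ - lam • ω‖ ^ 2 / (2 * s ^ 2)))) := fun ω => by
    rw [← mul_assoc, ← Real.exp_add (-β), mul_sub, mul_one, sub_eq_neg_add]
  simp_rw [h6]
  rw [integral_const_mul]
  linear_combination ((lam / s) ^ 2 * Real.exp (-β) * ∫ ω, Real.exp (β * ⟪ν, ω⟫_ℝ) *
        Real.exp (-(‖ξ - lam • ω‖ ^ 2 / (2 * s ^ 2))) ∂sphereMeasure) * h5

lemma capKernel_coeff {lam s : ℝ} (hs : 0 < s) :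
    (lam / s) ^ 2 * (2 * Real.pi / s ^ 2) ^ (-(3 / 2) : ℝ) =
      lam ^ 2 * s * (2 * Real.pi) ^ (-(3 / 2) : ℝ) := by
  have h : (s ^ 2) ^ (-(3 / 2) : ℝ) = (s ^ 3)⁻¹ := by
    rw [← Real.rpow_natCast s 2, ← Real.rpow_mul hs.le, ← Real.rpow_natCast s 3,
      ← Real.rpow_neg hs.le]
    norm_num
  rw [Real.div_rpow (by positivity) (by positivity), h]
  field_simp

/-- The difference of two cap kernels, in which the part near the origin cancels. -/
noncomputable def capDiff (ν : E3) (lam δ s : ℝ) (y : E3) : ℂ :=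
  capKernel ν lam (1 / δ ^ 2) δ y - (δ / s : ℝ) * capKernel ν lam (1 / δ ^ 2) s y

lemma norm_capDiff_le {ν : E3} (hν : ‖ν‖ = 1) {lam δ s : ℝ} (hδ : 0 < δ) (hM : 1 ≤ lam * δ)
    (hs : δ ≤ s) (y : E3) {τ : ℝ} (hτ : 1 - Real.exp (-(s ^ 2 / 2 * ‖y‖ ^ 2)) ≤ τ) :
    ‖capDiff ν lam δ s y‖ ≤ lam ^ 2 * δ * τ * (24 / (1 / δ ^ 2 + lam * ‖y‖) *
      (Real.exp (-(‖y - ⟪ν, y⟫_ℝ • ν‖ / 8)) * Real.exp (-(δ ^ 2 / 4 * ‖y‖ ^ 2)))) := by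
  have hs0 : 0 < s := hδ.trans_le hs
  have hτ0 : 0 ≤ τ := by
    refine le_trans ?_ hτ
    rw [sub_nonneg, Real.exp_le_one_iff, neg_nonpos]; positivity
  set g := (2 * Real.pi) ^ (-(3 / 2) : ℝ) with hg
  have hg0 : 0 ≤ g := by positivity
  have hg1 : g ≤ 1 := Real.rpow_le_one_of_one_le_of_nonpos
    (by linarith [Real.pi_gt_three]) (by norm_num)
  have e : capDiff ν lam δ s y = ((lam ^ 2 * δ * g *
      (Real.exp (-(δ ^ 2 / 2 * ‖y‖ ^ 2)) - Real.exp (-(s ^ 2 / 2 * ‖y‖ ^ 2))) : ℝ) : ℂ) *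
        capLaplace ν lam (1 / δ ^ 2) y := by
    rw [capDiff, capKernel, capKernel, capKernel_coeff hδ, capKernel_coeff hs0, ← hg]
    have : (s : ℂ) ≠ 0 := by exact_mod_cast hs0.ne'
    push_cast
    field_simp
  have h1 : Real.exp (-(δ ^ 2 / 2 * ‖y‖ ^ 2)) - Real.exp (-(s ^ 2 / 2 * ‖y‖ ^ 2)) ≤
      τ * Real.exp (-(δ ^ 2 / 2 * ‖y‖ ^ 2)) := by
    have h2 : Real.exp (-(s ^ 2 / 2 * ‖y‖ ^ 2)) * Real.exp (-(δ ^ 2 / 2 * ‖y‖ ^ 2)) ≤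
        Real.exp (-(s ^ 2 / 2 * ‖y‖ ^ 2)) :=
      mul_le_of_le_one_right (by positivity)
        (Real.exp_le_one_iff.2 (by rw [neg_nonpos]; positivity))
    have := mul_le_mul_of_nonneg_right hτ (Real.exp_pos (-(δ ^ 2 / 2 * ‖y‖ ^ 2))).le
    linarith
  have h3 : 0 ≤ Real.exp (-(δ ^ 2 / 2 * ‖y‖ ^ 2)) - Real.exp (-(s ^ 2 / 2 * ‖y‖ ^ 2)) := by
    rw [sub_nonneg]; gcongr
  rw [e, norm_mul, Complex.norm_real, Real.norm_of_nonneg (by positivity)]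
  calc lam ^ 2 * δ * g * (Real.exp (-(δ ^ 2 / 2 * ‖y‖ ^ 2)) - Real.exp (-(s ^ 2 / 2 * ‖y‖ ^ 2))) *
        ‖capLaplace ν lam (1 / δ ^ 2) y‖
      ≤ lam ^ 2 * δ * 1 * (τ * Real.exp (-(δ ^ 2 / 2 * ‖y‖ ^ 2))) *
        ‖capLaplace ν lam (1 / δ ^ 2) y‖ := by gcongr
    _ = lam ^ 2 * δ * τ * (‖capLaplace ν lam (1 / δ ^ 2) y‖ *
        Real.exp (-(δ ^ 2 / 2 * ‖y‖ ^ 2))) := by ring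
    _ ≤ _ := by
      exact mul_le_mul_of_nonneg_left (kernel_decay hν hδ hM y) (by positivity)

lemma norm_mul_norm_capDiff_le {ν : E3} (hν : ‖ν‖ = 1) {lam δ s : ℝ} (hδ : 0 < δ)
    (hM : 1 ≤ lam * δ) (hs : δ ≤ s) (y : E3) :
    ‖y‖ * ‖capDiff ν lam δ s y‖ ≤ 24 * (lam * δ) *
      (Real.exp (-(‖y - ⟪ν, y⟫_ℝ • ν‖ / 8)) * Real.exp (-(δ ^ 2 / 4 * ‖y‖ ^ 2))) := by
  have hlam : 0 < lam := pos_of_mul_pos_left (by linarith) hδ.le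
  have h := mul_le_mul_of_nonneg_left (norm_capDiff_le hν hδ hM hs y
    (sub_le_self 1 (Real.exp_pos _).le)) (norm_nonneg y)
  refine h.trans ?_
  set E := Real.exp (-(‖y - ⟪ν, y⟫_ℝ • ν‖ / 8)) * Real.exp (-(δ ^ 2 / 4 * ‖y‖ ^ 2))
  have hE : 0 ≤ E := by positivity
  have h1 : lam * ‖y‖ * (24 / (1 / δ ^ 2 + lam * ‖y‖)) ≤ 24 := by
    rw [mul_div_assoc', div_le_iff₀ (by positivity)]
    have : 0 < 1 / δ ^ 2 := by positivity
    linarith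
  calc ‖y‖ * (lam ^ 2 * δ * 1 * (24 / (1 / δ ^ 2 + lam * ‖y‖) * E))
      = (lam * ‖y‖ * (24 / (1 / δ ^ 2 + lam * ‖y‖))) * (lam * δ * E) := by ring
    _ ≤ 24 * (lam * δ * E) := by gcongr
    _ = _ := by ring

lemma norm_capDiff_le_mul {ν : E3} (hν : ‖ν‖ = 1) {lam δ s : ℝ} (hδ : 0 < δ)
    (hM : 1 ≤ lam * δ) (hs : δ ≤ s) (y : E3) :
    ‖capDiff ν lam δ s y‖ ≤ 24 * (lam * δ) * s *
      (Real.exp (-(‖y - ⟪ν, y⟫_ℝ • ν‖ / 8)) * Real.exp (-(δ ^ 2 / 4 * ‖y‖ ^ 2))) := by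
  have hlam : 0 < lam := pos_of_mul_pos_left (by linarith) hδ.le
  have hs0 : 0 < s := hδ.trans_le hs
  have hτ : 1 - Real.exp (-(s ^ 2 / 2 * ‖y‖ ^ 2)) ≤ s * ‖y‖ := by
    rcases le_total (s * ‖y‖) 1 with h | h
    · have h1 := Real.add_one_le_exp (-(s ^ 2 / 2 * ‖y‖ ^ 2))
      have h2 : 0 ≤ s * ‖y‖ := by positivity
      nlinarith
    · linarith [Real.exp_pos (-(s ^ 2 / 2 * ‖y‖ ^ 2))]
  refine (norm_capDiff_le hν hδ hM hs y hτ).trans ?_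
  set E := Real.exp (-(‖y - ⟪ν, y⟫_ℝ • ν‖ / 8)) * Real.exp (-(δ ^ 2 / 4 * ‖y‖ ^ 2))
  have hE : 0 ≤ E := by positivity
  have h1 : lam * ‖y‖ * (24 / (1 / δ ^ 2 + lam * ‖y‖)) ≤ 24 := by
    rw [mul_div_assoc', div_le_iff₀ (by positivity)]
    have : 0 < 1 / δ ^ 2 := by positivity
    linarith
  calc lam ^ 2 * δ * (s * ‖y‖) * (24 / (1 / δ ^ 2 + lam * ‖y‖) * E)
      = (lam * ‖y‖ * (24 / (1 / δ ^ 2 + lam * ‖y‖))) * (lam * δ * s * E) := by ring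
    _ ≤ 24 * (lam * δ * s * E) := by gcongr
    _ = _ := by ring

lemma tsum_int_abs_le {g : ℝ → ℝ} (hg : AntitoneOn g (Set.Ici 0)) {C : ℝ}
    (hg0 : ∀ t, 0 ≤ g t) (hC : ∀ N : ℕ, ∑ m ∈ Finset.range N, g m ≤ C) (x : ℝ) :
    ∑' n : ℤ, ENNReal.ofReal (g |x + n|) ≤ 2 * ENNReal.ofReal C := by
  have hN : ∑' m : ℕ, ENNReal.ofReal (g m) ≤ ENNReal.ofReal C := by
    refine ENNReal.tsum_le_of_sum_range_le fun N => ?_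
    rw [← ENNReal.ofReal_sum_of_nonneg fun i _ => hg0 _]
    exact ENNReal.ofReal_le_ofReal (hC N)
  have h1 : ∑' n : ℤ, ENNReal.ofReal (g |x + n|) =
      ∑' n : ℤ, ENNReal.ofReal (g |Int.fract x + n|) := by
    rw [← (Equiv.addRight (-⌊x⌋)).tsum_eq]
    refine tsum_congr fun n => ?_
    rw [Equiv.coe_addRight, Int.fract]
    congr 3
    push_cast
    ring
  have hf0 := Int.fract_nonneg x
  have hf1 := (Int.fract_lt_one x).le
  rw [h1, ← Equiv.intEquivNatSumNat.symm.tsum_eq,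
    Summable.tsum_sum ENNReal.summable ENNReal.summable, two_mul]
  refine add_le_add (le_trans ?_ hN) (le_trans ?_ hN)
  · refine ENNReal.tsum_le_tsum fun n => ENNReal.ofReal_le_ofReal (hg ?_ ?_ ?_)
    · exact Set.mem_Ici.2 (Nat.cast_nonneg n)
    · exact Set.mem_Ici.2 (abs_nonneg _)
    · simp only [Equiv.intEquivNatSumNat, Equiv.coe_fn_symm_mk, Sum.elim_inl, Int.ofNat_eq_natCast,
        Int.cast_natCast]
      exact le_trans (by linarith) (le_abs_self _)
  · refine ENNReal.tsum_le_tsum fun n => ENNReal.ofReal_le_ofReal (hg ?_ ?_ ?_)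
    · exact Set.mem_Ici.2 (Nat.cast_nonneg n)
    · exact Set.mem_Ici.2 (abs_nonneg _)
    · simp only [Equiv.intEquivNatSumNat, Equiv.coe_fn_symm_mk, Sum.elim_inr, Int.cast_negSucc]
      push_cast
      exact le_trans (by linarith) (neg_le_abs _)

lemma exists_tsum_exp_abs_le {c : ℝ} (hc : 0 < c) :
    ∃ C : ℝ, 0 < C ∧ ∀ x : ℝ, ∑' n : ℤ, ENNReal.ofReal (Real.exp (-(c * |x + n|))) ≤
      ENNReal.ofReal C := by
  have hr : Real.exp (-c) < 1 := by rw [Real.exp_lt_one_iff]; linarith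
  have hC : 0 < (1 - Real.exp (-c))⁻¹ := inv_pos.2 (by linarith)
  refine ⟨2 * (1 - Real.exp (-c))⁻¹, by positivity, fun x => ?_⟩
  rw [ENNReal.ofReal_mul zero_le_two, ENNReal.ofReal_ofNat]
  refine tsum_int_abs_le (g := fun t => Real.exp (-(c * t))) ?_ (fun t => (Real.exp_pos _).le)
    (fun N => ?_) x
  · intro a _ b _ hab
    exact Real.exp_le_exp.2 (neg_le_neg (mul_le_mul_of_nonneg_left hab hc.le))
  · rw [← tsum_geometric_of_lt_one (Real.exp_pos _).le hr]
    have h : ∀ m : ℕ, Real.exp (-(c * m)) = Real.exp (-c) ^ m := fun m => by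
      rw [← Real.exp_nat_mul]; ring_nf
    simp_rw [h]
    exact (summable_geometric_of_lt_one (Real.exp_pos _).le hr).sum_le_tsum _
      fun i _ => by positivity

/-- The weight describing the decay of the difference kernel along the direction of the cap. -/
noncomputable def rayWeight (δ s t : ℝ) : ℝ := 1 / (√(1 + s * t) * (1 + δ * t) ^ 2)

lemma rayWeight_antitone {δ s : ℝ} (hδ : 0 < δ) (hs : 0 < s) :
    AntitoneOn (rayWeight δ s) (Set.Ici 0) := by
  intro a (ha : 0 ≤ a) b _ hab
  unfold rayWeight
  gcongr

lemma rayWeight_nonneg (δ s t : ℝ) : 0 ≤ rayWeight δ s t := by unfold rayWeight; positivity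

lemma sum_rayWeight_le {δ s : ℝ} (hδ : 0 < δ) (hs : 0 < s) (N : ℕ) :
    ∑ m ∈ Finset.range N, rayWeight δ s m ≤ 1 + 2 / √(s * δ) := by
  have key : ∀ N : ℕ, ∑ m ∈ Finset.range (N + 1), rayWeight δ s m ≤
      1 + 2 / √s * √(N / (1 + δ * N)) := fun N => by
    induction N with
    | zero => simp [rayWeight]
    | succ N ih =>
      rw [Finset.sum_range_succ]
      suffices h : rayWeight δ s (N + 1 : ℕ) ≤
          2 / √s * (√((N + 1 : ℕ) / (1 + δ * (N + 1 : ℕ))) - √(N / (1 + δ * N))) by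
        rw [mul_sub] at h; linarith
      push_cast
      set m : ℝ := (N : ℝ) + 1 with hm
      have hm1 : 1 ≤ m := by rw [hm]; have : (0 : ℝ) ≤ N := N.cast_nonneg; linarith
      have hN : (N : ℝ) = m - 1 := by rw [hm]; ring
      rw [hN]
      set D := 1 + δ * m with hD
      have hD1 : 1 ≤ D := by rw [hD]; nlinarith
      have hD' : 0 < 1 + δ * (m - 1) := by nlinarith
      set b := √(m / D) with hb
      set a := √((m - 1) / (1 + δ * (m - 1))) with ha
      have hb0 : 0 < b := Real.sqrt_pos.2 (by positivity)
      have hb2 : b ^ 2 = m / D := Real.sq_sqrt (by positivity)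
      have ha2 : a ^ 2 = (m - 1) / (1 + δ * (m - 1)) :=
        Real.sq_sqrt (div_nonneg (by linarith) hD'.le)
      have hdiff : 1 / D ^ 2 ≤ b ^ 2 - a ^ 2 := by
        rw [hb2, ha2, div_sub_div _ _ (by positivity) hD'.ne',
          div_le_div_iff₀ (by positivity) (by positivity), hD]
        have : 0 ≤ δ * (1 + δ * m) := by positivity
        nlinarith
      have hab : a ≤ b := by
        have h0 : 0 ≤ 1 / D ^ 2 := by positivity
        exact abs_le_of_sq_le_sq' (by linarith) hb0.le |>.2
      have hba : 1 / D ^ 2 / (2 * b) ≤ b - a := by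
        rw [div_le_iff₀ (by positivity)]
        nlinarith
      have hbm : b ≤ √m := Real.sqrt_le_sqrt (div_le_self (by linarith) hD1)
      calc rayWeight δ s m = 1 / (√(1 + s * m) * D ^ 2) := rfl
        _ ≤ 1 / (√s * b * D ^ 2) := by
          gcongr
          calc √s * b ≤ √s * √m := by gcongr
            _ = √(s * m) := (Real.sqrt_mul hs.le m).symm
            _ ≤ √(1 + s * m) := Real.sqrt_le_sqrt (by linarith)
        _ = 2 / √s * (1 / D ^ 2 / (2 * b)) := by
          have : √s ≠ 0 := (Real.sqrt_pos.2 hs).ne'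
          field_simp
        _ ≤ 2 / √s * (b - a) := by gcongr
  have hle : 2 / √s * √(N / (1 + δ * N)) ≤ 2 / √(s * δ) := by
    rw [Real.sqrt_mul hs.le, ← div_div, div_eq_mul_inv (2 / √s), ← Real.sqrt_inv]
    gcongr
    rw [div_le_iff₀ (by positivity)]
    have : δ⁻¹ * (1 + δ * N) = δ⁻¹ + N := by field_simp
    rw [this]
    have := inv_pos.2 hδ
    linarith
  calc _ ≤ ∑ m ∈ Finset.range (N + 1), rayWeight δ s m := by
        rw [Finset.sum_range_succ]
        linarith [rayWeight_nonneg δ s N]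
    _ ≤ _ := (key N).trans (by linarith)

lemma tsum_fin_two (f g : ℤ → ℝ≥0∞) :
    ∑' n : Fin 2 → ℤ, f (n 0) * g (n 1) = (∑' m, f m) * ∑' m, g m := by
  rw [← (finTwoArrowEquiv ℤ).symm.tsum_eq, ENNReal.tsum_prod']
  simp [finTwoArrowEquiv, ENNReal.tsum_mul_left, ENNReal.tsum_mul_right]

lemma tsum_fin_three_le {i : Fin 3} (f : ℤ → ℝ≥0∞) (g : ℤ → Fin 2 → ℤ → ℝ≥0∞) {G : ℝ≥0∞}
    (hg : ∀ m j, ∑' n, g m j n ≤ G) :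
    ∑' n : Fin 3 → ℤ, f (n i) * (g (n i) 0 (n (i.succAbove 0)) * g (n i) 1 (n (i.succAbove 1))) ≤
      G ^ 2 * ∑' m, f m := by
  rw [← (Fin.insertNthEquiv (fun _ => ℤ) i).tsum_eq, ENNReal.tsum_prod', ← ENNReal.tsum_mul_left]
  refine ENNReal.tsum_le_tsum fun m => ?_
  simp only [Fin.insertNthEquiv, Equiv.coe_fn_mk, Fin.insertNth_apply_same,
    Fin.insertNth_apply_succAbove]
  rw [ENNReal.tsum_mul_left, tsum_fin_two (g m 0) (g m 1), mul_comm, sq]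
  gcongr <;> exact hg _ _

/-- An integer vector, viewed as a real vector. -/
def intVec (n : Fin 3 → ℤ) : Fin 3 → ℝ := fun i => n i

lemma exists_norm_symm_le (T : (Fin 3 → ℝ) ≃L[ℝ] E3) :
    ∃ K : ℝ, 1 ≤ K ∧ ∀ z, ‖z‖ ≤ K * ‖T z‖ := by
  have h0 := norm_nonneg (T.symm : E3 →L[ℝ] (Fin 3 → ℝ))
  refine ⟨‖(T.symm : E3 →L[ℝ] (Fin 3 → ℝ))‖ + 1, by linarith, fun z => ?_⟩
  have := (T.symm : E3 →L[ℝ] (Fin 3 → ℝ)).le_opNorm (T z)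
  simp only [ContinuousLinearEquiv.coe_coe, ContinuousLinearEquiv.symm_apply_apply] at this
  linarith [norm_nonneg (T z)]

lemma exists_tsum_exp_norm_le (B : (Fin 3 → ℝ) ≃L[ℝ] E3) :
    ∃ C : ℝ, 0 < C ∧ ∀ v : E3, ∑' k : Fin 3 → ℤ,
      ENNReal.ofReal (Real.exp (-‖B (intVec k) - v‖)) ≤ ENNReal.ofReal C := by
  obtain ⟨K, hK1, hK⟩ := exists_norm_symm_le B
  have hK0 : 0 < K := by linarith
  obtain ⟨G, hG0, hG⟩ := exists_tsum_exp_abs_le (c := 1 / (3 * K)) (by positivity)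
  refine ⟨G ^ 2 * G, by positivity, fun v => ?_⟩
  set x := B.symm v with hx
  set g : Fin 3 → ℤ → ℝ≥0∞ := fun i m => ENNReal.ofReal (Real.exp (-(1 / (3 * K) * |-x i + m|)))
  have hle : ∀ k : Fin 3 → ℤ, ENNReal.ofReal (Real.exp (-‖B (intVec k) - v‖)) ≤
      g 0 (k 0) * (g 1 (k 1) * g 2 (k 2)) := fun k => by
    simp only [g]
    rw [← ENNReal.ofReal_mul (Real.exp_pos _).le, ← ENNReal.ofReal_mul (Real.exp_pos _).le,
      ← Real.exp_add, ← Real.exp_add]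
    refine ENNReal.ofReal_le_ofReal (Real.exp_le_exp.2 ?_)
    have h1 : ‖intVec k - x‖ ≤ K * ‖B (intVec k) - v‖ := by
      have := hK (intVec k - x)
      rwa [map_sub, hx, B.apply_symm_apply, ← hx] at this
    have h2 : ∀ i, |-x i + k i| ≤ K * ‖B (intVec k) - v‖ := fun i => by
      refine le_trans ?_ h1
      have := norm_le_pi_norm (intVec k - x) i
      rwa [Pi.sub_apply, Real.norm_eq_abs, sub_eq_neg_add] at this
    have h3 : 1 / (3 * K) * (K * ‖B (intVec k) - v‖) = ‖B (intVec k) - v‖ / 3 := by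
      field_simp
    have h4 : ∀ i, 1 / (3 * K) * |-x i + k i| ≤ ‖B (intVec k) - v‖ / 3 := fun i => by
      rw [← h3]; exact mul_le_mul_of_nonneg_left (h2 i) (by positivity)
    linarith [h4 0, h4 1, h4 2]
  calc _ ≤ ∑' k : Fin 3 → ℤ, g 0 (k 0) * (g 1 (k 1) * g 2 (k 2)) := ENNReal.tsum_le_tsum hle
    _ ≤ ENNReal.ofReal G ^ 2 * ∑' m, g 0 m :=
      tsum_fin_three_le (i := 0) (g 0) (fun _ j => ![g 1, g 2] j)
        (fun _ j => by fin_cases j <;> exact hG _)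
    _ ≤ ENNReal.ofReal G ^ 2 * ENNReal.ofReal G := by gcongr; exact hG _
    _ = _ := by rw [ENNReal.ofReal_mul (by positivity), ENNReal.ofReal_pow hG0.le]

lemma exp_neg_sq_le {K x : ℝ} (hK : 1 ≤ K) (hx : 0 ≤ x) :
    Real.exp (-(x ^ 2 / (4 * K ^ 2))) ≤ 8 * K ^ 2 / (1 + x) ^ 2 := by
  have h1 := Real.add_one_le_exp (x ^ 2 / (4 * K ^ 2))
  rw [Real.exp_neg, inv_eq_one_div, div_le_div_iff₀ (Real.exp_pos _) (by positivity)]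
  have h2 : (1 + x) ^ 2 ≤ 8 * K ^ 2 * (x ^ 2 / (4 * K ^ 2) + 1) := by
    have : 8 * K ^ 2 * (x ^ 2 / (4 * K ^ 2) + 1) = 2 * x ^ 2 + 8 * K ^ 2 := by
      field_simp; ring
    nlinarith [sq_nonneg (1 - x)]
  have := mul_le_mul_of_nonneg_left h1 (by positivity : 0 ≤ 8 * K ^ 2)
  linarith

lemma exists_tsum_kernel_le (T : (Fin 3 → ℝ) ≃L[ℝ] E3) :
    ∃ C : ℝ, 0 < C ∧ ∀ ν : E3, ‖ν‖ = 1 → ∀ δ s : ℝ, 0 < δ → 0 < s → ∀ φ : E3 → ℝ,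
      (∀ y, φ y ≤ s * (Real.exp (-(‖y - ⟪ν, y⟫_ℝ • ν‖ / 8)) *
        Real.exp (-(δ ^ 2 / 4 * ‖y‖ ^ 2)))) →
      (∀ y, ‖y‖ * φ y ≤ Real.exp (-(‖y - ⟪ν, y⟫_ℝ • ν‖ / 8)) *
        Real.exp (-(δ ^ 2 / 4 * ‖y‖ ^ 2))) →
      ∀ u, ∑' n : Fin 3 → ℤ, ENNReal.ofReal (φ (T (u + intVec n))) ≤
        ENNReal.ofReal (C * (s + √(s / δ))) := by
  obtain ⟨K, hK1, hK⟩ := exists_norm_symm_le T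
  have hK0 : 0 < K := by linarith
  obtain ⟨G, hG0, hG⟩ := exists_tsum_exp_abs_le (c := 1 / (32 * K)) (by positivity)
  refine ⟨64 * K ^ 3 * G ^ 2, by positivity, fun ν hν δ s hδ hs φ hφ1 hφ2 u => ?_⟩
  set w := T.symm ν with hw
  have hTw : T w = ν := T.apply_symm_apply ν
  obtain ⟨i, hi⟩ := Finite.exists_max fun i => |w i|
  have hwi : 0 < |w i| := by
    by_contra! h
    have : w = 0 := by
      ext j
      exact abs_nonpos_iff.1 ((hi j).trans h)
    rw [← hTw, this, map_zero, norm_zero] at hν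
    exact zero_ne_one hν
  set r : Fin 3 → ℝ := fun j => w j / w i with hr
  have hr1 : ∀ j, |r j| ≤ 1 := fun j => by
    rw [hr, abs_div]; exact (div_le_one hwi).2 (hi j)
  set g : ℝ → Fin 2 → ℤ → ℝ≥0∞ := fun t j n => ENNReal.ofReal
    (Real.exp (-(1 / (32 * K) * |(u (i.succAbove j) - r (i.succAbove j) * t) + n|))) with hg
  set f : ℤ → ℝ≥0∞ := fun m => ENNReal.ofReal (16 * K ^ 3 * s) *
    ENNReal.ofReal (rayWeight δ s |u i + m|) with hf
  have hle : ∀ n : Fin 3 → ℤ, ENNReal.ofReal (φ (T (u + intVec n))) ≤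
      f (n i) * (g (u i + n i) 0 (n (i.succAbove 0)) * g (u i + n i) 1 (n (i.succAbove 1))) := by
    intro n
    simp only [hf, hg]
    rw [← ENNReal.ofReal_mul (by positivity), ← ENNReal.ofReal_mul (Real.exp_pos _).le,
      ← ENNReal.ofReal_mul (mul_nonneg (by positivity) (rayWeight_nonneg _ _ _))]
    refine ENNReal.ofReal_le_ofReal ?_
    set z := u + intVec n with hz
    have hzj : ∀ j, z j = u j + n j := fun j => rfl
    set y := T z with hy
    set m := ‖y - ⟪ν, y⟫_ℝ • ν‖ with hm
    have hzi : |z i| ≤ K * ‖y‖ := (norm_le_pi_norm z i).trans (hK z)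
    have hcoord : ∀ j, |z j - ⟪ν, y⟫_ℝ * w j| ≤ K * m := fun j => by
      have h1 := hK (z - ⟪ν, y⟫_ℝ • w)
      rw [map_sub, map_smul, hTw, ← hy] at h1
      exact (norm_le_pi_norm (z - ⟪ν, y⟫_ℝ • w) j).trans h1
    have hdev : ∀ j, |(u j - r j * (u i + n i)) + n j| ≤ 2 * K * m := fun j => by
      have e : (u j - r j * (u i + n i)) + n j =
          (z j - ⟪ν, y⟫_ℝ * w j) - r j * (z i - ⟪ν, y⟫_ℝ * w i) := by
        have : r j * w i = w j := div_mul_cancel₀ _ (abs_pos.1 hwi)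
        rw [hzj, hzj, ← this]; ring
      rw [e]
      refine (abs_sub _ _).trans ?_
      rw [abs_mul]
      have := mul_le_mul (hr1 j) (hcoord i) (abs_nonneg _) zero_le_one
      linarith [hcoord j]
    have hexp : Real.exp (-(m / 8)) ≤
        Real.exp (-(1 / (32 * K) *
          |(u (i.succAbove 0) - r (i.succAbove 0) * (u i + n i)) + n (i.succAbove 0)|)) *
        Real.exp (-(1 / (32 * K) *
          |(u (i.succAbove 1) - r (i.succAbove 1) * (u i + n i)) + n (i.succAbove 1)|)) := by
      rw [← Real.exp_add]
      refine Real.exp_le_exp.2 ?_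
      have h1 : ∀ j, 1 / (32 * K) * |(u j - r j * (u i + n i)) + n j| ≤ m / 16 := fun j => by
        refine (mul_le_mul_of_nonneg_left (hdev j) (by positivity)).trans (le_of_eq ?_)
        field_simp; ring
      linarith [h1 (i.succAbove 0), h1 (i.succAbove 1)]
    have hgauss : Real.exp (-(δ ^ 2 / 4 * ‖y‖ ^ 2)) ≤ 8 * K ^ 2 / (1 + δ * |z i|) ^ 2 := by
      refine le_trans (Real.exp_le_exp.2 (neg_le_neg ?_))
        (exp_neg_sq_le (x := δ * |z i|) hK1 (by positivity))
      rw [div_le_iff₀ (by positivity)]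
      have : |z i| ^ 2 ≤ (K * ‖y‖) ^ 2 := by gcongr
      nlinarith [mul_le_mul_of_nonneg_left this (sq_nonneg δ)]
    have hφ : φ y ≤ 2 * s * (K / √(1 + s * |z i|)) * (Real.exp (-(m / 8)) *
        Real.exp (-(δ ^ 2 / 4 * ‖y‖ ^ 2))) := by
      set E := Real.exp (-(m / 8)) * Real.exp (-(δ ^ 2 / 4 * ‖y‖ ^ 2)) with hE
      have hE0 : 0 ≤ E := by positivity
      have h1 : (1 + s * ‖y‖) * φ y ≤ 2 * s * E := by
        have := mul_le_mul_of_nonneg_left (hφ2 y) hs.le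
        linarith [hφ1 y]
      have h2 : φ y ≤ 2 * s * E / (1 + s * ‖y‖) := by
        rw [le_div_iff₀ (by positivity)]; linarith
      refine h2.trans ?_
      have h3 : √(1 + s * |z i|) ≤ K * (1 + s * ‖y‖) := by
        have h4 : 1 ≤ 1 + s * |z i| := by
          have : 0 ≤ s * |z i| := by positivity
          linarith
        have h5 : √(1 + s * |z i|) ≤ 1 + s * |z i| :=
          Real.sqrt_le_iff.2 ⟨by linarith, by nlinarith⟩
        nlinarith [mul_le_mul_of_nonneg_left hzi hs.le]
      have h6 : 0 < √(1 + s * |z i|) := Real.sqrt_pos.2 (by positivity)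
      calc 2 * s * E / (1 + s * ‖y‖) = 2 * s * E * (1 / (1 + s * ‖y‖)) := by ring
        _ ≤ 2 * s * E * (K / √(1 + s * |z i|)) := by
          gcongr ?_ * ?_
          rw [div_le_div_iff₀ (by positivity) h6]; linarith
        _ = _ := by ring
    calc φ y ≤ 2 * s * (K / √(1 + s * |z i|)) * (Real.exp (-(m / 8)) *
        Real.exp (-(δ ^ 2 / 4 * ‖y‖ ^ 2))) := hφ
      _ ≤ 2 * s * (K / √(1 + s * |z i|)) * ((Real.exp (-(1 / (32 * K) *
          |(u (i.succAbove 0) - r (i.succAbove 0) * (u i + n i)) + n (i.succAbove 0)|)) *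
        Real.exp (-(1 / (32 * K) *
          |(u (i.succAbove 1) - r (i.succAbove 1) * (u i + n i)) + n (i.succAbove 1)|))) *
          (8 * K ^ 2 / (1 + δ * |z i|) ^ 2)) := by gcongr
      _ = _ := by
        rw [rayWeight, hzj]
        generalize √(1 + s * |u i + n i|) = Z
        generalize (1 + δ * |u i + n i|) ^ 2 = W
        ring
  have hs1 : s * (2 / √(s * δ)) = 2 * √(s / δ) := by
    rw [Real.sqrt_mul hs.le, Real.sqrt_div hs.le]
    have := Real.mul_self_sqrt hs.le
    have h1 := Real.sqrt_pos.2 hs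
    have h2 := Real.sqrt_pos.2 hδ
    field_simp
    linarith
  calc _ ≤ _ := ENNReal.tsum_le_tsum hle
    _ ≤ ENNReal.ofReal G ^ 2 * ∑' m, f m :=
      tsum_fin_three_le (i := i) f (fun m => g (u i + m)) (fun _ _ => hG _)
    _ ≤ ENNReal.ofReal G ^ 2 * (ENNReal.ofReal (16 * K ^ 3 * s) *
        (2 * ENNReal.ofReal (1 + 2 / √(s * δ)))) := by
      rw [ENNReal.tsum_mul_left]
      gcongr
      exact tsum_int_abs_le (rayWeight_antitone hδ hs) (rayWeight_nonneg δ s)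
        (sum_rayWeight_le hδ hs) _
    _ = ENNReal.ofReal (G ^ 2 * (16 * K ^ 3 * s * (2 * (1 + 2 / √(s * δ))))) := by
      rw [ENNReal.ofReal_mul (by positivity : 0 ≤ G ^ 2),
        ENNReal.ofReal_mul (by positivity : 0 ≤ 16 * K ^ 3 * s),
        ENNReal.ofReal_mul zero_le_two, ENNReal.ofReal_pow hG0.le, ENNReal.ofReal_ofNat]
    _ ≤ _ := by
      refine ENNReal.ofReal_le_ofReal ?_
      have e : G ^ 2 * (16 * K ^ 3 * s * (2 * (1 + 2 / √(s * δ)))) =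
          32 * K ^ 3 * G ^ 2 * (s + s * (2 / √(s * δ))) := by ring
      rw [e, hs1]
      have : 0 ≤ 32 * K ^ 3 * G ^ 2 * s := by positivity
      linarith

attribute [local instance] instMeasureSpaceUnitAddCircle instIsAddHaarMeasureUnitAddCircleVolume
  instIsProbabilityMeasureUnitAddCircleVolume

open UnitAddTorus

/-- The three-dimensional torus. -/
abbrev T3 := UnitAddTorus (Fin 3)

/-- The projection of `ℝ³` onto the torus. -/
def torusMk (u : Fin 3 → ℝ) : T3 := fun i => (u i : UnitAddCircle)

lemma measurable_torusMk : Measurable torusMk :=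
  measurable_pi_lambda _ fun i => AddCircle.measurable_mk'.comp (measurable_pi_apply i)

lemma torusMk_add_intVec (u : Fin 3 → ℝ) (n : Fin 3 → ℤ) :
    torusMk (u + intVec n) = torusMk u := by
  ext i
  simp [torusMk, intVec]

lemma mFourier_torusMk (k : Fin 3 → ℤ) (u : Fin 3 → ℝ) :
    mFourier k (torusMk u) = cexp (2 * Real.pi * I * ((∑ i, (k i : ℝ) * u i : ℝ) : ℂ)) := by
  simp only [mFourier, torusMk, ContinuousMap.coe_mk, fourier_coe_apply]
  rw [← Complex.exp_sum]
  congr 1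
  push_cast
  rw [Finset.mul_sum]
  refine Finset.sum_congr rfl fun i _ => ?_
  ring

lemma norm_mFourier_apply (k : Fin 3 → ℤ) (x : T3) : ‖mFourier k x‖ = 1 := by
  simp only [mFourier, ContinuousMap.coe_mk, norm_prod, fourier_apply, Circle.norm_coe,
    Finset.prod_const_one]

lemma mFourier_apply_add (k : Fin 3 → ℤ) (x y : T3) :
    mFourier k (x + y) = mFourier k x * mFourier k y := by
  simp [mFourier, fourier_apply, smul_add, AddCircle.toCircle_add, Finset.prod_mul_distrib]

lemma mFourierCoeff_translate (h : T3 → ℂ) (y : T3) (k : Fin 3 → ℤ) :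
    mFourierCoeff (fun x => h (x + y)) k = mFourier k y * mFourierCoeff h k := by
  unfold mFourierCoeff
  rw [← integral_add_right_eq_self (fun t => mFourier (-k) t • h t) y, ← integral_const_mul]
  refine integral_congr_ae (Filter.Eventually.of_forall fun t => ?_)
  have h1 : mFourier k y * mFourier (-k) y = 1 := by
    rw [← mFourier_add]; simp [mFourier_zero]
  simp only [smul_eq_mul, mFourier_apply_add]
  linear_combination (-(mFourier (-k) t * h (t + y))) * h1

lemma memLp_two_of_norm_le_one {h : T3 → ℂ} (hm : Measurable h) (hb : ∀ x, ‖h x‖ ≤ 1) :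
    MemLp h 2 (volume : Measure T3) :=
  MemLp.of_bound hm.aestronglyMeasurable 1 (Filter.Eventually.of_forall hb)

lemma mFourierCoeff_toLp {h : T3 → ℂ} (hh : MemLp h 2 (volume : Measure T3)) (k : Fin 3 → ℤ) :
    mFourierCoeff (hh.toLp h) k = mFourierCoeff h k := by
  unfold mFourierCoeff
  refine integral_congr_ae ?_
  filter_upwards [hh.coeFn_toLp] with x hx
  rw [hx]

lemma hasSum_sq_mFourierCoeff_of_bdd {h : T3 → ℂ} (hm : Measurable h) (hb : ∀ x, ‖h x‖ ≤ 1) :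
    HasSum (fun k => ‖mFourierCoeff h k‖ ^ 2) (∫ x, ‖h x‖ ^ 2) := by
  have hh := memLp_two_of_norm_le_one hm hb
  have h1 := hasSum_sq_mFourierCoeff (hh.toLp h)
  simp_rw [mFourierCoeff_toLp] at h1
  convert h1 using 1
  refine integral_congr_ae ?_
  filter_upwards [hh.coeFn_toLp] with x hx
  rw [hx]

/-- The autocorrelation of `h`. -/
noncomputable def autocorr (h : T3 → ℂ) (y : T3) : ℂ := ∫ x, conj (h x) * h (x + y)

lemma hasSum_autocorr {h : T3 → ℂ} (hm : Measurable h) (hb : ∀ x, ‖h x‖ ≤ 1) (y : T3) :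
    HasSum (fun k => mFourier k y * (‖mFourierCoeff h k‖ ^ 2 : ℝ)) (autocorr h y) := by
  have hh := memLp_two_of_norm_le_one hm hb
  have hm' : Measurable fun x => h (x + y) := hm.comp (measurable_add_const y)
  have hh' := memLp_two_of_norm_le_one hm' fun x => hb (x + y)
  have h1 := hasSum_prod_mFourierCoeff (hh.toLp h) (hh'.toLp _)
  simp_rw [mFourierCoeff_toLp, mFourierCoeff_translate] at h1
  convert h1 using 1
  · ext k
    rw [← Complex.normSq_eq_norm_sq, Complex.normSq_eq_conj_mul_self]
    ring
  · refine integral_congr_ae ?_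
    filter_upwards [hh.coeFn_toLp, hh'.coeFn_toLp] with x hx hx'
    rw [hx, hx']

lemma lintegral_autocorr_le {h : T3 → ℂ} (hm : Measurable h) :
    ∫⁻ y, ‖autocorr h y‖ₑ ≤ (∫⁻ x, ‖h x‖ₑ) ^ 2 := by
  calc ∫⁻ y, ‖autocorr h y‖ₑ ≤ ∫⁻ y, ∫⁻ x, ‖h x‖ₑ * ‖h (x + y)‖ₑ := by
        refine lintegral_mono fun y => (enorm_integral_le_lintegral_enorm _).trans_eq ?_
        refine lintegral_congr fun x => ?_
        rw [enorm_mul, RCLike.enorm_conj]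
    _ = ∫⁻ x, ∫⁻ y, ‖h x‖ₑ * ‖h (x + y)‖ₑ := by
        refine lintegral_lintegral_swap ?_
        exact Measurable.aemeasurable (by unfold Function.uncurry; fun_prop)
    _ = ∫⁻ x, ‖h x‖ₑ * ∫⁻ y, ‖h y‖ₑ := by
        refine lintegral_congr fun x => ?_
        rw [lintegral_const_mul _ (by fun_prop)]
        congr 1
        exact lintegral_add_left_eq_self (fun y => ‖h y‖ₑ) x
    _ = (∫⁻ x, ‖h x‖ₑ) ^ 2 := by
        rw [lintegral_mul_const _ (by fun_prop), sq]

lemma lintegral_le_tsum_translate {G : (Fin 3 → ℝ) → ℝ≥0∞} (hG : Measurable G) :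
    ∫⁻ u, G u ≤ ∫⁻ u in {x : Fin 3 → ℝ | ∀ i, x i ∈ Set.Ioc ((0 : Fin 3 → ℝ) i) ((0 : Fin 3 → ℝ) i + 1)},
      ∑' n : Fin 3 → ℤ, G (u + intVec n) := by
  set Q := {x : Fin 3 → ℝ | ∀ i, x i ∈ Set.Ioc ((0 : Fin 3 → ℝ) i) ((0 : Fin 3 → ℝ) i + 1)}
  have hQ : MeasurableSet Q := MeasurableSet.univ_pi' fun i => measurableSet_Ioc
  have hcov : (⋃ n : Fin 3 → ℤ, (fun u => u - intVec n) ⁻¹' Q) = Set.univ := by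
    refine Set.eq_univ_of_forall fun u => Set.mem_iUnion.2 ⟨fun i => ⌈u i⌉ - 1, fun i => ?_⟩
    have h1 := Int.le_ceil (u i)
    have h2 := Int.ceil_lt_add_one (u i)
    simp only [intVec, Pi.sub_apply, Pi.zero_apply, Set.mem_Ioc]
    push_cast
    constructor <;> linarith
  calc ∫⁻ u, G u = ∫⁻ u in ⋃ n : Fin 3 → ℤ, (fun u => u - intVec n) ⁻¹' Q, G u := by
        rw [hcov, setLIntegral_univ]
    _ ≤ ∑' n : Fin 3 → ℤ, ∫⁻ u in (fun u => u - intVec n) ⁻¹' Q, G u := lintegral_iUnion_le _ _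
    _ = ∑' n : Fin 3 → ℤ, ∫⁻ u in Q, G (u + intVec n) := by
        refine tsum_congr fun n => ?_
        have h1 := (measurePreserving_sub_right volume (intVec n)).setLIntegral_comp_preimage hQ
          (f := fun u => G (u + intVec n)) (hG.comp (measurable_add_const _))
        simpa using h1
    _ = ∫⁻ u in Q, ∑' n : Fin 3 → ℤ, G (u + intVec n) :=
        (lintegral_tsum fun n => (hG.comp (measurable_add_const _)).aemeasurable).symm

lemma integrable_of_tsum_translate_le {K : (Fin 3 → ℝ) → ℂ} (hKm : Measurable K) {D : ℝ}
    (hD : ∀ u, ∑' n : Fin 3 → ℤ, ENNReal.ofReal ‖K (u + intVec n)‖ ≤ ENNReal.ofReal D) :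
    Integrable K := by
  refine ⟨hKm.aestronglyMeasurable, (lintegral_le_tsum_translate hKm.enorm).trans_lt ?_⟩
  refine (lintegral_mono (g := fun _ => ENNReal.ofReal D) fun u => ?_).trans_lt ?_
  · simpa only [ofReal_norm] using hD u
  · rw [← lintegral_preimage (fun _ : T3 => ENNReal.ofReal D) 0, lintegral_const]
    simp

/-- A multiplier whose inverse Fourier transform has absolutely summable periodization bounded by
`D` maps `L¹` to `L^∞` with norm at most `D`. -/
theorem norm_tsum_multiplier_le {K : (Fin 3 → ℝ) → ℂ} (hKm : Measurable K)
    {D : ℝ} (hD0 : 0 ≤ D)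
    (hD : ∀ u, ∑' n : Fin 3 → ℤ, ENNReal.ofReal ‖K (u + intVec n)‖ ≤ ENNReal.ofReal D)
    {h : T3 → ℂ} (hm : Measurable h) (hb : ∀ x, ‖h x‖ ≤ 1) :
    ‖∑' k, (∫ u, K u * mFourier k (torusMk u)) * (‖mFourierCoeff h k‖ ^ 2 : ℝ)‖ ≤
      D * (∫ x, ‖h x‖) ^ 2 := by
  have hsum := hasSum_sq_mFourierCoeff_of_bdd hm hb
  have hK := integrable_of_tsum_translate_le hKm hD
  have hmF (k) : Measurable fun u => mFourier k (torusMk u) :=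
    (mFourier k).continuous.measurable.comp measurable_torusMk
  have key := hasSum_integral_of_summable_integral_norm (μ := volume)
    (F := fun k u => K u * (mFourier k (torusMk u) * (‖mFourierCoeff h k‖ ^ 2 : ℝ)))
    (fun k => by
      refine hK.mul_bdd (c := ‖mFourierCoeff h k‖ ^ 2)
        ((hmF k).mul_const _).aestronglyMeasurable (Filter.Eventually.of_forall fun u => ?_)
      rw [norm_mul, norm_mFourier_apply, one_mul, Complex.norm_real, Real.norm_eq_abs,
        abs_of_nonneg (sq_nonneg _)])
    (by
      have : (fun k => ∫ u, ‖K u * (mFourier k (torusMk u) * (‖mFourierCoeff h k‖ ^ 2 : ℝ))‖) =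
          fun k => (∫ u, ‖K u‖) * ‖mFourierCoeff h k‖ ^ 2 := by
        ext k
        rw [← integral_mul_const]
        congr 1
        ext u
        rw [norm_mul, norm_mul, norm_mFourier_apply, one_mul, Complex.norm_real, Real.norm_eq_abs,
          abs_of_nonneg (sq_nonneg _)]
      rw [this]
      exact hsum.summable.mul_left _)
  have e1 : ∀ k, ∫ u, K u * (mFourier k (torusMk u) * (‖mFourierCoeff h k‖ ^ 2 : ℝ)) =
      (∫ u, K u * mFourier k (torusMk u)) * (‖mFourierCoeff h k‖ ^ 2 : ℝ) := by
    intro k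
    rw [← integral_mul_const]
    congr 1; ext u; ring
  have e2 : ∀ u, ∑' k, K u * (mFourier k (torusMk u) * (‖mFourierCoeff h k‖ ^ 2 : ℝ)) =
      K u * autocorr h (torusMk u) := fun u =>
    ((hasSum_autocorr hm hb (torusMk u)).mul_left _).tsum_eq
  simp_rw [e1, e2] at key
  rw [key.tsum_eq]
  have hA : Measurable (autocorr h) := by
    have : StronglyMeasurable fun y => ∫ x, conj (h x) * h (x + y) := by
      refine StronglyMeasurable.integral_prod_right' (f := fun p : T3 × T3 =>
        conj (h p.2) * h (p.2 + p.1)) ?_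
      exact Measurable.stronglyMeasurable (by fun_prop)
    exact this.measurable
  have hint : Integrable h (volume : Measure T3) :=
    (memLp_two_of_norm_le_one hm hb).integrable (by norm_num)
  have hnorm : ENNReal.ofReal (∫ x, ‖h x‖) = ∫⁻ x, ‖h x‖ₑ :=
    ofReal_integral_norm_eq_lintegral_enorm hint
  have hpos : 0 ≤ ∫ x, ‖h x‖ := integral_nonneg fun _ => norm_nonneg _
  rw [← ENNReal.ofReal_le_ofReal_iff (by positivity), ofReal_norm]
  calc ‖∫ u, K u * autocorr h (torusMk u)‖ₑ ≤ ∫⁻ u, ‖K u * autocorr h (torusMk u)‖ₑ :=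
        enorm_integral_le_lintegral_enorm _
    _ ≤ _ := lintegral_le_tsum_translate
        (hKm.mul (hA.comp measurable_torusMk)).enorm
    _ ≤ ∫⁻ u in {x : Fin 3 → ℝ | ∀ i, x i ∈ Set.Ioc ((0 : Fin 3 → ℝ) i) ((0 : Fin 3 → ℝ) i + 1)},
          ENNReal.ofReal D * ‖autocorr h (torusMk u)‖ₑ := by
        refine lintegral_mono fun u => ?_
        simp_rw [torusMk_add_intVec, enorm_mul]
        rw [ENNReal.tsum_mul_right]
        gcongr
        simpa only [ofReal_norm] using hD u
    _ = ENNReal.ofReal D * ∫⁻ y, ‖autocorr h y‖ₑ := by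
        rw [lintegral_const_mul _ (f := fun u => ‖autocorr h (torusMk u)‖ₑ)
            (hA.comp measurable_torusMk).enorm,
          lintegral_preimage (fun y => ‖autocorr h y‖ₑ) 0]
        rfl
    _ ≤ ENNReal.ofReal D * (∫⁻ x, ‖h x‖ₑ) ^ 2 := by
        gcongr
        exact lintegral_autocorr_le hm
    _ = ENNReal.ofReal (D * (∫ x, ‖h x‖) ^ 2) := by
        rw [ENNReal.ofReal_mul hD0, ENNReal.ofReal_pow hpos, hnorm]

section

open scoped MatrixOrder Matrix.Norms.L2Operator

lemma exists_transpose_mul_self {A : Matrix (Fin 3) (Fin 3) ℝ} (hA : A.PosDef) :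
    ∃ B : Matrix (Fin 3) (Fin 3) ℝ, IsUnit B ∧ A = B.transpose * B := by
  obtain ⟨B, hB, h⟩ := CStarAlgebra.isStrictlyPositive_iff_eq_star_mul_self.mp
    hA.isStrictlyPositive
  refine ⟨B, hB, ?_⟩
  rw [h, Matrix.star_eq_conjTranspose, Matrix.conjTranspose_eq_transpose_of_trivial]

end

/-- The continuous linear equivalence `ℝ³ ≃ E3` given by an invertible matrix. -/
noncomputable def matrixEquiv (B : Matrix (Fin 3) (Fin 3) ℝ) (hB : IsUnit B) :
    (Fin 3 → ℝ) ≃L[ℝ] E3 :=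
  ((Matrix.toLinearEquiv' B hB.invertible).trans
    (WithLp.linearEquiv 2 ℝ (Fin 3 → ℝ)).symm).toContinuousLinearEquiv

lemma matrixEquiv_apply (B : Matrix (Fin 3) (Fin 3) ℝ) (hB : IsUnit B) (x : Fin 3 → ℝ) :
    matrixEquiv B hB x = WithLp.toLp 2 (B.mulVec x) := by
  have := DFunLike.congr_fun (Matrix.toLinearEquiv'_apply B hB.invertible) x
  simp only [matrixEquiv, LinearEquiv.coe_toContinuousLinearEquiv', LinearEquiv.trans_apply]
  rw [← Matrix.toLin'_apply, ← this]
  rfl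

lemma exists_integral_comp_eq (T : (Fin 3 → ℝ) ≃L[ℝ] E3) :
    ∃ c : ℝ, 0 < c ∧ ∀ g : E3 → ℂ, ∫ y, g y = c * ∫ u, g (T u) := by
  have h := Measure.isAddLeftInvariant_eq_smul (volume : Measure E3)
    (Measure.map T (volume : Measure (Fin 3 → ℝ)))
  refine ⟨Measure.addHaarScalarFactor (volume : Measure E3)
    (Measure.map T (volume : Measure (Fin 3 → ℝ))), ?_, fun g => ?_⟩
  · exact_mod_cast Measure.addHaarScalarFactor_pos_of_isAddHaarMeasure _ _
  · conv_lhs => rw [h]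
    have h1 := T.toHomeomorph.measurableEmbedding.integral_map (μ := volume) g
    rw [ContinuousLinearEquiv.coe_toHomeomorph] at h1
    rw [integral_smul_nnreal_measure, h1]
    rfl

/-- Linear coordinates in which `Q` is the Euclidean norm, together with dual coordinates. -/
theorem exists_coordinates {A : Matrix (Fin 3) (Fin 3) ℝ} (hA : A.PosDef) :
    ∃ (B T : (Fin 3 → ℝ) ≃L[ℝ] E3) (c : ℝ), 0 < c ∧ (∀ x, ‖B x‖ ^ 2 = Qform A x) ∧
      (∀ x u, ⟪B x, T u⟫_ℝ = 2 * Real.pi * ∑ i, x i * u i) ∧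
      ∀ g : E3 → ℂ, ∫ y, g y = c * ∫ u, g (T u) := by
  obtain ⟨B, hB, h⟩ := exists_transpose_mul_self hA
  have hdet : IsUnit B.transpose.det := by
    rw [Matrix.det_transpose]; exact (Matrix.isUnit_iff_isUnit_det B).1 hB
  have hpi : (2 * Real.pi) ≠ 0 := by positivity
  have hT : IsUnit ((2 * Real.pi) • (B.transpose)⁻¹) := by
    rw [Matrix.isUnit_iff_isUnit_det, Matrix.det_smul]
    exact (IsUnit.mk0 _ (pow_ne_zero _ hpi)).mul (Matrix.isUnit_nonsing_inv_det _ hdet)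
  obtain ⟨c, hc, hc'⟩ := exists_integral_comp_eq (matrixEquiv _ hT)
  refine ⟨matrixEquiv B hB, matrixEquiv _ hT, c, hc, fun x => ?_, fun x u => ?_, hc'⟩
  · have h1 : Qform A x = x ⬝ᵥ (A.mulVec x) := by
      simp only [Qform, dotProduct, Matrix.mulVec, Finset.mul_sum]
      exact Finset.sum_congr rfl fun i _ => Finset.sum_congr rfl fun j _ => by ring
    rw [h1, h, ← Matrix.mulVec_mulVec, Matrix.dotProduct_mulVec, Matrix.vecMul_transpose,
      matrixEquiv_apply, EuclideanSpace.real_norm_sq_eq]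
    simp [dotProduct, sq]
  · rw [matrixEquiv_apply, matrixEquiv_apply, EuclideanSpace.inner_toLp_toLp, star_trivial,
      dotProduct_comm, Matrix.smul_mulVec, dotProduct_smul, smul_eq_mul,
      ← Matrix.vecMul_transpose, ← Matrix.dotProduct_mulVec, Matrix.mulVec_mulVec,
      Matrix.mul_nonsing_inv _ hdet, Matrix.one_mulVec]
    rfl

lemma exists_sum_exp_norm_le (B : (Fin 3 → ℝ) ≃L[ℝ] E3) :
    ∃ G : ℝ, 0 < G ∧ ∀ (S : Finset (Fin 3 → ℤ)) (v : E3),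
      ∑ k ∈ S, Real.exp (-‖B (intVec k) - v‖) ≤ G := by
  obtain ⟨G, hG, h⟩ := exists_tsum_exp_norm_le B
  refine ⟨G, hG, fun S v => ?_⟩
  rw [← ENNReal.ofReal_le_ofReal_iff hG.le, ENNReal.ofReal_sum_of_nonneg fun _ _ => by positivity]
  exact (ENNReal.sum_le_tsum S).trans (h v)

lemma integral_exp_cap_le {ν : E3} (hν : ‖ν‖ = 1) {β : ℝ} (hβ : 0 < β) :
    ∫ ω, Real.exp (β * (⟪ν, ω⟫_ℝ - 1)) ∂sphereMeasure ≤ 1 / (2 * β) := by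
  have hn : ‖β • ν‖ = β := by rw [norm_smul, hν, mul_one, Real.norm_eq_abs, abs_of_pos hβ]
  have h0 : β • ν ≠ 0 := by rw [← norm_pos_iff, hn]; exact hβ
  have h1 := sphere_laplace_real_le_div h0
  rw [hn] at h1
  have h2 : ∀ ω : E3, Real.exp (β * (⟪ν, ω⟫_ℝ - 1)) =
      Real.exp (-β) * Real.exp ⟪β • ν, ω⟫_ℝ := by
    intro ω
    rw [← Real.exp_add, real_inner_smul_left]
    ring_nf
  simp_rw [h2]
  rw [integral_const_mul]
  calc _ ≤ Real.exp (-β) * (Real.exp β / (2 * β)) := by gcongr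
    _ = 1 / (2 * β) := by
      rw [← mul_div_assoc, ← Real.exp_add, neg_add_cancel, Real.exp_zero]

/-- The set of lattice points of the shell which point in the direction of the cap. -/
def IsCapPoint (B : (Fin 3 → ℝ) ≃L[ℝ] E3) (K : ℝ) (ν : E3) (lam δ : ℝ) (k : Fin 3 → ℤ) : Prop :=
  |‖B (intVec k)‖ - lam| < δ ∧ ‖‖B (intVec k)‖⁻¹ • B (intVec k) - ν‖ ≤ K * δ

theorem exists_card_capPoints_le (B : (Fin 3 → ℝ) ≃L[ℝ] E3) (K : ℝ) :
    ∃ C : ℝ, 0 < C ∧ ∀ ν : E3, ‖ν‖ = 1 → ∀ lam δ : ℝ, 1 < lam → 0 < δ → δ < 1 → 1 < lam * δ →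
      ∀ S : Finset (Fin 3 → ℤ), (∀ k ∈ S, IsCapPoint B K ν lam δ k) →
        (S.card : ℝ) ≤ C * (lam * δ) ^ 2 := by
  obtain ⟨G, hG, hGS⟩ := exists_sum_exp_norm_le B
  set c := Real.exp (-(K ^ 2 + 1)) / 7 with hc
  have hc0 : 0 < c := by positivity
  refine ⟨c⁻¹ * (Real.exp (1 / 2) * G), by positivity, ?_⟩
  intro ν hν lam δ hlam hδ hδ1 hM S hS
  set β := 1 / δ ^ 2 with hβ
  have hβ0 : 0 < β := by positivity
  have h1 : c * S.card ≤ ∑ k ∈ S, capMultiplier ν lam β 1 (B (intVec k)) := by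
    rw [mul_comm, ← nsmul_eq_mul]
    exact Finset.card_nsmul_le_sum _ _ _ fun k hk =>
      le_capMultiplier hν hlam hδ hδ1 hδ1.le le_rfl hM.le (hS k hk).1 (hS k hk).2
  have hint : ∀ ξ : E3, Integrable (fun ω => Real.exp (β * (⟪ν, ω⟫_ℝ - 1)) *
      Real.exp (-(‖ξ - lam • ω‖ ^ 2 / (2 * (1 : ℝ) ^ 2)))) sphereMeasure := fun ξ =>
    sphere_integrable_real (by fun_prop)
  have h2 : ∑ k ∈ S, capMultiplier ν lam β 1 (B (intVec k)) ≤
      lam ^ 2 * ((Real.exp (1 / 2) * G) * (1 / (2 * β))) := by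
    simp only [capMultiplier, div_one]
    rw [← Finset.mul_sum, ← integral_finsetSum _ fun k _ => hint _]
    gcongr
    calc _ ≤ ∫ ω, (Real.exp (1 / 2) * G) * Real.exp (β * (⟪ν, ω⟫_ℝ - 1)) ∂sphereMeasure := by
          refine integral_mono (integrable_finsetSum _ fun k _ => hint _)
            (sphere_integrable_real (by fun_prop)) fun ω => ?_
          simp only
          rw [← Finset.mul_sum, mul_comm]
          gcongr
          calc _ ≤ ∑ k ∈ S, Real.exp (1 / 2) * Real.exp (-‖B (intVec k) - lam • ω‖) := by
                refine Finset.sum_le_sum fun k _ => ?_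
                rw [← Real.exp_add]
                apply Real.exp_le_exp.2
                nlinarith [sq_nonneg (‖B (intVec k) - lam • ω‖ - 1)]
            _ ≤ _ := by
                rw [← Finset.mul_sum]
                gcongr
                exact hGS S _
      _ ≤ _ := by
          rw [integral_const_mul]
          gcongr
          exact integral_exp_cap_le hν hβ0
  have h3 : lam ^ 2 * ((Real.exp (1 / 2) * G) * (1 / (2 * β))) ≤
      (Real.exp (1 / 2) * G) * (lam * δ) ^ 2 := by
    have : 1 / (2 * β) = δ ^ 2 / 2 := by rw [hβ]; field_simp
    rw [this]
    have : 0 < Real.exp (1 / 2) * G := by positivity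
    nlinarith [mul_pos this (show 0 < (lam * δ) ^ 2 by positivity)]
  rw [mul_assoc, ← div_eq_inv_mul, le_div_iff₀ hc0, mul_comm]
  exact h1.trans (h2.trans h3)

lemma fourier_capDiff (ν : E3) (lam : ℝ) {δ s : ℝ} (hδ : 0 < δ) (hs : 0 < s) (ξ : E3) :
    ∫ y, capDiff ν lam δ s y * cexp (I * (⟪ξ, y⟫_ℝ : ℝ)) =
      ((capMultiplier ν lam (1 / δ ^ 2) δ ξ - δ / s * capMultiplier ν lam (1 / δ ^ 2) s ξ : ℝ) :
        ℂ) := by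
  have hi : ∀ r, 0 < r → Integrable fun y : E3 => capKernel ν lam (1 / δ ^ 2) r y *
      cexp (I * (⟪ξ, y⟫_ℝ : ℝ)) := fun r hr => by
    refine (integrable_capKernel ν lam _ hr).mul_bdd (c := 1)
      (Continuous.aestronglyMeasurable (by fun_prop)) (Filter.Eventually.of_forall fun y => ?_)
    rw [mul_comm, Complex.norm_exp_ofReal_mul_I]
  have h1 : ∀ y : E3, capDiff ν lam δ s y * cexp (I * (⟪ξ, y⟫_ℝ : ℝ)) =
      capKernel ν lam (1 / δ ^ 2) δ y * cexp (I * (⟪ξ, y⟫_ℝ : ℝ)) -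
        ((δ / s : ℝ) : ℂ) * (capKernel ν lam (1 / δ ^ 2) s y * cexp (I * (⟪ξ, y⟫_ℝ : ℝ))) := by
    intro y
    simp only [capDiff]
    ring
  simp_rw [h1]
  rw [integral_sub (hi δ hδ) ((hi s hs).const_mul _), integral_const_mul,
    fourier_capKernel ν lam _ hδ, fourier_capKernel ν lam _ hs]
  push_cast
  rfl

theorem exists_tsum_capMultiplier_le {B T : (Fin 3 → ℝ) ≃L[ℝ] E3} {c : ℝ} (hc : 0 < c)
    (hBT : ∀ x u, ⟪B x, T u⟫_ℝ = 2 * Real.pi * ∑ i, x i * u i)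
    (hT : ∀ g : E3 → ℂ, ∫ y, g y = c * ∫ u, g (T u)) :
    ∃ D : ℝ, 0 < D ∧ ∀ ν : E3, ‖ν‖ = 1 → ∀ lam δ s : ℝ, 0 < δ → 1 ≤ lam * δ → δ ≤ s →
      ∀ h : T3 → ℂ, Measurable h → (∀ x, ‖h x‖ ≤ 1) →
        ∑' k, capMultiplier ν lam (1 / δ ^ 2) δ (B (intVec k)) * ‖mFourierCoeff h k‖ ^ 2 ≤
          8 * (δ / s) * (∫ x, ‖h x‖ ^ 2) +
            D * (lam * δ) * (s + √(s / δ)) * (∫ x, ‖h x‖) ^ 2 := by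
  obtain ⟨C, hC, hker⟩ := exists_tsum_kernel_le T
  refine ⟨c * 24 * C, by positivity, ?_⟩
  intro ν hν lam δ s hδ hM hs h hm hb
  have hs0 : 0 < s := hδ.trans_le hs
  have hlam : 0 < lam := by
    by_contra! hl
    nlinarith
  have hM0 : 0 < lam * δ := by linarith
  have hβ : 0 ≤ 1 / δ ^ 2 := by positivity
  set K : (Fin 3 → ℝ) → ℂ := fun u => c * capDiff ν lam δ s (T u) with hK
  have hKm : Measurable K := by
    have h1 : Measurable (capDiff ν lam δ s) :=
      (measurable_capKernel _ _ _ _).sub ((measurable_capKernel _ _ _ _).const_mul _)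
    exact (h1.comp T.continuous.measurable).const_mul _
  set D := c * 24 * C * (lam * δ) * (s + √(s / δ)) with hDdef
  have hD0 : 0 ≤ D := by positivity
  have hD : ∀ u, ∑' n : Fin 3 → ℤ, ENNReal.ofReal ‖K (u + intVec n)‖ ≤ ENNReal.ofReal D := by
    intro u
    have h1 := hker ν hν δ s hδ hs0 (fun y => ‖capDiff ν lam δ s y‖ / (24 * (lam * δ)))
      (fun y => by
        rw [div_le_iff₀ (by positivity)]
        refine (norm_capDiff_le_mul hν hδ hM hs y).trans_eq (by ring))
      (fun y => by
        rw [← mul_div_assoc, div_le_iff₀ (by positivity)]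
        refine (norm_mul_norm_capDiff_le hν hδ hM hs y).trans_eq (by ring)) u
    calc ∑' n : Fin 3 → ℤ, ENNReal.ofReal ‖K (u + intVec n)‖ =
        ∑' n : Fin 3 → ℤ, ENNReal.ofReal (c * (24 * (lam * δ))) *
          ENNReal.ofReal (‖capDiff ν lam δ s (T (u + intVec n))‖ / (24 * (lam * δ))) := by
          refine tsum_congr fun n => ?_
          rw [← ENNReal.ofReal_mul (by positivity), hK]
          congr 1
          simp only [norm_mul, Complex.norm_real, Real.norm_eq_abs, abs_of_pos hc]
          field_simp
      _ ≤ ENNReal.ofReal (c * (24 * (lam * δ))) * ENNReal.ofReal (C * (s + √(s / δ))) := by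
          rw [ENNReal.tsum_mul_left]
          gcongr
      _ = ENNReal.ofReal D := by
          rw [← ENNReal.ofReal_mul (by positivity), hDdef]
          congr 1
          ring
  have hmain := norm_tsum_multiplier_le hKm hD0 hD hm hb
  have hmul : ∀ k, ∫ u, K u * mFourier k (torusMk u) =
      ((capMultiplier ν lam (1 / δ ^ 2) δ (B (intVec k)) -
        δ / s * capMultiplier ν lam (1 / δ ^ 2) s (B (intVec k)) : ℝ) : ℂ) := by
    intro k
    rw [← fourier_capDiff ν lam hδ hs0, hT, ← integral_const_mul]
    congr 1
    ext u
    rw [mFourier_torusMk, hBT, hK]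
    simp only [intVec]
    push_cast
    ring_nf
  simp_rw [hmul, ← Complex.ofReal_mul, ← Complex.ofReal_tsum, Complex.norm_real] at hmain
  have hsum := hasSum_sq_mFourierCoeff_of_bdd hm hb
  have hle : ∀ r, 0 < r → ∀ k, capMultiplier ν lam (1 / δ ^ 2) r (B (intVec k)) *
      ‖mFourierCoeff h k‖ ^ 2 ≤ 8 * ‖mFourierCoeff h k‖ ^ 2 := fun r hr k => by
    gcongr
    exact capMultiplier_le hν hlam hβ hr _
  have hsm : ∀ r, 0 < r → Summable fun k => capMultiplier ν lam (1 / δ ^ 2) r (B (intVec k)) *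
      ‖mFourierCoeff h k‖ ^ 2 := fun r hr =>
    Summable.of_nonneg_of_le (fun k => mul_nonneg (capMultiplier_nonneg ..) (sq_nonneg _))
      (hle r hr) (hsum.summable.mul_left 8)
  have h8 : ∑' k, capMultiplier ν lam (1 / δ ^ 2) s (B (intVec k)) * ‖mFourierCoeff h k‖ ^ 2 ≤
      8 * ∫ x, ‖h x‖ ^ 2 := by
    rw [← hsum.tsum_eq, ← tsum_mul_left]
    exact (hsm s hs0).tsum_le_tsum (hle s hs0) (hsum.summable.mul_left 8)
  have hsplit : ∑' k, (capMultiplier ν lam (1 / δ ^ 2) δ (B (intVec k)) -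
        δ / s * capMultiplier ν lam (1 / δ ^ 2) s (B (intVec k))) * ‖mFourierCoeff h k‖ ^ 2 =
      ∑' k, capMultiplier ν lam (1 / δ ^ 2) δ (B (intVec k)) * ‖mFourierCoeff h k‖ ^ 2 -
      δ / s * ∑' k, capMultiplier ν lam (1 / δ ^ 2) s (B (intVec k)) *
        ‖mFourierCoeff h k‖ ^ 2 := by
    rw [← tsum_mul_left, ← (hsm δ hδ).tsum_sub ((hsm s hs0).mul_left _)]
    refine tsum_congr fun k => by ring
  have hfin := (le_abs_self _).trans hmain
  rw [hsplit] at hfin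
  have : δ / s * ∑' k, capMultiplier ν lam (1 / δ ^ 2) s (B (intVec k)) *
        ‖mFourierCoeff h k‖ ^ 2 ≤ δ / s * (8 * ∫ x, ‖h x‖ ^ 2) := by gcongr
  linarith

/-- The trigonometric polynomial on the torus with coefficients `a` on `S`. -/
noncomputable def trigPoly (S : Finset (Fin 3 → ℤ)) (a : (Fin 3 → ℤ) → ℂ) (x : T3) : ℂ :=
  ∑ k ∈ S, a k * mFourier k x

lemma continuous_trigPoly (S : Finset (Fin 3 → ℤ)) (a : (Fin 3 → ℤ) → ℂ) :
    Continuous (trigPoly S a) := by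
  unfold trigPoly
  fun_prop

lemma exists_dual_function (S : Finset (Fin 3 → ℤ)) (a : (Fin 3 → ℤ) → ℂ)
    (ha : ∑ k ∈ S, ‖a k‖ ^ 2 ≤ 1) {α : ℝ} (hα : 0 ≤ α) :
    ∃ h : T3 → ℂ, Measurable h ∧ (∀ x, ‖h x‖ ≤ 1) ∧
      ∫ x, ‖h x‖ = volume.real {x | α < ‖trigPoly S a x‖} ∧
      ∫ x, ‖h x‖ ^ 2 = volume.real {x | α < ‖trigPoly S a x‖} ∧
      (α * volume.real {x | α < ‖trigPoly S a x‖}) ^ 2 ≤ ∑ k ∈ S, ‖mFourierCoeff h k‖ ^ 2 := by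
  set F := trigPoly S a with hF
  have hFc : Continuous F := continuous_trigPoly S a
  set E := {x | α < ‖F x‖} with hE
  have hEm : MeasurableSet E := measurableSet_lt measurable_const hFc.norm.measurable
  set h : T3 → ℂ := E.indicator fun x => F x / ‖F x‖ with hh
  have hm : Measurable h :=
    (hFc.measurable.div (Complex.measurable_ofReal.comp hFc.norm.measurable)).indicator hEm
  have hn : ∀ x, ‖h x‖ = E.indicator 1 x := by
    intro x
    by_cases hx : x ∈ E
    · have : 0 < ‖F x‖ := hα.trans_lt hx
      simp only [hh, Set.indicator_of_mem hx, norm_div, Complex.norm_real, norm_norm,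
        div_self this.ne', Pi.one_apply]
    · simp [hh, Set.indicator_of_notMem hx]
  have hb : ∀ x, ‖h x‖ ≤ 1 := fun x => by
    rw [hn]; exact Set.indicator_le_self' (fun _ _ => zero_le_one) x
  have hi1 : ∫ x, ‖h x‖ = volume.real E := by
    simp_rw [hn]; exact integral_indicator_one hEm
  have hi2 : ∫ x, ‖h x‖ ^ 2 = volume.real E := by
    rw [← hi1]
    congr 1; ext x
    rw [hn]
    by_cases hx : x ∈ E <;> simp [hx]
  refine ⟨h, hm, hb, hi1, hi2, ?_⟩
  have hint : Integrable h (volume : Measure T3) :=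
    (memLp_two_of_norm_le_one hm hb).integrable (by norm_num)
  have h1 : ∫ x, h x * conj (F x) = ∑ k ∈ S, conj (a k) * mFourierCoeff h k := by
    have e1 : ∀ x, h x * conj (F x) = ∑ k ∈ S, conj (a k) * (mFourier (-k) x • h x) := by
      intro x
      simp only [hF, trigPoly, map_sum, map_mul, mFourier_neg, Finset.mul_sum, smul_eq_mul]
      exact Finset.sum_congr rfl fun k _ => by ring
    simp_rw [e1]
    rw [integral_finsetSum]
    · exact Finset.sum_congr rfl fun k _ => integral_const_mul _ _
    · intro k _
      refine Integrable.const_mul ?_ _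
      exact hint.bdd_mul (c := 1) (mFourier (-k)).continuous.aestronglyMeasurable
        (Filter.Eventually.of_forall fun x => (norm_mFourier_apply _ _).le)
  have h2 : ∫ x, h x * conj (F x) = ((∫ x in E, ‖F x‖ : ℝ) : ℂ) := by
    rw [← integral_indicator hEm, ← integral_complex_ofReal]
    refine integral_congr_ae (Filter.Eventually.of_forall fun x => ?_)
    by_cases hx : x ∈ E
    · have : 0 < ‖F x‖ := hα.trans_lt hx
      have h0 : (‖F x‖ : ℂ) ≠ 0 := by exact_mod_cast this.ne'
      simp only [hh, Set.indicator_of_mem hx]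
      rw [div_mul_eq_mul_div, Complex.mul_conj', sq, mul_div_assoc, div_self h0, mul_one]
    · simp [hh, Set.indicator_of_notMem hx]
  have h3 : α * volume.real E ≤ ∫ x in E, ‖F x‖ := by
    have hFi : Integrable (fun x => ‖F x‖) (volume : Measure T3) :=
      hFc.norm.integrable_of_hasCompactSupport (HasCompactSupport.of_compactSpace _)
    calc α * volume.real E = ∫ x in E, α := by simp [mul_comm]
      _ ≤ _ := setIntegral_mono_on (integrable_const _) hFi.integrableOn hEm
          fun x hx => le_of_lt hx
  have h4 : ‖∑ k ∈ S, conj (a k) * mFourierCoeff h k‖ ^ 2 ≤ ∑ k ∈ S, ‖mFourierCoeff h k‖ ^ 2 := by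
    calc ‖∑ k ∈ S, conj (a k) * mFourierCoeff h k‖ ^ 2 ≤
        (∑ k ∈ S, ‖a k‖ * ‖mFourierCoeff h k‖) ^ 2 := by
          gcongr
          refine (norm_sum_le _ _).trans_eq (Finset.sum_congr rfl fun k _ => ?_)
          rw [norm_mul, RCLike.norm_conj]
      _ ≤ (∑ k ∈ S, ‖a k‖ ^ 2) * ∑ k ∈ S, ‖mFourierCoeff h k‖ ^ 2 :=
          Finset.sum_mul_sq_le_sq_mul_sq _ _ _
      _ ≤ 1 * ∑ k ∈ S, ‖mFourierCoeff h k‖ ^ 2 := by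
          gcongr
      _ = _ := one_mul _
  refine le_trans ?_ h4
  rw [← h1, h2, Complex.norm_real, Real.norm_eq_abs, sq_abs]
  have : 0 ≤ volume.real E := measureReal_nonneg
  gcongr

/-- Optimization of the scale in the level set inequality. -/
lemma level_set_optimize {c₀ D M δ α e : ℝ} (hc₀ : 0 < c₀) (hc₁ : c₀ ≤ 1) (hD : 0 < D)
    (hM : 0 < M) (hδ : 0 < δ) (hα : 0 < α) (he0 : 0 ≤ e) (he : α ^ 2 * e ≤ 1)
    (h : ∀ s, δ ≤ s → c₀ * (α * e) ^ 2 ≤ 8 * (δ / s) * e + D * M * (s + √(s / δ)) * e ^ 2) :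
    e ≤ (64 * D / c₀ ^ 2) * (M * δ / α ^ 4) + (256 * D ^ 2 / c₀ ^ 3) * (M ^ 2 / α ^ 6) := by
  rcases he0.eq_or_lt with rfl | hepos
  · positivity
  set w := α ^ 2 * e with hw
  have hw0 : 0 < w := by positivity
  have h1 := h (16 * δ / (c₀ * w)) (by
    rw [le_div_iff₀ (by positivity)]
    nlinarith [mul_le_one₀ hc₁ hw0.le he])
  have e1 : 8 * (δ / (16 * δ / (c₀ * w))) * e = c₀ * (α * e) ^ 2 / 2 := by
    rw [hw]; field_simp; ring
  have e2 : 16 * δ / (c₀ * w) / δ = 16 / (c₀ * w) := by field_simp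
  rw [e1, e2] at h1
  set r := √(16 / (c₀ * w)) with hr
  have hr0 : 0 ≤ r := Real.sqrt_nonneg _
  have hr2 : r ^ 2 = 16 / (c₀ * w) := Real.sq_sqrt (by positivity)
  have h2 : c₀ * α ^ 2 / 2 ≤ D * M * (16 * δ / (c₀ * w) + r) := by
    have : 0 < e ^ 2 := by positivity
    refine le_of_mul_le_mul_right ?_ this
    nlinarith
  rcases le_total r (16 * δ / (c₀ * w)) with hle | hle
  · have h3 : c₀ * α ^ 2 / 2 ≤ D * M * (2 * (16 * δ / (c₀ * w))) := by
      refine h2.trans ?_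
      gcongr
      linarith
    have h4 : e ≤ (64 * D / c₀ ^ 2) * (M * δ / α ^ 4) := by
      have h5 : D * M * (2 * (16 * δ / (c₀ * w))) = 32 * D * M * δ / (c₀ * α ^ 2) / e := by
        rw [hw]; field_simp; ring
      rw [h5, le_div_iff₀ hepos, le_div_iff₀ (by positivity)] at h3
      have : (64 * D / c₀ ^ 2) * (M * δ / α ^ 4) = 64 * D * M * δ / (c₀ ^ 2 * α ^ 4) := by
        field_simp
      rw [this, le_div_iff₀ (by positivity)]
      nlinarith
    have : 0 ≤ (256 * D ^ 2 / c₀ ^ 3) * (M ^ 2 / α ^ 6) := by positivity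
    linarith
  · have h3 : c₀ * α ^ 2 / 2 ≤ D * M * (2 * r) := by
      refine h2.trans ?_
      gcongr
      linarith
    have h4 : (c₀ * α ^ 2 / 2) ^ 2 ≤ (D * M * (2 * r)) ^ 2 := by gcongr
    have h5 : e ≤ (256 * D ^ 2 / c₀ ^ 3) * (M ^ 2 / α ^ 6) := by
      have h6 : (D * M * (2 * r)) ^ 2 = 64 * D ^ 2 * M ^ 2 / (c₀ * α ^ 2) / e := by
        rw [mul_pow, mul_pow, mul_pow, hr2, hw]; field_simp; ring
      rw [h6, le_div_iff₀ hepos, le_div_iff₀ (by positivity)] at h4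
      have : (256 * D ^ 2 / c₀ ^ 3) * (M ^ 2 / α ^ 6) = 256 * D ^ 2 * M ^ 2 / (c₀ ^ 3 * α ^ 6) := by
        field_simp
      rw [this, le_div_iff₀ (by positivity)]
      nlinarith
    have : 0 ≤ (64 * D / c₀ ^ 2) * (M * δ / α ^ 4) := by positivity
    linarith

theorem exists_level_set_le {B T : (Fin 3 → ℝ) ≃L[ℝ] E3} {c : ℝ} (hc : 0 < c)
    (hBT : ∀ x u, ⟪B x, T u⟫_ℝ = 2 * Real.pi * ∑ i, x i * u i)
    (hT : ∀ g : E3 → ℂ, ∫ y, g y = c * ∫ u, g (T u)) (K : ℝ) :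
    ∃ C : ℝ, 0 < C ∧ ∀ ν : E3, ‖ν‖ = 1 → ∀ lam δ : ℝ, 1 < lam → 0 < δ → δ < 1 → 1 < lam * δ →
      ∀ S : Finset (Fin 3 → ℤ), (∀ k ∈ S, IsCapPoint B K ν lam δ k) →
        ∀ a : (Fin 3 → ℤ) → ℂ, ∑ k ∈ S, ‖a k‖ ^ 2 ≤ 1 → ∀ α : ℝ, 0 < α →
          α ^ 2 * volume.real {x | α < ‖trigPoly S a x‖} ≤ 1 ∧
          volume.real {x | α < ‖trigPoly S a x‖} ≤
            C * (lam * δ * δ / α ^ 4 + (lam * δ) ^ 2 / α ^ 6) := by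
  obtain ⟨D, hD, hmult⟩ := exists_tsum_capMultiplier_le hc hBT hT
  set c₀ := Real.exp (-(K ^ 2 + 1)) / 7 with hc₀
  have hc₀0 : 0 < c₀ := by positivity
  have hc₀1 : c₀ ≤ 1 := by
    have : Real.exp (-(K ^ 2 + 1)) ≤ 1 := Real.exp_le_one_iff.2 (by nlinarith [sq_nonneg K])
    rw [hc₀]; linarith
  refine ⟨64 * D / c₀ ^ 2 + 256 * D ^ 2 / c₀ ^ 3, by positivity, ?_⟩
  intro ν hν lam δ hlam hδ hδ1 hM S hS a ha α hα
  obtain ⟨h, hm, hb, hi1, hi2, hdual⟩ := exists_dual_function S a ha hα.le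
  set e := volume.real {x | α < ‖trigPoly S a x‖} with he
  have he0 : 0 ≤ e := measureReal_nonneg
  have hsum := hasSum_sq_mFourierCoeff_of_bdd hm hb
  have hw : α ^ 2 * e ≤ 1 := by
    have h1 : (α * e) ^ 2 ≤ e := by
      refine hdual.trans ((hsum.summable.sum_le_tsum S fun _ _ => sq_nonneg _).trans_eq ?_)
      rw [hsum.tsum_eq, hi2]
    rcases he0.eq_or_lt with h0 | h0
    · rw [← h0]; simp
    · nlinarith
  refine ⟨hw, ?_⟩
  have hM0 : 0 < lam * δ := by linarith
  have hopt := level_set_optimize hc₀0 hc₀1 hD hM0 hδ hα he0 hw (fun s hs => by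
    have h1 := hmult ν hν lam δ s hδ hM.le hs h hm hb
    rw [hi1, hi2] at h1
    refine le_trans ?_ h1
    have hsm : Summable fun k => capMultiplier ν lam (1 / δ ^ 2) δ (B (intVec k)) *
        ‖mFourierCoeff h k‖ ^ 2 :=
      Summable.of_nonneg_of_le (fun k => mul_nonneg (capMultiplier_nonneg ..) (sq_nonneg _))
        (fun k => by
          gcongr
          exact capMultiplier_le hν (by linarith) (by positivity) hδ _)
        (hsum.summable.mul_left 8)
    calc c₀ * (α * e) ^ 2 ≤ c₀ * ∑ k ∈ S, ‖mFourierCoeff h k‖ ^ 2 := by gcongr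
      _ ≤ ∑ k ∈ S, capMultiplier ν lam (1 / δ ^ 2) δ (B (intVec k)) *
          ‖mFourierCoeff h k‖ ^ 2 := by
          rw [Finset.mul_sum]
          refine Finset.sum_le_sum fun k hk => ?_
          gcongr
          exact le_capMultiplier hν hlam hδ hδ1 le_rfl hδ1.le (by nlinarith) (hS k hk).1 (hS k hk).2
      _ ≤ _ := hsm.sum_le_tsum S fun k _ =>
          mul_nonneg (capMultiplier_nonneg ..) (sq_nonneg _))
  refine hopt.trans ?_
  have p1 : 0 ≤ 256 * D ^ 2 / c₀ ^ 3 * (lam * δ * δ / α ^ 4) := by positivity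
  have p2 : 0 ≤ 64 * D / c₀ ^ 2 * ((lam * δ) ^ 2 / α ^ 6) := by positivity
  nlinarith

lemma lintegral_Ioc_rpow {r b : ℝ} (hr : -1 < r) (hb : 0 ≤ b) :
    ∫⁻ t in Set.Ioc 0 b, ENNReal.ofReal (t ^ r) = ENNReal.ofReal (b ^ (r + 1) / (r + 1)) := by
  have hi : IntegrableOn (fun t : ℝ => t ^ r) (Set.Ioc 0 b) :=
    (intervalIntegral.intervalIntegrable_rpow' hr).1
  rw [← ofReal_integral_eq_lintegral_ofReal hi]
  · rw [← intervalIntegral.integral_of_le hb, integral_rpow (Or.inl hr),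
      Real.zero_rpow (by linarith), sub_zero]
  · exact (ae_restrict_iff' measurableSet_Ioc).2
      (Filter.Eventually.of_forall fun t ht => Real.rpow_nonneg ht.1.le _)

lemma lintegral_Ioi_rpow {r b : ℝ} (hr : r < -1) (hb : 0 < b) :
    ∫⁻ t in Set.Ioi b, ENNReal.ofReal (t ^ r) = ENNReal.ofReal (b ^ (r + 1) / (-(r + 1))) := by
  rw [← ofReal_integral_eq_lintegral_ofReal (integrableOn_Ioi_rpow_of_lt hr hb)]
  · rw [integral_Ioi_rpow_of_lt hr hb, div_neg, neg_div]
  · exact (ae_restrict_iff' measurableSet_Ioi).2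
      (Filter.Eventually.of_forall fun t ht => Real.rpow_nonneg (hb.le.trans (le_of_lt ht)) _)

lemma integral_rpow_le_of_level_sets {Ω : Type*} [MeasurableSpace Ω] {μ : Measure Ω}
    [IsProbabilityMeasure μ] {g : Ω → ℝ} (hg : Measurable g) (h0 : ∀ x, 0 ≤ g x)
    {C C' M δ p : ℝ} (hC : 0 ≤ C) (hC' : 0 ≤ C') (hM : 0 < M) (hδ : 0 ≤ δ) (hp4 : 4 < p)
    (hp6 : p < 6) (hsup : ∀ x, g x ≤ C' * M)
    (hlev : ∀ α, 0 < α → α ^ 2 * μ.real {x | α < g x} ≤ 1 ∧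
      μ.real {x | α < g x} ≤ C * (M * δ / α ^ 4 + M ^ 2 / α ^ 6)) :
    ∫ x, g x ^ p ∂μ ≤ p * (M ^ (p / 2 - 1) / (p - 2) +
      C * δ * C' ^ (p - 4) / (p - 4) * M ^ (p - 3) + C / (6 - p) * M ^ (p / 2 - 1)) := by
  have hs : 0 < √M := Real.sqrt_pos.2 hM
  have hb : 0 ≤ C' * M := by positivity
  have d2 : 0 < p - 2 := by linarith
  have d4 : 0 < p - 4 := by linarith
  have d6 : 0 < 6 - p := by linarith
  have hbound : ∀ t ∈ Set.Ioi (0 : ℝ), μ {x | t < g x} * ENNReal.ofReal (t ^ (p - 1)) ≤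
      (Set.Ioc 0 (√M)).indicator (fun t => ENNReal.ofReal (t ^ (p - 3))) t +
      (Set.Ioc 0 (C' * M)).indicator (fun t => ENNReal.ofReal (C * (M * δ)) *
        ENNReal.ofReal (t ^ (p - 5))) t +
      (Set.Ioi (√M)).indicator (fun t => ENNReal.ofReal (C * M ^ 2) *
        ENNReal.ofReal (t ^ (p - 7))) t := by
    intro t ht
    have ht : 0 < t := ht
    obtain ⟨l1, l2⟩ := hlev t ht
    have hpow : ∀ n : ℕ, t ^ (p - 1) / t ^ n = t ^ (p - 1 - n) := fun n => by
      rw [Real.rpow_sub_natCast ht.ne']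
    have hμ : μ {x | t < g x} * ENNReal.ofReal (t ^ (p - 1)) =
        ENNReal.ofReal (μ.real {x | t < g x} * t ^ (p - 1)) := by
      rw [ENNReal.ofReal_mul measureReal_nonneg, ofReal_measureReal]
    have htp : 0 < t ^ (p - 1) := Real.rpow_pos_of_pos ht _
    rcases le_or_gt t (√M) with h | h
    · rw [Set.indicator_of_mem (show t ∈ Set.Ioc 0 (√M) from ⟨ht, h⟩), add_assoc]
      refine le_add_right ?_
      rw [hμ]
      refine ENNReal.ofReal_le_ofReal ?_
      have : t ^ (p - 3) = t ^ (p - 1) / t ^ 2 := by rw [hpow]; norm_num; ring_nf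
      rw [this, le_div_iff₀ (by positivity)]
      nlinarith
    · rcases le_or_gt t (C' * M) with h' | h'
      · rw [Set.indicator_of_mem (show t ∈ Set.Ioi (√M) from h),
          Set.indicator_of_mem (show t ∈ Set.Ioc 0 (C' * M) from ⟨ht, h'⟩), add_assoc]
        refine le_add_left ?_
        have e5 : t ^ (p - 5) = t ^ (p - 1) / t ^ 4 := by rw [hpow]; norm_num; ring_nf
        have e7 : t ^ (p - 7) = t ^ (p - 1) / t ^ 6 := by rw [hpow]; norm_num; ring_nf
        rw [hμ, ← ENNReal.ofReal_mul (by positivity), ← ENNReal.ofReal_mul (by positivity),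
          ← ENNReal.ofReal_add (by positivity) (by positivity)]
        refine ENNReal.ofReal_le_ofReal ?_
        calc _ ≤ (C * (M * δ / t ^ 4 + M ^ 2 / t ^ 6)) * t ^ (p - 1) := by gcongr
          _ = _ := by rw [e5, e7]; ring
      · have : {x | t < g x} = ∅ := by
          ext x
          simp only [Set.mem_ofPred_eq, Set.mem_empty_iff_false, iff_false, not_lt]
          exact (hsup x).trans h'.le
        rw [this]
        simp
  have hlint : ∫⁻ x, ENNReal.ofReal (g x ^ p) ∂μ ≤ ENNReal.ofReal p *
      (ENNReal.ofReal (√M ^ (p - 3 + 1) / (p - 3 + 1)) +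
        ENNReal.ofReal (C * (M * δ)) * ENNReal.ofReal ((C' * M) ^ (p - 5 + 1) / (p - 5 + 1)) +
        ENNReal.ofReal (C * M ^ 2) * ENNReal.ofReal (√M ^ (p - 7 + 1) / (-(p - 7 + 1)))) := by
    rw [lintegral_rpow_eq_lintegral_meas_lt_mul μ (Filter.Eventually.of_forall h0)
      hg.aemeasurable (by linarith)]
    gcongr
    refine (setLIntegral_mono' measurableSet_Ioi hbound).trans
      ((setLIntegral_le_lintegral _ _).trans_eq ?_)
    have m3 : ∀ r : ℝ, Measurable fun t : ℝ => ENNReal.ofReal (t ^ r) := fun r => by fun_prop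
    rw [lintegral_add_left, lintegral_add_left, lintegral_indicator measurableSet_Ioc,
      lintegral_indicator measurableSet_Ioc, lintegral_indicator measurableSet_Ioi,
      lintegral_const_mul _ (m3 _), lintegral_const_mul _ (m3 _),
      lintegral_Ioc_rpow (by linarith) hs.le, lintegral_Ioc_rpow (by linarith) hb,
      lintegral_Ioi_rpow (by linarith) hs]
    · exact (m3 _).indicator measurableSet_Ioc
    · exact ((m3 _).indicator measurableSet_Ioc).add
        (((m3 _).const_mul _).indicator measurableSet_Ioc)
  have n1 : 0 ≤ √M ^ (p - 3 + 1) / (p - 3 + 1) :=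
    div_nonneg (Real.rpow_nonneg hs.le _) (by linarith)
  have n2 : 0 ≤ (C' * M) ^ (p - 5 + 1) / (p - 5 + 1) :=
    div_nonneg (Real.rpow_nonneg hb _) (by linarith)
  have n3 : 0 ≤ √M ^ (p - 7 + 1) / (-(p - 7 + 1)) :=
    div_nonneg (Real.rpow_nonneg hs.le _) (by linarith)
  rw [← ENNReal.ofReal_mul (by positivity), ← ENNReal.ofReal_mul (by positivity),
    ← ENNReal.ofReal_add n1 (by positivity), ← ENNReal.ofReal_add (by positivity) (by positivity),
    ← ENNReal.ofReal_mul (by linarith)] at hlint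
  have hnn : 0 ≤ p * (√M ^ (p - 3 + 1) / (p - 3 + 1) +
      C * (M * δ) * ((C' * M) ^ (p - 5 + 1) / (p - 5 + 1)) +
      C * M ^ 2 * (√M ^ (p - 7 + 1) / (-(p - 7 + 1)))) := by
    have : 0 < p := by linarith
    positivity
  have hreal : ∫ x, g x ^ p ∂μ ≤ p * (√M ^ (p - 3 + 1) / (p - 3 + 1) +
      C * (M * δ) * ((C' * M) ^ (p - 5 + 1) / (p - 5 + 1)) +
      C * M ^ 2 * (√M ^ (p - 7 + 1) / (-(p - 7 + 1)))) := by
    rw [integral_eq_lintegral_of_nonneg_ae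
      (Filter.Eventually.of_forall fun x => Real.rpow_nonneg (h0 x) _)
      (hg.pow_const p).aestronglyMeasurable]
    exact ENNReal.toReal_le_of_le_ofReal hnn hlint
  refine hreal.trans_eq ?_
  have q1 : √M ^ (p - 3 + 1) = M ^ (p / 2 - 1) := by
    rw [Real.sqrt_eq_rpow, ← Real.rpow_mul hM.le]; ring_nf
  have q2 : (C' * M) ^ (p - 5 + 1) = C' ^ (p - 4) * M ^ (p - 4) := by
    rw [Real.mul_rpow hC' hM.le]; ring_nf
  have q3 : M ^ 2 * √M ^ (p - 7 + 1) = M ^ (p / 2 - 1) := by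
    rw [Real.sqrt_eq_rpow, ← Real.rpow_mul hM.le, ← Real.rpow_natCast, ← Real.rpow_add hM]
    norm_num
    ring_nf
  have q4 : M * M ^ (p - 4) = M ^ (p - 3) := by
    rw [← Real.rpow_one_add' hM.le (by linarith)]; ring_nf
  rw [q1, q2, show p - 3 + 1 = p - 2 by ring, show p - 5 + 1 = p - 4 by ring,
    show -(p - 7 + 1) = 6 - p by ring, show p - 7 + 1 = p - 6 by ring]
  rw [show p - 7 + 1 = p - 6 by ring] at q3
  rw [← q4]
  have q5 : C * M ^ 2 * (√M ^ (p - 6) / (6 - p)) = C / (6 - p) * (M ^ 2 * √M ^ (p - 6)) := by ring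
  rw [q5, q3]
  ring

lemma norm_trigPoly_le (S : Finset (Fin 3 → ℤ)) (a : (Fin 3 → ℤ) → ℂ)
    (ha : ∑ k ∈ S, ‖a k‖ ^ 2 ≤ 1) (x : T3) : ‖trigPoly S a x‖ ≤ √S.card := by
  have h1 : ‖trigPoly S a x‖ ≤ ∑ k ∈ S, 1 * ‖a k‖ := by
    refine (norm_sum_le _ _).trans_eq (Finset.sum_congr rfl fun k _ => ?_)
    rw [norm_mul, norm_mFourier_apply, mul_one, one_mul]
  refine h1.trans (Real.le_sqrt_of_sq_le ?_)
  refine (Finset.sum_mul_sq_le_sq_mul_sq S (fun _ => (1 : ℝ)) fun k => ‖a k‖).trans ?_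
  simp only [one_pow, Finset.sum_const, nsmul_eq_mul, mul_one]
  nlinarith [S.card.cast_nonneg (α := ℝ)]

lemma delta_mul_rpow_le {lam δ p : ℝ} (hlam : 0 < lam) (hδ : 0 < δ) (hδ1 : δ < 1) (hp : 4 ≤ p) :
    δ * (lam * δ) ^ (p - 3) ≤ lam ^ (p - 3) * δ ^ (p / 2) := by
  have h1 : δ * (lam * δ) ^ (p - 3) = lam ^ (p - 3) * δ ^ (p - 2) := by
    rw [Real.mul_rpow hlam.le hδ.le, mul_left_comm, ← Real.rpow_one_add' hδ.le (by linarith)]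
    ring_nf
  rw [h1]
  gcongr ?_ * ?_
  exact Real.rpow_le_rpow_of_exponent_ge hδ hδ1.le (by linarith)

lemma rpow_le_shell {lam δ p : ℝ} (hlam : 0 < lam) (hδ : 0 < δ) (hδ1 : δ < 1)
    (hM : 1 < lam * δ) (hp : 6 ≤ p) :
    (lam * δ) ^ (p - 7 / 2) ≤ lam ^ (p - 3) * δ ^ (p / 2) := by
  have h1 : (lam * δ) ^ (p - 7 / 2) ≤ (lam * δ) ^ (p - 3) :=
    Real.rpow_le_rpow_of_exponent_le hM.le (by linarith)
  refine h1.trans ?_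
  rw [Real.mul_rpow hlam.le hδ.le]
  gcongr ?_ * ?_
  exact Real.rpow_le_rpow_of_exponent_ge hδ hδ1.le (by linarith)

theorem exists_integral_rpow_le {B T : (Fin 3 → ℝ) ≃L[ℝ] E3} {c : ℝ} (hc : 0 < c)
    (hBT : ∀ x u, ⟪B x, T u⟫_ℝ = 2 * Real.pi * ∑ i, x i * u i)
    (hT : ∀ g : E3 → ℂ, ∫ y, g y = c * ∫ u, g (T u)) (K : ℝ) {p : ℝ} (hp : 4 < p) :
    ∃ C : ℝ, 0 < C ∧ ∀ ν : E3, ‖ν‖ = 1 → ∀ lam δ : ℝ, 1 < lam → 0 < δ → δ < 1 → 1 < lam * δ →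
      ∀ S : Finset (Fin 3 → ℤ), (∀ k ∈ S, IsCapPoint B K ν lam δ k) →
        ∀ a : (Fin 3 → ℤ) → ℂ, ∑ k ∈ S, ‖a k‖ ^ 2 ≤ 1 →
          ∫ x, ‖trigPoly S a x‖ ^ p ≤
            C * (lam ^ (p - 3) * δ ^ (p / 2) + (lam * δ) ^ (p / 2 - 1)) := by
  obtain ⟨C₁, hC₁, hlevel⟩ := exists_level_set_le hc hBT hT K
  obtain ⟨C₂, hC₂, hcard⟩ := exists_card_capPoints_le B K
  have hsmall : ∀ q : ℝ, 4 < q → q < 6 → ∃ C : ℝ, 0 < C ∧ ∀ ν : E3, ‖ν‖ = 1 → ∀ lam δ : ℝ,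
      1 < lam → 0 < δ → δ < 1 → 1 < lam * δ →
      ∀ S : Finset (Fin 3 → ℤ), (∀ k ∈ S, IsCapPoint B K ν lam δ k) →
        ∀ a : (Fin 3 → ℤ) → ℂ, ∑ k ∈ S, ‖a k‖ ^ 2 ≤ 1 →
          ∫ x, ‖trigPoly S a x‖ ^ q ≤
            C * (δ * (lam * δ) ^ (q - 3) + (lam * δ) ^ (q / 2 - 1)) := by
    intro q hq4 hq6
    have d2 : 0 < q - 2 := by linarith
    have d4 : 0 < q - 4 := by linarith
    have d6 : 0 < 6 - q := by linarith
    have dq : 0 < q := by linarith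
    refine ⟨q * (1 / (q - 2) + C₁ * √C₂ ^ (q - 4) / (q - 4) + C₁ / (6 - q)), by positivity, ?_⟩
    intro ν hν lam δ hlam hδ hδ1 hM S hS a ha
    have hM0 : 0 < lam * δ := by linarith
    have h1 := integral_rpow_le_of_level_sets (μ := (volume : Measure T3))
      (continuous_trigPoly S a).norm.measurable (fun x => norm_nonneg _) hC₁.le
      (Real.sqrt_nonneg C₂) hM0 hδ.le hq4 hq6 (fun x => by
        refine (norm_trigPoly_le S a ha x).trans ?_
        refine Real.sqrt_le_iff.2 ⟨by positivity, ?_⟩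
        rw [mul_pow, Real.sq_sqrt hC₂.le]
        exact hcard ν hν lam δ hlam hδ hδ1 hM S hS)
      (fun α hα => hlevel ν hν lam δ hlam hδ hδ1 hM S hS a ha α hα)
    refine h1.trans ?_
    rw [mul_assoc q]
    refine mul_le_mul_of_nonneg_left ?_ dq.le
    set X := δ * (lam * δ) ^ (q - 3) with hX
    set Y := (lam * δ) ^ (q / 2 - 1)
    have hX0 : 0 ≤ X := by positivity
    have hY0 : 0 ≤ Y := by positivity
    have t1 : 0 ≤ 1 / (q - 2) := by positivity
    have t2 : 0 ≤ C₁ * √C₂ ^ (q - 4) / (q - 4) := by positivity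
    have t3 : 0 ≤ C₁ / (6 - q) := by positivity
    have e : Y / (q - 2) + C₁ * δ * √C₂ ^ (q - 4) / (q - 4) * (lam * δ) ^ (q - 3) +
        C₁ / (6 - q) * Y = 1 / (q - 2) * Y + C₁ * √C₂ ^ (q - 4) / (q - 4) * X +
        C₁ / (6 - q) * Y := by
      rw [hX]; ring
    rw [e]
    nlinarith [mul_nonneg t1 hX0, mul_nonneg t2 hY0, mul_nonneg t3 hX0]
  rcases lt_or_ge p 6 with hp6 | hp6
  · obtain ⟨C, hC, h⟩ := hsmall p hp hp6
    refine ⟨C, hC, fun ν hν lam δ hlam hδ hδ1 hM S hS a ha => ?_⟩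
    refine (h ν hν lam δ hlam hδ hδ1 hM S hS a ha).trans ?_
    exact mul_le_mul_of_nonneg_left
      (add_le_add (delta_mul_rpow_le (by linarith) hδ hδ1 hp.le) le_rfl) hC.le
  · obtain ⟨C, hC, h⟩ := hsmall 5 (by norm_num) (by norm_num)
    refine ⟨√C₂ ^ (p - 5) * (C * 2), by positivity, ?_⟩
    intro ν hν lam δ hlam hδ hδ1 hM S hS a ha
    have hM0 : 0 < lam * δ := by linarith
    have hlam0 : 0 < lam := by linarith
    have hint : ∀ r : ℝ, 0 < r → Integrable (fun x => ‖trigPoly S a x‖ ^ r)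
        (volume : Measure T3) := fun r hr =>
      ((continuous_trigPoly S a).norm.rpow_const fun _ => Or.inr hr.le).integrable_of_hasCompactSupport
        (HasCompactSupport.of_compactSpace _)
    have h5 := h ν hν lam δ hlam hδ hδ1 hM S hS a ha
    calc ∫ x, ‖trigPoly S a x‖ ^ p ≤
        ∫ x, (√C₂ * (lam * δ)) ^ (p - 5) * ‖trigPoly S a x‖ ^ (5 : ℝ) := by
          refine integral_mono (hint p (by linarith)) ((hint 5 (by norm_num)).const_mul _)
            fun x => ?_
          have hx : ‖trigPoly S a x‖ ≤ √C₂ * (lam * δ) := by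
            refine (norm_trigPoly_le S a ha x).trans ?_
            refine Real.sqrt_le_iff.2 ⟨by positivity, ?_⟩
            rw [mul_pow, Real.sq_sqrt hC₂.le]
            exact hcard ν hν lam δ hlam hδ hδ1 hM S hS
          have e : ‖trigPoly S a x‖ ^ p =
              ‖trigPoly S a x‖ ^ (p - 5) * ‖trigPoly S a x‖ ^ (5 : ℝ) := by
            rw [← Real.rpow_add_of_nonneg (norm_nonneg _) (by linarith) (by norm_num)]
            ring_nf
          simp only
          rw [e]
          gcongr
          linarith
      _ ≤ √C₂ ^ (p - 5) * (lam * δ) ^ (p - 5) * (C * (δ * (lam * δ) ^ ((5 : ℝ) - 3) +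
            (lam * δ) ^ ((5 : ℝ) / 2 - 1))) := by
          rw [integral_const_mul, Real.mul_rpow (by positivity) hM0.le]
          gcongr
      _ = √C₂ ^ (p - 5) * (C * (δ * (lam * δ) ^ (p - 3) + (lam * δ) ^ (p - 7 / 2))) := by
          have e1 : (lam * δ) ^ (p - 3) = (lam * δ) ^ (p - 5) * (lam * δ) ^ ((5 : ℝ) - 3) := by
            rw [← Real.rpow_add hM0]; ring_nf
          have e2 : (lam * δ) ^ (p - 7 / 2) =
              (lam * δ) ^ (p - 5) * (lam * δ) ^ ((5 : ℝ) / 2 - 1) := by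
            rw [← Real.rpow_add hM0]; ring_nf
          rw [e1, e2]
          ring
      _ ≤ √C₂ ^ (p - 5) * (C * (lam ^ (p - 3) * δ ^ (p / 2) + lam ^ (p - 3) * δ ^ (p / 2))) := by
          exact mul_le_mul_of_nonneg_left (mul_le_mul_of_nonneg_left
            (add_le_add (delta_mul_rpow_le hlam0 hδ hδ1 hp.le)
              (rpow_le_shell hlam0 hδ hδ1 hM hp6)) hC.le) (by positivity)
      _ ≤ _ := by
          have : 0 ≤ (lam * δ) ^ (p / 2 - 1) := by positivity
          have h0 : 0 ≤ √C₂ ^ (p - 5) * (C * 2) := by positivity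
          nlinarith [mul_nonneg h0 this]

lemma card_int_le {I : Finset ℤ} {R : ℝ} (hR : 0 ≤ R)
    (h : ∀ m ∈ I, ∀ n ∈ I, (m : ℝ) - n ≤ R) : (I.card : ℝ) ≤ R + 1 := by
  rcases I.eq_empty_or_nonempty with rfl | hI
  · simp only [Finset.card_empty, Nat.cast_zero]; linarith
  have hsub : I ⊆ Finset.Icc (I.min' hI) (I.min' hI + ⌊R⌋) := fun m hm => by
    rw [Finset.mem_Icc]
    refine ⟨I.min'_le m hm, ?_⟩
    have : m - I.min' hI ≤ ⌊R⌋ := by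
      rw [Int.le_floor]
      push_cast
      exact h m hm _ (I.min'_mem hI)
    linarith
  have h1 := Finset.card_le_card hsub
  rw [Int.card_Icc] at h1
  have h2 : (I.card : ℤ) ≤ ⌊R⌋ + 1 := by
    have := Int.floor_nonneg.2 hR
    omega
  have h3 : (I.card : ℝ) ≤ (⌊R⌋ : ℝ) + 1 := by exact_mod_cast h2
  linarith [Int.floor_le R]

lemma card_le_mul_of_unit_fibers {α : Type*} {S : Finset α} {y : α → ℝ} {L N : ℝ} (hL : 0 ≤ L)
    (hN : 0 ≤ N) (hy : ∀ k ∈ S, ∀ l ∈ S, |y k - y l| ≤ L)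
    (h : ∀ S' ⊆ S, (∀ k ∈ S', ∀ l ∈ S', |y k - y l| ≤ 1) → (S'.card : ℝ) ≤ N) :
    (S.card : ℝ) ≤ (L + 2) * N := by
  classical
  have h1 : (S.card : ℝ) = ∑ m ∈ S.image fun k => ⌊y k⌋, ((S.filter fun k => ⌊y k⌋ = m).card : ℝ) := by
    rw [← Nat.cast_sum]
    congr 1
    exact Finset.card_eq_sum_card_image _ _
  have h2 : ((S.image fun k => ⌊y k⌋).card : ℝ) ≤ (L + 1) + 1 := by
    refine card_int_le (by linarith) fun m hm n hn => ?_
    obtain ⟨k, hk, rfl⟩ := Finset.mem_image.1 hm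
    obtain ⟨l, hl, rfl⟩ := Finset.mem_image.1 hn
    linarith [Int.floor_le (y k), Int.lt_floor_add_one (y l), (abs_le.1 (hy k hk l hl)).2]
  calc (S.card : ℝ) ≤ ∑ m ∈ S.image fun k => ⌊y k⌋, N := by
        rw [h1]
        refine Finset.sum_le_sum fun m _ => h _ (Finset.filter_subset _ _) fun k hk l hl => ?_
        have hk' := (Finset.mem_filter.1 hk).2
        have hl' := (Finset.mem_filter.1 hl).2
        exact (Int.abs_sub_lt_one_of_floor_eq_floor (hk'.trans hl'.symm)).le
    _ = ((S.image fun k => ⌊y k⌋).card : ℝ) * N := by rw [Finset.sum_const, nsmul_eq_mul]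
    _ ≤ _ := by
        refine mul_le_mul_of_nonneg_right ?_ hN
        linarith

lemma card_sector_le {α : Type*} {S : Finset α} {x y : α → ℝ} {N D M r : ℝ} (hM : 1 ≤ D * M)
    (hN : 0 ≤ N) (hr : 2 ≤ r) (hrD : D * M ≤ r ^ 2)
    (hbox : ∀ S' ⊆ S, (∀ k ∈ S', ∀ l ∈ S', |x k - x l| ≤ 1) →
      (∀ k ∈ S', ∀ l ∈ S', |y k - y l| ≤ 1) → (S'.card : ℝ) ≤ N)
    (hr' : ∀ k ∈ S, |x k ^ 2 + y k ^ 2 - r ^ 2| ≤ D * M)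
    (hy : ∀ k ∈ S, ∀ l ∈ S, |y k - y l| ≤ D * M) (hx : ∀ k ∈ S, r / 2 ≤ x k) :
    (S.card : ℝ) ≤ 28 * (D * M) * N := by
  have hr0 : 0 < r := by linarith
  have hDM : 0 ≤ D * M := by linarith
  have hy2 : ∀ k ∈ S, |y k| ≤ 2 * r := fun k hk => by
    refine abs_le_of_sq_le_sq ?_ (by linarith)
    nlinarith [(abs_le.1 (hr' k hk)).2, sq_nonneg (x k)]
  have key : (S.card : ℝ) ≤ (min (4 * r) (D * M) + 2) * ((2 * (D * M) / r + 4 + 2) * N) := by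
    refine card_le_mul_of_unit_fibers (y := y) (le_min (by linarith) hDM) (by positivity)
      (fun k hk l hl => le_min ?_ (hy k hk l hl)) fun S' hS' h1 => ?_
    · linarith [abs_sub (y k) (y l), hy2 k hk, hy2 l hl]
    · refine card_le_mul_of_unit_fibers (y := x) (by positivity) hN (fun k hk l hl => ?_)
        fun S'' hS'' h2 => hbox S'' (hS''.trans hS') h2 fun k hk l hl =>
          h1 k (hS'' hk) l (hS'' hl)
      have hk' := hS' hk
      have hl' := hS' hl
      have e1 : |x k - x l| * (x k + x l) ≤ 2 * (D * M) + 4 * r := by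
        have : |x k - x l| * (x k + x l) = |x k ^ 2 - x l ^ 2| := by
          rw [show x k ^ 2 - x l ^ 2 = (x k - x l) * (x k + x l) by ring, abs_mul,
            abs_of_nonneg (show 0 ≤ x k + x l by linarith [hx k hk', hx l hl'])]
        rw [this]
        have e2 : |y k ^ 2 - y l ^ 2| ≤ 4 * r := by
          have : y k ^ 2 - y l ^ 2 = (y k - y l) * (y k + y l) := by ring
          rw [this, abs_mul]
          have h3 : |y k + y l| ≤ 4 * r := by
            linarith [abs_add_le (y k) (y l), hy2 k hk', hy2 l hl']
          nlinarith [h1 k hk l hl, abs_nonneg (y k - y l), abs_nonneg (y k + y l)]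
        have a1 := abs_le.1 (hr' k hk')
        have a2 := abs_le.1 (hr' l hl')
        have a3 := abs_le.1 e2
        exact abs_le.2 ⟨by linarith, by linarith⟩
      have e3 : |x k - x l| * r ≤ 2 * (D * M) + 4 * r :=
        (mul_le_mul_of_nonneg_left (by linarith [hx k hk', hx l hl']) (abs_nonneg _)).trans e1
      rw [div_add' _ _ _ hr0.ne', le_div_iff₀ hr0]
      exact e3
  refine key.trans ?_
  rw [← mul_assoc]
  refine mul_le_mul_of_nonneg_right ?_ hN
  set L := min (4 * r) (D * M)
  have l1 : L ≤ 4 * r := min_le_left _ _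
  have l2 : L ≤ D * M := min_le_right _ _
  have hq : 0 ≤ 2 * (D * M) / r := by positivity
  have q1 : 2 * (D * M) / r * r = 2 * (D * M) := by field_simp
  nlinarith [mul_le_mul_of_nonneg_left l1 hq, mul_le_mul_of_nonneg_left hr hq]

lemma card_annulus_le {α : Type*} {S : Finset α} {x y : α → ℝ} {N D M ρ : ℝ} (hM : 1 ≤ D * M)
    (hN : 0 ≤ N)
    (hbox : ∀ S' ⊆ S, (∀ k ∈ S', ∀ l ∈ S', |x k - x l| ≤ 1) →
      (∀ k ∈ S', ∀ l ∈ S', |y k - y l| ≤ 1) → (S'.card : ℝ) ≤ N)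
    (hρ : ∀ k ∈ S, |x k ^ 2 + y k ^ 2 - ρ| ≤ D * M)
    (hx : ∀ k ∈ S, ∀ l ∈ S, |x k - x l| ≤ D * M)
    (hy : ∀ k ∈ S, ∀ l ∈ S, |y k - y l| ≤ D * M) :
    (S.card : ℝ) ≤ 112 * (D * M) * N := by
  classical
  have hDM : 0 ≤ D * M := by linarith
  rcases le_or_gt ρ (4 * (D * M)) with h | h
  · set s := √(5 * (D * M)) with hs
    have hs2 : s ^ 2 = 5 * (D * M) := Real.sq_sqrt (by positivity)
    have hs0 : 0 ≤ s := Real.sqrt_nonneg _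
    have hxs : ∀ k ∈ S, |x k| ≤ s := fun k hk => by
      refine abs_le_of_sq_le_sq ?_ hs0
      nlinarith [(abs_le.1 (hρ k hk)).2, sq_nonneg (y k)]
    have hys : ∀ k ∈ S, |y k| ≤ s := fun k hk => by
      refine abs_le_of_sq_le_sq ?_ hs0
      nlinarith [(abs_le.1 (hρ k hk)).2, sq_nonneg (x k)]
    have key : (S.card : ℝ) ≤ (2 * s + 2) * ((2 * s + 2) * N) := by
      refine card_le_mul_of_unit_fibers (y := y) (by positivity) (by positivity)
        (fun k hk l hl => by linarith [abs_sub (y k) (y l), hys k hk, hys l hl])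
        fun S' hS' h1 => ?_
      exact card_le_mul_of_unit_fibers (y := x) (by positivity) hN
        (fun k hk l hl => by linarith [abs_sub (x k) (x l), hxs k (hS' hk), hxs l (hS' hl)])
        fun S'' hS'' h2 => hbox S'' (hS''.trans hS') h2 fun k hk l hl =>
          h1 k (hS'' hk) l (hS'' hl)
    refine key.trans ?_
    rw [← mul_assoc]
    refine mul_le_mul_of_nonneg_right ?_ hN
    nlinarith [sq_nonneg (s - 1)]
  · set r := √ρ with hr
    have hr2 : r ^ 2 = ρ := Real.sq_sqrt (by linarith)
    have hr0 : 0 ≤ r := Real.sqrt_nonneg _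
    have h2r : 2 ≤ r := Real.le_sqrt_of_sq_le (by linarith)
    rw [← hr2] at hρ h
    have hcover : S ⊆ (S.filter (fun k => r / 2 ≤ x k) ∪ S.filter (fun k => r / 2 ≤ -x k)) ∪
        (S.filter (fun k => r / 2 ≤ y k) ∪ S.filter (fun k => r / 2 ≤ -y k)) := fun k hk => by
      simp only [Finset.mem_union, Finset.mem_filter, hk, true_and]
      by_contra! hcon
      obtain ⟨⟨c1, c2⟩, c3, c4⟩ := hcon
      have := (abs_le.1 (hρ k hk)).1
      nlinarith
    have hc := Finset.card_le_card hcover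
    have hu : (S.card : ℝ) ≤ ((S.filter fun k => r / 2 ≤ x k).card +
        (S.filter fun k => r / 2 ≤ -x k).card : ℝ) + ((S.filter fun k => r / 2 ≤ y k).card +
        (S.filter fun k => r / 2 ≤ -y k).card) := by
      have u1 := Finset.card_union_le (S.filter (fun k => r / 2 ≤ x k) ∪
        S.filter (fun k => r / 2 ≤ -x k)) (S.filter (fun k => r / 2 ≤ y k) ∪
        S.filter (fun k => r / 2 ≤ -y k))
      have u2 := Finset.card_union_le (S.filter (fun k => r / 2 ≤ x k))
        (S.filter (fun k => r / 2 ≤ -x k))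
      have u3 := Finset.card_union_le (S.filter (fun k => r / 2 ≤ y k))
        (S.filter (fun k => r / 2 ≤ -y k))
      exact_mod_cast hc.trans (u1.trans (add_le_add u2 u3))
    have hneg : ∀ s t : ℝ, |-s - -t| = |s - t| := fun s t => by
      rw [neg_sub_neg, abs_sub_comm]
    have b1 : ((S.filter fun k => r / 2 ≤ x k).card : ℝ) ≤ 28 * (D * M) * N :=
      card_sector_le (x := x) (y := y) hM hN h2r (by linarith)
        (fun S' hS' => hbox S' (hS'.trans (Finset.filter_subset _ _)))
        (fun k hk => hρ k (Finset.mem_filter.1 hk).1)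
        (fun k hk l hl => hy k (Finset.mem_filter.1 hk).1 l (Finset.mem_filter.1 hl).1)
        fun k hk => (Finset.mem_filter.1 hk).2
    have b2 : ((S.filter fun k => r / 2 ≤ -x k).card : ℝ) ≤ 28 * (D * M) * N :=
      card_sector_le (x := fun k => -x k) (y := y) hM hN h2r (by linarith)
        (fun S' hS' => by
          simp only [hneg]; exact hbox S' (hS'.trans (Finset.filter_subset _ _)))
        (fun k hk => by simpa only [neg_sq] using hρ k (Finset.mem_filter.1 hk).1)
        (fun k hk l hl => hy k (Finset.mem_filter.1 hk).1 l (Finset.mem_filter.1 hl).1)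
        fun k hk => (Finset.mem_filter.1 hk).2
    have b3 : ((S.filter fun k => r / 2 ≤ y k).card : ℝ) ≤ 28 * (D * M) * N :=
      card_sector_le (x := y) (y := x) hM hN h2r (by linarith)
        (fun S' hS' h1 h2 => hbox S' (hS'.trans (Finset.filter_subset _ _)) h2 h1)
        (fun k hk => by rw [add_comm]; exact hρ k (Finset.mem_filter.1 hk).1)
        (fun k hk l hl => hx k (Finset.mem_filter.1 hk).1 l (Finset.mem_filter.1 hl).1)
        fun k hk => (Finset.mem_filter.1 hk).2
    have b4 : ((S.filter fun k => r / 2 ≤ -y k).card : ℝ) ≤ 28 * (D * M) * N :=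
      card_sector_le (x := fun k => -y k) (y := x) hM hN h2r (by linarith)
        (fun S' hS' h1 h2 => by
          simp only [hneg] at h1
          exact hbox S' (hS'.trans (Finset.filter_subset _ _)) h2 h1)
        (fun k hk => by
          simp only [neg_sq]; rw [add_comm]; exact hρ k (Finset.mem_filter.1 hk).1)
        (fun k hk l hl => hx k (Finset.mem_filter.1 hk).1 l (Finset.mem_filter.1 hl).1)
        fun k hk => (Finset.mem_filter.1 hk).2
    linarith

lemma integral_mFourier (n : Fin 3 → ℤ) :
    ∫ x : T3, mFourier n x = if n = 0 then 1 else 0 := by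
  have h := orthonormal_iff_ite.1 (orthonormal_mFourier (d := Fin 3)) 0 n
  simp_rw [ContinuousMap.inner_toLp] at h
  simp only [mFourier_zero, ContinuousMap.one_apply, map_one, mul_one] at h
  rw [h]
  simp only [eq_comm]

lemma integral_norm_sq_trigPoly (U : Finset (Fin 3 → ℤ)) (c : (Fin 3 → ℤ) → ℂ) :
    ∫ x, ‖trigPoly U c x‖ ^ 2 = ∑ u ∈ U, ‖c u‖ ^ 2 := by
  have h1 : ∀ x, ((‖trigPoly U c x‖ ^ 2 : ℝ) : ℂ) =
      ∑ u ∈ U, ∑ v ∈ U, c u * conj (c v) * mFourier (u - v) x := fun x => by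
    rw [ofReal_pow, ← Complex.mul_conj', trigPoly, map_sum, Finset.sum_mul_sum]
    refine Finset.sum_congr rfl fun u _ => Finset.sum_congr rfl fun v _ => ?_
    rw [sub_eq_add_neg, mFourier_add, mFourier_neg, map_mul]
    ring
  have hi : ∀ (z : ℂ) (n : Fin 3 → ℤ), Integrable (fun x : T3 => z * mFourier n x) := fun z n =>
    ((mFourier n).continuous.integrable_of_hasCompactSupport
      (HasCompactSupport.of_compactSpace _)).const_mul z
  apply ofReal_injective
  rw [← integral_complex_ofReal]
  simp_rw [h1]
  rw [integral_finsetSum _ fun u _ => integrable_finsetSum _ fun v _ => hi _ _, ofReal_sum]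
  refine Finset.sum_congr rfl fun u hu => ?_
  rw [integral_finsetSum _ fun v _ => hi _ _]
  simp_rw [integral_const_mul, integral_mFourier, sub_eq_zero]
  simp [hu, Complex.mul_conj']

lemma integral_norm_pow_four_trigPoly_le {S : Finset (Fin 3 → ℤ)} {a : (Fin 3 → ℤ) → ℂ} {N : ℝ}
    (hN : ∀ u, ((S.filter fun k => u - k ∈ S).card : ℝ) ≤ N) :
    ∫ x, ‖trigPoly S a x‖ ^ 4 ≤ N * (∑ k ∈ S, ‖a k‖ ^ 2) ^ 2 := by
  classical
  set U := (S ×ˢ S).image fun q => q.1 + q.2 with hU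
  set c : (Fin 3 → ℤ) → ℂ := fun u => ∑ k ∈ S.filter (fun k => u - k ∈ S), a k * a (u - k) with hc
  have hN0 : 0 ≤ N := (Nat.cast_nonneg _).trans (hN 0)
  have reindex : ∀ {V : Type} [AddCommMonoid V] (g : (Fin 3 → ℤ) → (Fin 3 → ℤ) → V),
      ∑ u ∈ U, ∑ k ∈ S.filter (fun k => u - k ∈ S), g k (u - k) = ∑ k ∈ S, ∑ l ∈ S, g k l := by
    intro V _ g
    rw [← Finset.sum_product', Finset.sum_sigma']
    refine Finset.sum_bij' (fun q _ => (q.2, q.1 - q.2)) (fun q _ => ⟨q.1 + q.2, q.1⟩) ?_ ?_ ?_ ?_ ?_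
    · rintro ⟨u, k⟩ hq
      simp only [Finset.mem_sigma, Finset.mem_filter] at hq
      simp [hq.2.1, hq.2.2]
    · rintro ⟨k, l⟩ hq
      rw [Finset.mem_product] at hq
      simp only [Finset.mem_sigma, Finset.mem_filter, add_sub_cancel_left]
      exact ⟨Finset.mem_image.2 ⟨(k, l), Finset.mem_product.2 hq, rfl⟩, hq⟩
    · rintro ⟨u, k⟩ _
      simp
    · rintro ⟨k, l⟩ _
      simp
    · rintro ⟨u, k⟩ _
      rfl
  have hsq : ∀ x, trigPoly S a x ^ 2 = trigPoly U c x := fun x => by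
    have e : trigPoly U c x = ∑ u ∈ U, ∑ k ∈ S.filter (fun k => u - k ∈ S),
        (fun k l => a k * mFourier k x * (a l * mFourier l x)) k (u - k) := by
      refine Finset.sum_congr rfl fun u _ => ?_
      rw [hc, Finset.sum_mul]
      refine Finset.sum_congr rfl fun k _ => ?_
      simp only
      have : mFourier u x = mFourier k x * mFourier (u - k) x := by
        rw [← mFourier_add, add_sub_cancel]
      rw [this]; ring
    rw [e, reindex fun k l => a k * mFourier k x * (a l * mFourier l x), sq, trigPoly,
      Finset.sum_mul_sum]
  have h1 : ∫ x, ‖trigPoly S a x‖ ^ 4 = ∑ u ∈ U, ‖c u‖ ^ 2 := by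
    rw [← integral_norm_sq_trigPoly]
    congr 1; ext x
    rw [← hsq, norm_pow]; ring
  have h2 : ∀ u, ‖c u‖ ^ 2 ≤ N * ∑ k ∈ S.filter (fun k => u - k ∈ S),
      ‖a k‖ ^ 2 * ‖a (u - k)‖ ^ 2 := fun u => by
    calc ‖c u‖ ^ 2 ≤ (∑ k ∈ S.filter (fun k => u - k ∈ S), 1 * (‖a k‖ * ‖a (u - k)‖)) ^ 2 := by
          gcongr
          refine (norm_sum_le _ _).trans_eq (Finset.sum_congr rfl fun k _ => ?_)
          rw [norm_mul, one_mul]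
      _ ≤ (∑ k ∈ S.filter (fun k => u - k ∈ S), (1 : ℝ) ^ 2) *
          ∑ k ∈ S.filter (fun k => u - k ∈ S), (‖a k‖ * ‖a (u - k)‖) ^ 2 :=
          Finset.sum_mul_sq_le_sq_mul_sq _ _ _
      _ ≤ _ := by
          simp only [mul_pow, one_pow, Finset.sum_const, nsmul_eq_mul, mul_one]
          gcongr
          exact hN u
  rw [h1]
  refine (Finset.sum_le_sum fun u _ => h2 u).trans_eq ?_
  rw [← Finset.mul_sum, reindex fun k l => ‖a k‖ ^ 2 * ‖a l‖ ^ 2, sq, Finset.sum_mul_sum]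

lemma exists_orthonormalBasis_apply_zero {e : E3} (he : ‖e‖ = 1) :
    ∃ b : OrthonormalBasis (Fin 3) ℝ E3, b 0 = e := by
  have hv : Orthonormal ℝ (({0} : Set (Fin 3)).domRestrict fun _ => e) := by
    refine ⟨fun _ => he, fun i j hij => (hij (Subsingleton.elim i j)).elim⟩
  obtain ⟨b, hb⟩ := hv.exists_orthonormalBasis_extension_of_card_eq (by simp)
  exact ⟨b, hb 0 rfl⟩

lemma IsCapPoint.norm_sub_le {B : (Fin 3 → ℝ) ≃L[ℝ] E3} {K : ℝ} {ν : E3} {lam δ : ℝ}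
    (hν : ‖ν‖ = 1) (hlam : 1 < lam) (hδ : 0 < δ) (hδ1 : δ < 1) {k : Fin 3 → ℤ}
    (hk : IsCapPoint B K ν lam δ k) (hM : 1 < lam * δ) :
    ‖B (intVec k) - lam • ν‖ ≤ (2 * |K| + 1) * (lam * δ) := by
  obtain ⟨h1, h2⟩ := hk
  set z := B (intVec k)
  have h1' := abs_lt.1 h1
  have hz : 0 < ‖z‖ := by linarith
  have e : z - lam • ν = ‖z‖ • (‖z‖⁻¹ • z - ν) + (‖z‖ - lam) • ν := by
    rw [smul_sub, smul_smul, mul_inv_cancel₀ hz.ne', one_smul, sub_smul]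
    abel
  calc ‖z - lam • ν‖ ≤ ‖‖z‖ • (‖z‖⁻¹ • z - ν)‖ + ‖(‖z‖ - lam) • ν‖ := by
        rw [e]; exact norm_add_le _ _
    _ ≤ (2 * lam) * (|K| * δ) + δ := by
        rw [norm_smul, norm_smul, hν, mul_one, norm_norm, Real.norm_eq_abs]
        gcongr
        · linarith
        · exact h2.trans (mul_le_mul_of_nonneg_right (le_abs_self K) hδ.le)
    _ ≤ _ := by linarith

lemma card_le_of_norm_sub_le {B : (Fin 3 → ℝ) ≃L[ℝ] E3} {G : ℝ}
    (hG : ∀ (S : Finset (Fin 3 → ℤ)) (v : E3), ∑ k ∈ S, Real.exp (-‖B (intVec k) - v‖) ≤ G)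
    {S : Finset (Fin 3 → ℤ)} {R : ℝ} (hG0 : 0 < G)
    (hS : ∀ k ∈ S, ∀ l ∈ S, ‖B (intVec k) - B (intVec l)‖ ≤ R) :
    (S.card : ℝ) ≤ Real.exp R * G := by
  rcases S.eq_empty_or_nonempty with rfl | ⟨l, hl⟩
  · simp only [Finset.card_empty, Nat.cast_zero]; positivity
  have h1 : (S.card : ℝ) * Real.exp (-R) ≤ G := by
    rw [← nsmul_eq_mul]
    refine (Finset.card_nsmul_le_sum _ _ _ fun k hk => ?_).trans (hG S (B (intVec l)))
    exact Real.exp_le_exp.2 (neg_le_neg (hS k hk l hl))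
  rw [Real.exp_neg, ← div_eq_mul_inv, div_le_iff₀ (Real.exp_pos R)] at h1
  linarith

theorem exists_card_add_le (B : (Fin 3 → ℝ) ≃L[ℝ] E3) (K : ℝ) :
    ∃ C : ℝ, 0 < C ∧ ∀ ν : E3, ‖ν‖ = 1 → ∀ lam δ : ℝ, 1 < lam → 0 < δ → δ < 1 → 1 < lam * δ →
      ∀ S : Finset (Fin 3 → ℤ), (∀ k ∈ S, IsCapPoint B K ν lam δ k) →
        (∀ k ∈ S, ∀ l ∈ S, 0 ≤ ⟪B (intVec k), B (intVec l)⟫_ℝ) →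
        ∀ u, ((S.filter fun k => u - k ∈ S).card : ℝ) ≤ C * (lam * δ) := by
  obtain ⟨C₀, hC₀, hcard⟩ := exists_card_capPoints_le B K
  obtain ⟨G, hG, hGS⟩ := exists_sum_exp_norm_le B
  set D : ℝ := 41 + 4 * |K| with hD
  have hK : 0 ≤ |K| := abs_nonneg K
  refine ⟨2 * C₀ + 112 * D * (Real.exp 13 * G), by positivity, ?_⟩
  intro ν hν lam δ hlam hδ hδ1 hM S hS hpos u
  have hM0 : 0 < lam * δ := by linarith
  have hDM : 1 ≤ D * (lam * δ) :=
    one_le_mul_of_one_le_of_one_le (by rw [hD]; linarith) hM.le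
  have hDM' : D * (lam * δ) = 41 * (lam * δ) + 4 * (|K| * (lam * δ)) := by rw [hD]; ring
  have hKM : 0 ≤ |K| * (lam * δ) := by positivity
  have hD0 : 0 < D := by rw [hD]; linarith
  clear_value D
  rcases lt_or_ge lam 2 with h2 | h2
  · have h1 : ((S.filter fun k => u - k ∈ S).card : ℝ) ≤ C₀ * (lam * δ) ^ 2 :=
      hcard ν hν lam δ hlam hδ hδ1 hM _ fun k hk => hS k (Finset.mem_filter.1 hk).1
    have h3 : lam * δ ≤ 2 := by nlinarith
    have h4 : 0 ≤ 112 * D * (Real.exp 13 * G) * (lam * δ) := by positivity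
    nlinarith [mul_le_mul_of_nonneg_left h3 (show 0 ≤ C₀ * (lam * δ) by positivity)]
  set P := S.filter fun k => u - k ∈ S with hP
  rcases P.eq_empty_or_nonempty with h0 | hne
  · rw [h0]; simp only [Finset.card_empty, Nat.cast_zero]; positivity
  have hPS : ∀ k ∈ P, k ∈ S ∧ u - k ∈ S := fun k hk => Finset.mem_filter.1 hk
  set w : E3 := (1 / 2 : ℝ) • B (intVec u) with hw
  have hrefl : ∀ k, B (intVec (u - k)) = w - (B (intVec k) - w) := fun k => by
    have : intVec (u - k) = intVec u - intVec k := by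
      ext i; simp [intVec]
    rw [this, map_sub, hw]
    module
  clear_value w
  have hshell : ∀ k ∈ S, |‖B (intVec k)‖ ^ 2 - lam ^ 2| ≤ 3 * (lam * δ) := fun k hk => by
    have := abs_lt.1 (hS k hk).1
    refine abs_le.2 ⟨?_, ?_⟩ <;> nlinarith [norm_nonneg (B (intVec k))]
  have hsq1 : ∀ k, ‖B (intVec k)‖ ^ 2 = ‖w‖ ^ 2 + 2 * ⟪w, B (intVec k) - w⟫_ℝ +
      ‖B (intVec k) - w‖ ^ 2 := fun k => by
    rw [← norm_add_sq_real, add_sub_cancel]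
  have hsq2 : ∀ k, ‖B (intVec (u - k))‖ ^ 2 = ‖w‖ ^ 2 - 2 * ⟪w, B (intVec k) - w⟫_ℝ +
      ‖B (intVec k) - w‖ ^ 2 := fun k => by
    rw [hrefl, norm_sub_sq_real]
  have hwn : lam / 3 ≤ ‖w‖ := by
    obtain ⟨k, hk⟩ := hne
    obtain ⟨k1, k2⟩ := hPS k hk
    have e1 : (2 : ℝ) • w = B (intVec k) + B (intVec (u - k)) := by
      rw [hrefl]; module
    have e2 : 4 * ‖w‖ ^ 2 = ‖B (intVec k) + B (intVec (u - k))‖ ^ 2 := by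
      rw [← e1, norm_smul (2 : ℝ) w, mul_pow]; norm_num
    rw [norm_add_sq_real] at e2
    have b1 := abs_lt.1 (hS k k1).1
    have b2 := abs_lt.1 (hS _ k2).1
    have b3 := hpos k k1 _ k2
    refine abs_le_of_sq_le_sq' ?_ (norm_nonneg w) |>.2
    have c1 : lam / 2 ≤ ‖B (intVec k)‖ := by linarith
    have c2 : lam / 2 ≤ ‖B (intVec (u - k))‖ := by linarith
    nlinarith
  have hw0 : 0 < ‖w‖ := by linarith
  obtain ⟨b, hb⟩ := exists_orthonormalBasis_apply_zero (e := ‖w‖⁻¹ • w) (by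
    rw [norm_smul, norm_inv, norm_norm, inv_mul_cancel₀ hw0.ne'])
  set z : (Fin 3 → ℤ) → ℝ := fun k => ⟪b 0, B (intVec k) - w⟫_ℝ with hz
  set x : (Fin 3 → ℤ) → ℝ := fun k => ⟪b 1, B (intVec k) - w⟫_ℝ with hx
  set y : (Fin 3 → ℤ) → ℝ := fun k => ⟪b 2, B (intVec k) - w⟫_ℝ with hy
  have hnorm : ∀ ξ : E3, ‖ξ‖ ^ 2 = ⟪b 0, ξ⟫_ℝ ^ 2 + ⟪b 1, ξ⟫_ℝ ^ 2 + ⟪b 2, ξ⟫_ℝ ^ 2 := fun ξ => by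
    have := b.sum_sq_norm_inner_right ξ
    simp only [Fin.sum_univ_three, Real.norm_eq_abs, sq_abs] at this
    exact this.symm
  have hdiff : ∀ k l, ‖B (intVec k) - B (intVec l)‖ ^ 2 =
      (z k - z l) ^ 2 + (x k - x l) ^ 2 + (y k - y l) ^ 2 := fun k l => by
    rw [hnorm, ← sub_sub_sub_cancel_right _ _ w]
    simp only [inner_sub_right, hz, hx, hy]
  have hz6 : ∀ k ∈ P, |z k| ≤ 6 := fun k hk => by
    obtain ⟨k1, k2⟩ := hPS k hk
    have e1 : ‖w‖ * z k = ⟪w, B (intVec k) - w⟫_ℝ := by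
      simp only [hz]
      rw [hb, real_inner_smul_left, mul_inv_cancel_left₀ hw0.ne']
    have e2 := hsq1 k
    have e3 := hsq2 k
    have b1 := abs_lt.1 (hS k k1).1
    have b2 := abs_lt.1 (hS _ k2).1
    have e4 : |‖w‖ * z k| ≤ 2 * lam := by
      rw [e1]
      have d1 : |‖B (intVec k)‖ - ‖B (intVec (u - k))‖| ≤ 2 := abs_le.2 ⟨by linarith, by linarith⟩
      have d2 : ‖B (intVec k)‖ + ‖B (intVec (u - k))‖ ≤ 4 * lam := by linarith
      have d3 : 4 * ⟪w, B (intVec k) - w⟫_ℝ = (‖B (intVec k)‖ - ‖B (intVec (u - k))‖) *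
          (‖B (intVec k)‖ + ‖B (intVec (u - k))‖) := by nlinarith
      have d4 : |4 * ⟪w, B (intVec k) - w⟫_ℝ| ≤ 2 * (4 * lam) := by
        rw [d3, abs_mul, abs_of_nonneg (a := ‖B (intVec k)‖ + _) (by positivity)]
        gcongr
      rw [abs_mul, abs_of_pos (by norm_num : (0 : ℝ) < 4)] at d4
      linarith
    rw [abs_mul, abs_norm] at e4
    nlinarith [abs_nonneg (z k)]
  have hpair : ∀ k ∈ P, ∀ l ∈ P, ‖B (intVec k) - B (intVec l)‖ ≤ D * (lam * δ) :=
    fun k hk l hl => by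
      have n1 := (hS k (hPS k hk).1).norm_sub_le hν hlam hδ hδ1 hM
      have n2 := (hS l (hPS l hl).1).norm_sub_le hν hlam hδ hδ1 hM
      rw [norm_sub_rev] at n2
      have := norm_sub_le_norm_sub_add_norm_sub (B (intVec k)) (lam • ν) (B (intVec l))
      linarith
  have hxy : ∀ k ∈ P, ∀ l ∈ P, |x k - x l| ≤ D * (lam * δ) ∧ |y k - y l| ≤ D * (lam * δ) :=
    fun k hk l hl => by
      have h1 := hpair k hk l hl
      have h2 := hdiff k l
      constructor <;> refine le_trans (abs_le_of_sq_le_sq ?_ (norm_nonneg _)) h1 <;>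
        nlinarith [sq_nonneg (z k - z l), sq_nonneg (x k - x l), sq_nonneg (y k - y l)]
  have key := card_annulus_le (S := P) (x := x) (y := y) (N := Real.exp 13 * G) (D := D)
    (M := lam * δ) (ρ := lam ^ 2 - ‖w‖ ^ 2) hDM (by positivity)
    (fun S' hS' h1 h2 => card_le_of_norm_sub_le hGS hG fun k hk l hl => by
      refine abs_le_of_sq_le_sq' ?_ (by norm_num) |>.2
      rw [hdiff]
      have p1 := abs_le.1 (hz6 k (hS' hk))
      have p2 := abs_le.1 (hz6 l (hS' hl))
      have p3 := abs_le.1 (h1 k hk l hl)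
      have p4 := abs_le.1 (h2 k hk l hl)
      have q1 := sq_le_sq' (a := z k - z l) (b := 12) (by linarith) (by linarith)
      have q2 := sq_le_sq' p3.1 p3.2
      have q3 := sq_le_sq' p4.1 p4.2
      linarith)
    (fun k hk => by
      obtain ⟨k1, k2⟩ := hPS k hk
      have e1 := hsq1 k
      have e2 := hsq2 k
      have e3 := hnorm (B (intVec k) - w)
      have e4 := abs_le.1 (hshell k k1)
      have e5 := abs_le.1 (hshell _ k2)
      have e6 := abs_le.1 (hz6 k hk)
      have e7 : z k ^ 2 ≤ 36 := by
        have := sq_le_sq' e6.1 e6.2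
        linarith
      have e8 : ‖B (intVec k) - w‖ ^ 2 = z k ^ 2 + x k ^ 2 + y k ^ 2 := e3
      have e9 := sq_nonneg (z k)
      exact abs_le.2 ⟨by linarith, by linarith⟩)
    (fun k hk l hl => (hxy k hk l hl).1) (fun k hk l hl => (hxy k hk l hl).2)
  refine key.trans ?_
  have : 0 ≤ C₀ * (lam * δ) := by positivity
  linarith

theorem exists_integral_pow_four_le (B : (Fin 3 → ℝ) ≃L[ℝ] E3) (K : ℝ) :
    ∃ C : ℝ, 0 < C ∧ ∀ ν : E3, ‖ν‖ = 1 → ∀ lam δ : ℝ, 1 < lam → 0 < δ → δ < 1 → 1 < lam * δ →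
      ∀ S : Finset (Fin 3 → ℤ), (∀ k ∈ S, IsCapPoint B K ν lam δ k) →
        ∀ a : (Fin 3 → ℤ) → ℂ, ∑ k ∈ S, ‖a k‖ ^ 2 ≤ 1 →
          ∫ x, ‖trigPoly S a x‖ ^ 4 ≤ C * (lam * δ) := by
  obtain ⟨C, hC, hcount⟩ := exists_card_add_le B K
  refine ⟨4096 * C, by positivity, ?_⟩
  intro ν hν lam δ hlam hδ hδ1 hM S hS a ha
  set σ : (Fin 3 → ℤ) → (Fin 3 → Bool) := fun k i => decide (0 ≤ B (intVec k) i) with hσ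
  have hpart : ∀ x, trigPoly S a x = ∑ s, trigPoly (S.filter fun k => σ k = s) a x := fun x =>
    (Finset.sum_fiberwise S σ _).symm
  have hpt : ∀ x, ‖trigPoly S a x‖ ^ 4 ≤
      512 * ∑ s, ‖trigPoly (S.filter fun k => σ k = s) a x‖ ^ 4 := fun x => by
    have h1 := pow_sum_div_card_le_sum_pow (s := (Finset.univ : Finset (Fin 3 → Bool)))
      (f := fun s => ‖trigPoly (S.filter fun k => σ k = s) a x‖) (fun _ _ => norm_nonneg _) 3
    have hcard : (Finset.univ : Finset (Fin 3 → Bool)).card = 8 := by simp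
    rw [hcard, div_le_iff₀ (by norm_num)] at h1
    calc ‖trigPoly S a x‖ ^ 4 ≤ (∑ s, ‖trigPoly (S.filter fun k => σ k = s) a x‖) ^ 4 := by
          rw [hpart]
          gcongr
          exact norm_sum_le _ _
      _ ≤ _ := h1
      _ = _ := by norm_num; ring
  have hint : ∀ S' : Finset (Fin 3 → ℤ),
      Integrable (fun x => ‖trigPoly S' a x‖ ^ 4) (volume : Measure T3) := fun S' =>
    ((continuous_trigPoly S' a).norm.pow 4).integrable_of_hasCompactSupport
      (HasCompactSupport.of_compactSpace _)
  have hclass : ∀ s, ∫ x, ‖trigPoly (S.filter fun k => σ k = s) a x‖ ^ 4 ≤ C * (lam * δ) := by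
    intro s
    set P := S.filter fun k => σ k = s with hP
    have hP1 : ∀ k ∈ P, IsCapPoint B K ν lam δ k := fun k hk => hS k (Finset.mem_filter.1 hk).1
    have hP2 : ∀ k ∈ P, ∀ l ∈ P, 0 ≤ ⟪B (intVec k), B (intVec l)⟫_ℝ := fun k hk l hl => by
      rw [PiLp.inner_apply]
      refine Finset.sum_nonneg fun i _ => ?_
      have e : σ k i = σ l i := by
        rw [(Finset.mem_filter.1 hk).2, (Finset.mem_filter.1 hl).2]
      simp only [hσ, decide_eq_decide] at e
      simp only [RCLike.inner_apply, conj_trivial]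
      rcases le_or_gt 0 (B (intVec k) i) with h | h
      · exact mul_nonneg (e.1 h) h
      · exact mul_nonneg_of_nonpos_of_nonpos (not_le.1 fun h' => h.not_ge (e.2 h')).le h.le
    have h1 := integral_norm_pow_four_trigPoly_le (a := a)
      (hcount ν hν lam δ hlam hδ hδ1 hM P hP1 hP2)
    have h2 : ∑ k ∈ P, ‖a k‖ ^ 2 ≤ 1 :=
      (Finset.sum_le_sum_of_subset_of_nonneg (Finset.filter_subset _ _)
        fun _ _ _ => by positivity).trans ha
    have h3 : (∑ k ∈ P, ‖a k‖ ^ 2) ^ 2 ≤ 1 := pow_le_one₀ (by positivity) h2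
    exact h1.trans (mul_le_of_le_one_right (by positivity) h3)
  calc ∫ x, ‖trigPoly S a x‖ ^ 4 ≤
      ∫ x, 512 * ∑ s, ‖trigPoly (S.filter fun k => σ k = s) a x‖ ^ 4 :=
        integral_mono (hint S) ((integrable_finsetSum _ fun s _ => hint _).const_mul _) hpt
    _ = 512 * ∑ s, ∫ x, ‖trigPoly (S.filter fun k => σ k = s) a x‖ ^ 4 := by
        rw [integral_const_mul, integral_finsetSum _ fun s _ => hint _]
    _ ≤ 512 * ∑ s : Fin 3 → Bool, C * (lam * δ) := by
        gcongr with s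
        exact hclass s
    _ = _ := by
        simp only [Finset.sum_const, Finset.card_univ, Fintype.card_pi, Fintype.card_bool,
          Finset.prod_const, nsmul_eq_mul, Fintype.card_fin]
        norm_num
        ring

theorem exists_integral_rpow_trigPoly_le {B T : (Fin 3 → ℝ) ≃L[ℝ] E3} {c : ℝ} (hc : 0 < c)
    (hBT : ∀ x u, ⟪B x, T u⟫_ℝ = 2 * Real.pi * ∑ i, x i * u i)
    (hT : ∀ g : E3 → ℂ, ∫ y, g y = c * ∫ u, g (T u)) (K : ℝ) {p : ℝ} (hp : 4 ≤ p) :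
    ∃ C : ℝ, 0 < C ∧ ∀ ν : E3, ‖ν‖ = 1 → ∀ lam δ : ℝ, 1 < lam → 0 < δ → δ < 1 → 1 < lam * δ →
      ∀ S : Finset (Fin 3 → ℤ), (∀ k ∈ S, IsCapPoint B K ν lam δ k) →
        ∀ a : (Fin 3 → ℤ) → ℂ, ∑ k ∈ S, ‖a k‖ ^ 2 ≤ 1 →
          ∫ x, ‖trigPoly S a x‖ ^ p ≤
            C * (lam ^ (p - 3) * δ ^ (p / 2) + (lam * δ) ^ (p / 2 - 1)) := by
  rcases hp.eq_or_lt with rfl | hp'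
  · obtain ⟨C, hC, h⟩ := exists_integral_pow_four_le B K
    refine ⟨C, hC, fun ν hν lam δ hlam hδ hδ1 hM S hS a ha => ?_⟩
    have h1 := h ν hν lam δ hlam hδ hδ1 hM S hS a ha
    have e : ∀ x, ‖trigPoly S a x‖ ^ (4 : ℝ) = ‖trigPoly S a x‖ ^ 4 := fun x => by
      exact_mod_cast Real.rpow_natCast _ 4
    simp_rw [e]
    refine h1.trans ?_
    have e2 : (lam * δ) ^ ((4 : ℝ) / 2 - 1) = lam * δ := by norm_num
    rw [e2]
    have : 0 ≤ lam ^ ((4 : ℝ) - 3) * δ ^ ((4 : ℝ) / 2) := by positivity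
    exact mul_le_mul_of_nonneg_left (by linarith) hC.le
  · exact exists_integral_rpow_le hc hBT hT K hp'

/-- Taking the `p`-th root of an estimate for normalized coefficients. -/
lemma rpow_integral_trigPoly_le {S : Finset (Fin 3 → ℤ)} {p X : ℝ} (hp : 0 < p)
    (h : ∀ a : (Fin 3 → ℤ) → ℂ, ∑ k ∈ S, ‖a k‖ ^ 2 ≤ 1 → ∫ x, ‖trigPoly S a x‖ ^ p ≤ X)
    (a : (Fin 3 → ℤ) → ℂ) :
    (∫ x, ‖trigPoly S a x‖ ^ p) ^ (1 / p) ≤ X ^ (1 / p) * √(∑ k ∈ S, ‖a k‖ ^ 2) := by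
  set l := √(∑ k ∈ S, ‖a k‖ ^ 2) with hl
  have hl2 : l ^ 2 = ∑ k ∈ S, ‖a k‖ ^ 2 := Real.sq_sqrt (by positivity)
  have hl0 : 0 ≤ l := Real.sqrt_nonneg _
  rcases hl0.eq_or_lt with h0 | hpos
  · have hz : ∀ k ∈ S, a k = 0 := fun k hk => by
      rw [← h0] at hl2
      have := (Finset.sum_eq_zero_iff_of_nonneg fun k _ => by positivity).1
        (by rw [← hl2]; norm_num : ∑ k ∈ S, ‖a k‖ ^ 2 = 0) k hk
      simpa using this
    have hf : ∀ x, trigPoly S a x = 0 := fun x =>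
      Finset.sum_eq_zero fun k hk => by rw [hz k hk, zero_mul]
    rw [← h0]
    simp [hf, hp.ne']
  · set b : (Fin 3 → ℤ) → ℂ := fun k => (l : ℂ)⁻¹ * a k with hb
    have hbn : ∑ k ∈ S, ‖b k‖ ^ 2 ≤ 1 := by
      simp only [hb, norm_mul, mul_pow, ← Finset.mul_sum, ← hl2, norm_inv, norm_real,
        Real.norm_eq_abs, abs_of_pos hpos]
      rw [← mul_pow, inv_mul_cancel₀ hpos.ne', one_pow]
    have hab : ∀ x, ‖trigPoly S a x‖ ^ p = l ^ p * ‖trigPoly S b x‖ ^ p := fun x => by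
      have : trigPoly S a x = l * trigPoly S b x := by
        have hl' : (l : ℂ) ≠ 0 := by exact_mod_cast hpos.ne'
        rw [trigPoly, trigPoly, Finset.mul_sum]
        refine Finset.sum_congr rfl fun k _ => ?_
        simp only [hb]
        rw [← mul_assoc, mul_inv_cancel_left₀ hl']
      rw [this, norm_mul, norm_real, Real.norm_eq_abs, abs_of_pos hpos,
        Real.mul_rpow hl0 (norm_nonneg _)]
    have hI : 0 ≤ ∫ x, ‖trigPoly S b x‖ ^ p := integral_nonneg fun x => by positivity
    simp_rw [hab]
    rw [integral_const_mul, Real.mul_rpow (by positivity) hI, ← Real.rpow_mul hl0,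
      mul_one_div_cancel hp.ne', Real.rpow_one, mul_comm]
    gcongr
    exact h b hbn

lemma integral_cube_eq (g : T3 → ℝ) :
    ∫ x in Set.univ.pi fun _ : Fin 3 => Set.Icc (0 : ℝ) 1, g (torusMk x) = ∫ x, g x := by
  rw [UnitAddTorus.integral_preimage g 0]
  have h1 : {x : Fin 3 → ℝ | ∀ i, x i ∈ Set.Ioc ((0 : Fin 3 → ℝ) i) ((0 : Fin 3 → ℝ) i + 1)} =
      Set.univ.pi fun _ : Fin 3 => Set.Ioc (0 : ℝ) 1 := by
    ext x; simp
  rw [h1]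
  have h2 : (Set.univ.pi fun _ : Fin 3 => Set.Ioc (0 : ℝ) 1) =ᵐ[volume]
      Set.univ.pi fun _ : Fin 3 => Set.Icc (0 : ℝ) 1 :=
    Measure.ae_eq_set_pi fun _ _ => Ioc_ae_eq_Icc
  exact (setIntegral_congr_set h2).symm

lemma trigSum_eq_trigPoly (a : (Fin 3 → ℤ) →₀ ℂ) (x : Fin 3 → ℝ) :
    trigSum a x = trigPoly a.support a (torusMk x) :=
  Finset.sum_congr rfl fun k _ => by rw [mFourier_torusMk]

lemma lpNorm_eq (p : ℝ) (a : (Fin 3 → ℤ) →₀ ℂ) :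
    lpNorm p a = (∫ x, ‖trigPoly a.support a x‖ ^ p) ^ (1 / p) := by
  rw [_root_.lpNorm, ← integral_cube_eq fun x => ‖trigPoly a.support a x‖ ^ p]
  simp_rw [trigSum_eq_trigPoly]

lemma norm_le_enorm3 (z : Fin 3 → ℝ) : ‖z‖ ≤ enorm3 z := by
  refine (pi_norm_le_iff_of_nonneg (Real.sqrt_nonneg _)).2 fun i => ?_
  exact Real.abs_le_sqrt (Finset.single_le_sum (f := fun i => z i ^ 2)
    (fun i _ => sq_nonneg (z i)) (Finset.mem_univ i))

lemma rpow_inv_shell_le {C lam δ p : ℝ} (hC : 0 < C) (hlam : 0 < lam) (hδ : 0 < δ) (hp : 1 ≤ p) :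
    (C * (lam ^ (p - 3) * δ ^ (p / 2) + (lam * δ) ^ (p / 2 - 1))) ^ (1 / p) ≤
      C ^ (1 / p) * (lam ^ (1 - 3 / p) * δ ^ ((1 : ℝ) / 2) + (lam * δ) ^ (1 / 2 - 1 / p)) := by
  have hp0 : 0 < p := by linarith
  rw [Real.mul_rpow hC.le (by positivity)]
  gcongr
  refine (Real.rpow_add_le_add_rpow (by positivity) (by positivity) (by positivity)
    ((div_le_one hp0).2 hp)).trans_eq ?_
  rw [Real.mul_rpow (by positivity) (by positivity), ← Real.rpow_mul hlam.le,
    ← Real.rpow_mul hδ.le, ← Real.rpow_mul (by positivity)]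
  congr 3 <;> field_simp

end ShellCap

theorem statement6 (A : Matrix (Fin 3) (Fin 3) ℝ) (hA : A.IsSymm) (hApd : A.PosDef)
    (κ p : ℝ) (hκ : 0 < κ) (hp4 : 4 ≤ p) :
    ∃ C : ℝ, 0 < C ∧
      ∀ lam δ : ℝ, 1 < lam → lam ^ (κ - 1) < δ → δ < 1 →
        ∀ ν : Fin 3 → ℝ, Qform A ν = 1 →
          ∀ a : (Fin 3 → ℤ) →₀ ℂ,
            (∀ k ∈ a.support,
              |Real.sqrt (Qform A fun i => (k i : ℝ)) - lam| < δ ∧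
              enorm3 ((Real.sqrt (Qform A fun i => (k i : ℝ)))⁻¹ • (fun i => (k i : ℝ)) - ν) < δ) →
            lpNorm p a ≤
              C * (lam ^ (1 - 3 / p) * δ ^ ((1:ℝ) / 2) + (lam * δ) ^ (1 / 2 - 1 / p)) * l2Norm a := by
  obtain ⟨B, T, c, hc, hB, hBT, hT⟩ := ShellCap.exists_coordinates hApd
  set K := ‖(B : (Fin 3 → ℝ) →L[ℝ] ShellCap.E3)‖ with hK
  have hBn : ∀ z, ‖B z‖ = √(Qform A z) := fun z => by
    rw [← hB, Real.sqrt_sq (norm_nonneg _)]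
  have hBK : ∀ z, ‖B z‖ ≤ K * enorm3 z := fun z =>
    ((B : (Fin 3 → ℝ) →L[ℝ] ShellCap.E3).le_opNorm z).trans
      (mul_le_mul_of_nonneg_left (ShellCap.norm_le_enorm3 z) (norm_nonneg _))
  obtain ⟨C, hC, h⟩ := ShellCap.exists_integral_rpow_trigPoly_le hc hBT hT K hp4
  refine ⟨C ^ (1 / p), by positivity, fun lam δ hlam hδ hδ1 ν hν a ha => ?_⟩
  have hlam0 : 0 < lam := by linarith
  have hδ0 : 0 < δ := (Real.rpow_pos_of_pos hlam0 _).trans hδ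
  have hM : 1 < lam * δ := by
    calc 1 < lam ^ κ := Real.one_lt_rpow hlam hκ
      _ = lam * lam ^ (κ - 1) := by rw [← Real.rpow_one_add' hlam0.le (by linarith)]; ring_nf
      _ < lam * δ := by gcongr
  have hcap : ∀ k ∈ a.support, ShellCap.IsCapPoint B K (B ν) lam δ k := fun k hk => by
    obtain ⟨h1, h2⟩ := ha k hk
    refine ⟨by rw [hBn]; exact h1, ?_⟩
    rw [hBn, ← map_smul, ← map_sub]
    exact (hBK _).trans (mul_le_mul_of_nonneg_left h2.le (norm_nonneg _))
  have key := ShellCap.rpow_integral_trigPoly_le (by linarith)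
    (h (B ν) (by rw [hBn, hν, Real.sqrt_one]) lam δ hlam hδ0 hδ1 hM a.support hcap) a
  rw [← ShellCap.lpNorm_eq, Real.sqrt_eq_rpow] at key
  refine key.trans (mul_le_mul_of_nonneg_right ?_ (by positivity))
  exact ShellCap.rpow_inv_shell_le hC hlam0 hδ0 (by linarith)
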